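/- arXiv:2212.13147 — 9 statements merged into one kernel-verified Lean document; each statement's English description precedes it below -/
import Mathlib

section
/- Let (X,Σ,μ) be a σ-finite measure space and {P(t)}_{t≥0} a continuous-time stochastic semigroup on L¹(X,Σ,μ) that is partially integral, i.e. there exist t₀ > 0 and a measurable kernel k : X × X → [0,∞] with ∫_X∫_X k(x,y) μ(dy) μ(dx) > 0 such that P(t₀)f(y) ≥ ∫_X k(x,y) f(x) μ(dx) for μ-a.e. y and every density f. If {P(t)}_{t≥0} has a unique invariant density f* (P(t)f* = f* for all t ≥ 0) and f* > 0 μ-a.e., then the semigroup is asymptotically stable: for every density f, ‖P(t)f − f*‖_{L¹} → 0 as t → ∞. -/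
open MeasureTheory Filter Topology

set_option linter.unusedSectionVars false

section AbsLat

variable {E : Type*} [NormedAddCommGroup E] [Lattice E] [HasSolidNorm E]
  [IsOrderedAddMonoid E] [NormedSpace ℝ E] [IsOrderedModule ℝ E]

lemma al_norm_mono {a b : E} (ha : 0 ≤ a) (hab : a ≤ b) : ‖a‖ ≤ ‖b‖ := by
  apply norm_le_norm_of_abs_le_abs
  rwa [abs_of_nonneg ha, abs_of_nonneg (ha.trans hab)]

lemma al_norm_sub (hadd : ∀ a b : E, 0 ≤ a → 0 ≤ b → ‖a + b‖ = ‖a‖ + ‖b‖)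
    {a b : E} (ha : 0 ≤ a) (hab : a ≤ b) : ‖b - a‖ = ‖b‖ - ‖a‖ := by
  have := hadd a (b - a) ha (sub_nonneg.2 hab)
  rw [add_sub_cancel] at this
  linarith

lemma al_eq (hadd : ∀ a b : E, 0 ≤ a → 0 ≤ b → ‖a + b‖ = ‖a‖ + ‖b‖)
    {a b : E} (ha : 0 ≤ a) (hab : a ≤ b) (h : ‖b‖ ≤ ‖a‖) : a = b := by
  have h1 := al_norm_sub hadd ha hab
  have h2 : ‖b - a‖ = 0 := le_antisymm (by linarith) (norm_nonneg _)
  exact (sub_eq_zero.1 (norm_eq_zero.1 h2)).symm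

lemma al_anti [CompleteSpace E] (hadd : ∀ a b : E, 0 ≤ a → 0 ≤ b → ‖a + b‖ = ‖a‖ + ‖b‖)
    {a : ℕ → E} (ha : Antitone a) (h0 : ∀ n, 0 ≤ a n) :
    ∃ l, Tendsto a atTop (𝓝 l) ∧ 0 ≤ l ∧ ∀ n, l ≤ a n := by
  have hn : Antitone (fun n => ‖a n‖) := fun m n h => al_norm_mono (h0 n) (ha h)
  have hlim := tendsto_atTop_ciInf hn ⟨0, by rintro _ ⟨n, rfl⟩; exact norm_nonneg _⟩
  have hC := hlim.cauchySeq
  have : CauchySeq a := by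
    rw [Metric.cauchySeq_iff] at hC ⊢
    intro ε hε
    obtain ⟨N, hN⟩ := hC ε hε
    refine ⟨N, fun m hm n hn' => ?_⟩
    have key := hN m hm n hn'
    rw [Real.dist_eq] at key
    rw [dist_eq_norm]
    rcases le_total m n with h | h
    · rw [al_norm_sub hadd (h0 n) (ha h)]
      exact lt_of_le_of_lt (le_abs_self _) key
    · rw [← norm_neg, neg_sub, al_norm_sub hadd (h0 m) (ha h)]
      rw [abs_sub_comm] at key
      exact lt_of_le_of_lt (le_abs_self _) key
  obtain ⟨l, hl⟩ := cauchySeq_tendsto_of_complete this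
  exact ⟨l, hl, ge_of_tendsto' hl h0, fun n => le_of_tendsto hl
    (eventually_atTop.2 ⟨n, fun m hm => ha hm⟩)⟩

lemma al_mono [CompleteSpace E] (hadd : ∀ a b : E, 0 ≤ a → 0 ≤ b → ‖a + b‖ = ‖a‖ + ‖b‖)
    {a : ℕ → E} {f : E} (ha : Monotone a) (h0 : ∀ n, a n ≤ f) :
    ∃ l, Tendsto a atTop (𝓝 l) ∧ l ≤ f ∧ ∀ n, a n ≤ l := by
  obtain ⟨l, hl, h1, h2⟩ := al_anti hadd (a := fun n => f - a n)
    (fun m n h => sub_le_sub_left (ha h) f) (fun n => sub_nonneg.2 (h0 n))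
  refine ⟨f - l, ?_, sub_le_self _ h1, fun n => ?_⟩
  · have := (tendsto_const_nhds (x := f)).sub hl
    simpa using this
  · have := h2 n
    exact le_sub_comm.1 this

lemma al_inf_add {w a b : E} (hw : 0 ≤ w) (ha : 0 ≤ a) (hb : 0 ≤ b) (h1 : w ⊓ a = 0)
    (h2 : w ⊓ b = 0) : w ⊓ (a + b) = 0 := by
  apply le_antisymm _ (le_inf hw (add_nonneg ha hb))
  have h3 : w ⊓ (a + b) - a ≤ w ⊓ b := by
    apply le_inf
    · exact (sub_le_self _ ha).trans inf_le_left
    · exact sub_le_iff_le_add'.2 inf_le_right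
  rw [h2, sub_nonpos] at h3
  calc w ⊓ (a + b) ≤ w ⊓ a := le_inf inf_le_left h3
    _ = 0 := h1

lemma al_smul_inf {c : ℝ} (hc : 0 < c) (a b : E) : c • (a ⊓ b) = c • a ⊓ c • b :=
  (OrderIso.smulRight (β := E) hc).map_inf a b

lemma al_smul_sup {c : ℝ} (hc : 0 < c) (a b : E) : c • (a ⊔ b) = c • a ⊔ c • b :=
  (OrderIso.smulRight (β := E) hc).map_sup a b

lemma al_pos_mono {K : E →L[ℝ] E} (hK : ∀ f, 0 ≤ f → 0 ≤ K f) {a b : E} (h : a ≤ b) :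
    K a ≤ K b := by
  have := hK (b - a) (sub_nonneg.2 h)
  rwa [map_sub, sub_nonneg] at this

/-- data of an abstract stochastic semigroup with unique invariant density -/
structure AbsSem (P : ℝ → E →L[ℝ] E) (fs : E) : Prop where
  add : ∀ a b : E, 0 ≤ a → 0 ≤ b → ‖a + b‖ = ‖a‖ + ‖b‖
  zero : ∀ f, P 0 f = f
  sem : ∀ s t : ℝ, 0 ≤ s → 0 ≤ t → ∀ f, P (s + t) f = P s (P t f)
  cont : ∀ f, ContinuousOn (fun t => P t f) (Set.Ici 0)
  pos : ∀ t, 0 ≤ t → ∀ f, 0 ≤ f → 0 ≤ P t f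
  norm : ∀ t, 0 ≤ t → ∀ f, 0 ≤ f → ‖P t f‖ = ‖f‖
  fpos : 0 ≤ fs
  fnorm : ‖fs‖ = 1
  finv : ∀ t, 0 ≤ t → P t fs = fs
  uniq : ∀ g, 0 ≤ g → ‖g‖ = 1 → (∀ t, 0 ≤ t → P t g = g) → g = fs

variable {P : ℝ → E →L[ℝ] E} {fs : E}

lemma AbsSem.mono (H : AbsSem P fs) {t : ℝ} (ht : 0 ≤ t) {a b : E} (h : a ≤ b) :
    P t a ≤ P t b := al_pos_mono (H.pos t ht) h

lemma AbsSem.le_fs (H : AbsSem P fs) {t : ℝ} (ht : 0 ≤ t) {a : E} (h : a ≤ fs) :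
    P t a ≤ fs := by
  have := H.mono ht h
  rwa [H.finv t ht] at this

lemma AbsSem.norm_posneg (H : AbsSem P fs) (x : E) : ‖x‖ = ‖x⁺‖ + ‖x⁻‖ := by
  rw [← H.add _ _ (posPart_nonneg _) (negPart_nonneg _), posPart_add_negPart, norm_abs_eq_norm]

lemma AbsSem.contr (H : AbsSem P fs) {t : ℝ} (ht : 0 ≤ t) (x : E) : ‖P t x‖ ≤ ‖x‖ := by
  conv_lhs => rw [← posPart_sub_negPart x, map_sub]
  refine (norm_sub_le _ _).trans ?_
  rw [H.norm t ht _ (posPart_nonneg _), H.norm t ht _ (negPart_nonneg _), H.norm_posneg x]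

lemma AbsSem.inv_eq (H : AbsSem P fs) {z : E} (hz : 0 ≤ z) (h : ∀ t, 0 ≤ t → P t z = z) :
    z = ‖z‖ • fs := by
  by_cases h0 : z = 0
  · simp [h0]
  have hn : 0 < ‖z‖ := norm_pos_iff.2 h0
  have := H.uniq (‖z‖⁻¹ • z) (smul_nonneg (by positivity) hz)
    (by rw [norm_smul, norm_inv, norm_norm, inv_mul_cancel₀ hn.ne'])
    (fun t ht => by rw [map_smul, h t ht])
  rw [← this, smul_smul, mul_inv_cancel₀ hn.ne', one_smul]

lemma AbsSem.lemA [CompleteSpace E] (H : AbsSem P fs) {K : E →L[ℝ] E}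
    (hK : ∀ f, 0 ≤ f → 0 ≤ K f) {w h : E} (hw : 0 ≤ w) (h0 : 0 ≤ h) (h1 : h ≤ fs)
    (hh : ∀ s, 0 ≤ s → w ⊓ K (P s h) = 0) : h = 0 ∨ w ⊓ K fs = 0 := by
  by_cases hne : h = 0
  · exact Or.inl hne
  right
  let N : Set E := {v | 0 ≤ v ∧ v ≤ fs ∧ ∀ s, 0 ≤ s → w ⊓ K (P s v) = 0}
  have hNh : h ∈ N := ⟨h0, h1, hh⟩
  have hNsup : ∀ a ∈ N, ∀ b ∈ N, a ⊔ b ∈ N := by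
    rintro a ⟨a0, a1, a2⟩ b ⟨b0, b1, b2⟩
    refine ⟨le_sup_of_le_left a0, sup_le a1 b1, fun s hs => ?_⟩
    have p : 0 ≤ K (P s (a ⊔ b)) := hK _ (H.pos s hs _ (le_sup_of_le_left a0))
    apply le_antisymm _ (le_inf hw p)
    have q : K (P s (a ⊔ b)) ≤ K (P s a) + K (P s b) := by
      rw [← map_add, ← map_add]
      apply al_pos_mono hK
      apply H.mono hs
      exact sup_le (le_add_of_nonneg_right b0) (le_add_of_nonneg_left a0)
    refine (inf_le_inf_left w q).trans (le_of_eq ?_)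
    exact al_inf_add hw (hK _ (H.pos s hs _ a0)) (hK _ (H.pos s hs _ b0)) (a2 s hs) (b2 s hs)
  have hNP : ∀ t, 0 ≤ t → ∀ a ∈ N, P t a ∈ N := by
    rintro t ht a ⟨a0, a1, a2⟩
    refine ⟨H.pos t ht _ a0, H.le_fs ht a1, fun s hs => ?_⟩
    rw [← H.sem s t hs ht]
    exact a2 _ (add_nonneg hs ht)
  have hNcl : ∀ (u : ℕ → E) (z : E), (∀ n, u n ∈ N) → Tendsto u atTop (𝓝 z) → z ∈ N := by
    intro u z hu hz
    refine ⟨ge_of_tendsto' hz fun n => (hu n).1, le_of_tendsto' hz fun n => (hu n).2.1,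
      fun s hs => ?_⟩
    have c : Continuous (fun v => w ⊓ K (P s v)) :=
      continuous_const.inf (K.continuous.comp (P s).continuous)
    have := (c.tendsto z).comp hz
    refine tendsto_nhds_unique this ?_
    refine tendsto_const_nhds.congr fun n => ?_
    exact ((hu n).2.2 s hs).symm
  let S : Set ℝ := (fun v : E => ‖v‖) '' N
  have hSb : BddAbove S := ⟨1, by
    rintro _ ⟨v, hv, rfl⟩
    rw [← H.fnorm]
    exact al_norm_mono hv.1 hv.2.1⟩
  have hSn : S.Nonempty := ⟨_, h, hNh, rfl⟩
  have hex : ∀ n : ℕ, ∃ v ∈ N, sSup S - 1 / ((n : ℝ) + 1) < ‖v‖ := by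
    intro n
    have : sSup S - 1 / ((n : ℝ) + 1) < sSup S := by
      have : 0 < 1 / ((n : ℝ) + 1) := by positivity
      linarith
    obtain ⟨_, ⟨v, hv, rfl⟩, h⟩ := exists_lt_of_lt_csSup hSn this
    exact ⟨v, hv, h⟩
  choose v hvN hv using hex
  have hpN : ∀ n, partialSups v n ∈ N := by
    intro n
    induction n with
    | zero => simpa using hvN 0
    | succ n ih => rw [partialSups_add_one]; exact hNsup _ ih _ (hvN _)
  obtain ⟨z, hz, hz1, hz2⟩ := al_mono H.add (partialSups v).monotone (fun n => (hpN n).2.1)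
  have hzN : z ∈ N := hNcl _ z hpN hz
  have hzS : sSup S ≤ ‖z‖ := by
    have t : Tendsto (fun n : ℕ => sSup S - 1 / ((n : ℝ) + 1)) atTop (𝓝 (sSup S - 0)) :=
      tendsto_const_nhds.sub tendsto_one_div_add_atTop_nhds_zero_nat
    rw [sub_zero] at t
    refine le_of_tendsto' t fun n => (hv n).le.trans ?_
    exact al_norm_mono (hvN n).1 ((le_partialSups v n).trans (hz2 n))
  have hzinv : ∀ t, 0 ≤ t → P t z = z := by
    intro t ht
    have m := hNsup _ hzN _ (hNP t ht z hzN)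
    have e : z = z ⊔ P t z := al_eq H.add hzN.1 le_sup_left
      ((le_csSup hSb ⟨_, m, rfl⟩).trans hzS)
    have e' : P t z ≤ z := by rw [e]; exact le_sup_of_le_right (by rw [← e])
    exact al_eq H.add (H.pos t ht _ hzN.1) e' (H.norm t ht _ hzN.1).ge
  have hzp : 0 < ‖z‖ := by
    refine lt_of_lt_of_le (norm_pos_iff.2 hne) ((le_csSup hSb ⟨_, hNh, rfl⟩).trans hzS)
  have hzf := H.inv_eq hzN.1 hzinv
  have q := hzN.2.2 0 le_rfl
  rw [H.zero] at q
  have hle1 : ‖z‖ ≤ 1 := by rw [← H.fnorm]; exact al_norm_mono hzN.1 hzN.2.1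
  rw [hzf, map_smul] at q
  have kf := hK _ H.fpos
  apply le_antisymm _ (le_inf hw kf)
  have : ‖z‖ • (w ⊓ K fs) ≤ 0 := by
    rw [al_smul_inf hzp, ← q]
    refine inf_le_inf_right _ ?_
    calc ‖z‖ • w ≤ (1 : ℝ) • w := smul_le_smul_of_nonneg_right hle1 hw
      _ = w := one_smul _ _
  have h3 := smul_le_smul_of_nonneg_left this (inv_nonneg.2 hzp.le)
  rwa [smul_smul, inv_mul_cancel₀ hzp.ne', one_smul, smul_zero] at h3

lemma tb_of_approx {A : Set E} (h : ∀ ε > 0, ∃ B : Set E, TotallyBounded B ∧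
    ∀ a ∈ A, ∃ b ∈ B, ‖a - b‖ < ε) : TotallyBounded A := by
  rw [Metric.totallyBounded_iff]
  intro ε hε
  obtain ⟨B, hB, hAB⟩ := h (ε / 2) (by positivity)
  obtain ⟨t, ht, hBt⟩ := Metric.totallyBounded_iff.1 hB (ε / 2) (by positivity)
  refine ⟨t, ht, fun a ha => ?_⟩
  obtain ⟨b, hb, hab⟩ := hAB a ha
  have := hBt hb
  simp only [Set.mem_iUnion, Metric.mem_ball, exists_prop] at this ⊢
  obtain ⟨y, hy, hby⟩ := this
  refine ⟨y, hy, ?_⟩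
  have := dist_triangle a b y
  rw [← dist_eq_norm] at hab
  linarith

lemma tb_add {A B C : Set E} (hA : TotallyBounded A) (hB : TotallyBounded B)
    (h : ∀ c ∈ C, ∃ a ∈ A, ∃ b ∈ B, c = a + b) : TotallyBounded C := by
  rw [Metric.totallyBounded_iff] at *
  intro ε hε
  obtain ⟨s, hs, hAs⟩ := hA (ε / 2) (by positivity)
  obtain ⟨t, ht, hBt⟩ := hB (ε / 2) (by positivity)
  refine ⟨Set.image2 (· + ·) s t, hs.image2 _ ht, fun c hc => ?_⟩
  obtain ⟨a, ha, b, hb, rfl⟩ := h c hc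
  have h1 := hAs ha
  have h2 := hBt hb
  simp only [Set.mem_iUnion, Metric.mem_ball, exists_prop] at h1 h2 ⊢
  obtain ⟨x, hx, h1⟩ := h1
  obtain ⟨y, hy, h2⟩ := h2
  refine ⟨x + y, Set.mem_image2_of_mem hx hy, ?_⟩
  have := dist_add_add_le a b x y
  linarith

lemma tb_clm {A : Set E} (hA : TotallyBounded A) (R : E →L[ℝ] E) : TotallyBounded (R '' A) :=
  hA.image R.uniformContinuous

/-- `R` is dominated by `P t` and equals it modulo a compact part. -/
structure GG (P : ℝ → E →L[ℝ] E) (fs : E) (t : ℝ) (R : E →L[ℝ] E) : Prop where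
  tnn : 0 ≤ t
  pos : ∀ f, 0 ≤ f → 0 ≤ R f
  dom : ∀ f, 0 ≤ f → R f ≤ P t f
  tb : TotallyBounded ((P t - R) '' Set.Icc 0 fs)

lemma GG.comp (H : AbsSem P fs) {t₁ t₂ : ℝ} {R₁ R₂ : E →L[ℝ] E} (h₁ : GG P fs t₁ R₁)
    (h₂ : GG P fs t₂ R₂) : GG P fs (t₁ + t₂) (R₁.comp R₂) where
  tnn := add_nonneg h₁.tnn h₂.tnn
  pos f hf := h₁.pos _ (h₂.pos _ hf)
  dom f hf := by
    rw [H.sem _ _ h₁.tnn h₂.tnn]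
    exact (h₁.dom _ (h₂.pos _ hf)).trans (H.mono h₁.tnn (h₂.dom _ hf))
  tb := by
    refine tb_add h₁.tb (tb_clm h₂.tb R₁) ?_
    rintro _ ⟨x, hx, rfl⟩
    refine ⟨_, ⟨P t₂ x, ⟨H.pos _ h₂.tnn _ hx.1, H.le_fs h₂.tnn hx.2⟩, rfl⟩, _,
      ⟨_, ⟨x, hx, rfl⟩, rfl⟩, ?_⟩
    simp [H.sem _ _ h₁.tnn h₂.tnn]

lemma AbsSem.lemB [CompleteSpace E] (H : AbsSem P fs) {K : E →L[ℝ] E} {t₀ : ℝ} (ht₀ : 0 ≤ t₀)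
    (hK : ∀ f, 0 ≤ f → 0 ≤ K f) (hKP : ∀ f, 0 ≤ f → K f ≤ P t₀ f)
    (hKtb : TotallyBounded (K '' Set.Icc 0 fs)) (hKf : K fs ≠ 0) (ε : ℝ) (hε : 0 < ε) :
    ∃ t R, GG P fs t R ∧ ‖R fs‖ < ε := by
  let S : Set ℝ := {r | ∃ t R, GG P fs t R ∧ r = ‖R fs‖}
  have hSb : BddBelow S := ⟨0, by rintro _ ⟨t, R, -, rfl⟩; exact norm_nonneg _⟩
  have hid : GG P fs 0 (ContinuousLinearMap.id ℝ E) := by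
    refine ⟨le_rfl, fun f hf => hf, fun f hf => by simp [H.zero], ?_⟩
    refine (Set.Finite.totallyBounded (Set.finite_singleton (0 : E))).subset ?_
    rintro _ ⟨x, -, rfl⟩
    simp [H.zero]
  have hSn : S.Nonempty := ⟨_, 0, _, hid, rfl⟩
  set α := sInf S with hα
  have hex : ∀ n : ℕ, ∃ t R, GG P fs t R ∧ ‖R fs‖ < α + 1 / ((n : ℝ) + 1) := by
    intro n
    have : sInf S < α + 1 / ((n : ℝ) + 1) := by
      have : 0 < 1 / ((n : ℝ) + 1) := by positivity
      linarith
    obtain ⟨_, ⟨t, R, h, rfl⟩, h'⟩ := exists_lt_of_csInf_lt hSn this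
    exact ⟨t, R, h, h'⟩
  choose t R hG hR using hex
  let Q : ℕ → E →L[ℝ] E := fun n => Nat.rec (ContinuousLinearMap.id ℝ E)
    (fun n q => q.comp (R n)) n
  have hQs : ∀ n, Q (n + 1) = (Q n).comp (R n) := fun n => rfl
  have hQ : ∀ n, ∃ τ, GG P fs τ (Q n) := by
    intro n
    induction n with
    | zero => exact ⟨0, hid⟩
    | succ n ih =>
      obtain ⟨τ, h⟩ := ih
      exact ⟨_, h.comp H (hG n)⟩
  have hanti : Antitone (fun n => Q n fs) := by
    refine antitone_nat_of_succ_le fun n => ?_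
    obtain ⟨τ, h⟩ := hQ n
    rw [hQs]
    refine al_pos_mono h.pos ?_
    have := (hG n).dom fs H.fpos
    rwa [H.finv _ (hG n).tnn] at this
  have hQ0 : ∀ n, 0 ≤ Q n fs := fun n => by
    obtain ⟨τ, h⟩ := hQ n
    exact h.pos _ H.fpos
  obtain ⟨h, hlim, h0, hle⟩ := al_anti H.add hanti hQ0
  have hnα : ‖h‖ ≤ α := by
    have l1 : Tendsto (fun n => ‖Q (n + 1) fs‖) atTop (𝓝 ‖h‖) :=
      (hlim.norm).comp (tendsto_add_atTop_nat 1)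
    have l2 : Tendsto (fun n : ℕ => α + 1 / ((n : ℝ) + 1)) atTop (𝓝 (α + 0)) :=
      tendsto_const_nhds.add tendsto_one_div_add_atTop_nhds_zero_nat
    rw [add_zero] at l2
    refine le_of_tendsto_of_tendsto' l1 l2 fun n => ?_
    obtain ⟨τ, hq⟩ := hQ n
    rw [hQs, ContinuousLinearMap.comp_apply]
    have p := (hG n).pos fs H.fpos
    refine le_trans (al_norm_mono (hq.pos _ p) (hq.dom _ p)) ?_
    rw [H.norm _ hq.tnn _ p]
    exact (hR n).le
  have hRα : ∀ t R, GG P fs t R → α ≤ ‖R h‖ := by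
    intro t R hg
    have l1 : Tendsto (fun n => ‖R (Q n fs)‖) atTop (𝓝 ‖R h‖) :=
      ((R.continuous.tendsto h).comp hlim).norm
    refine ge_of_tendsto' l1 fun n => csInf_le hSb ?_
    obtain ⟨τ, hq⟩ := hQ n
    exact ⟨_, _, hg.comp H hq, rfl⟩
  have hKs : ∀ s, 0 ≤ s → K (P s h) = 0 := by
    intro s hs
    have hg : GG P fs (t₀ + s) (P (t₀ + s) - K.comp (P s)) := by
      refine ⟨add_nonneg ht₀ hs, fun f hf => ?_, fun f hf => ?_, hKtb.subset ?_⟩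
      · simp only [_root_.sub_apply, ContinuousLinearMap.comp_apply, sub_nonneg]
        rw [H.sem _ _ ht₀ hs]
        exact hKP _ (H.pos _ hs _ hf)
      · simp only [_root_.sub_apply, ContinuousLinearMap.comp_apply]
        exact sub_le_self _ (hK _ (H.pos _ hs _ hf))
      · rintro _ ⟨x, hx, rfl⟩
        exact ⟨P s x, ⟨H.pos _ hs _ hx.1, H.le_fs hs hx.2⟩, by simp⟩
    have q := hRα _ _ hg
    have p1 : 0 ≤ K (P s h) := hK _ (H.pos _ hs _ h0)
    have p2 : K (P s h) ≤ P (t₀ + s) h := by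
      rw [H.sem _ _ ht₀ hs]; exact hKP _ (H.pos _ hs _ h0)
    simp only [_root_.sub_apply, ContinuousLinearMap.comp_apply] at q
    rw [al_norm_sub H.add p1 p2, H.norm _ (add_nonneg ht₀ hs) _ h0] at q
    exact norm_eq_zero.1 (le_antisymm (by linarith) (norm_nonneg _))
  have hkf0 := hK _ H.fpos
  have hz : h = 0 := by
    have h1 : h ≤ fs := hle 0
    rcases H.lemA hK hkf0 h0 h1 (fun s hs => by rw [hKs s hs]; exact inf_eq_right.2 hkf0) with h | h
    · exact h
    · exact absurd (by simpa using h) hKf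
  have hα0 : α ≤ 0 := by
    have := hRα _ _ hid
    simpa [hz] using this
  obtain ⟨_, ⟨t, R, h, rfl⟩, h'⟩ := exists_lt_of_csInf_lt hSn (lt_of_le_of_lt hα0 hε)
  exact ⟨t, R, h, h'⟩

lemma AbsSem.cluster [CompleteSpace E] (H : AbsSem P fs)
    (hB : ∀ ε > 0, ∃ t R, GG P fs t R ∧ ‖R fs‖ < ε) {f : E} (hf : f ∈ Set.Icc 0 fs) :
    ∃ g, ∃ φ : ℕ → ℕ, StrictMono φ ∧ Tendsto (fun n => P (φ n : ℝ) f) atTop (𝓝 g) := by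
  have htb : TotallyBounded (Set.range fun n : ℕ => P (n : ℝ) f) := by
    refine tb_of_approx fun ε hε => ?_
    obtain ⟨t, R, hG, hR⟩ := hB ε hε
    refine ⟨((P t - R) '' Set.Icc 0 fs) ∪ ((fun n : ℕ => P (n : ℝ) f) '' Set.Iio (⌈t⌉₊)),
      totallyBounded_union.2 ⟨hG.tb, ((Set.finite_Iio _).image _).totallyBounded⟩, ?_⟩
    rintro _ ⟨n, rfl⟩
    by_cases hn : n < ⌈t⌉₊
    · exact ⟨_, Or.inr ⟨n, hn, rfl⟩, by simpa using hε⟩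
    · have hn' : t ≤ n := (Nat.le_ceil t).trans (by exact_mod_cast not_lt.1 hn)
      have e : P (n : ℝ) f = P t (P (n - t) f) := by
        rw [← H.sem _ _ hG.tnn (sub_nonneg.2 hn'), add_sub_cancel]
      have m1 := H.pos _ (sub_nonneg.2 hn') _ hf.1
      have m2 := H.le_fs (sub_nonneg.2 hn') hf.2
      refine ⟨_, Or.inl ⟨_, ⟨m1, m2⟩, rfl⟩, ?_⟩
      simp only [e, _root_.sub_apply, sub_sub_cancel]
      exact lt_of_le_of_lt (al_norm_mono (hG.pos _ m1) (al_pos_mono hG.pos m2)) hR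
  have hc : IsCompact (closure (Set.range fun n : ℕ => P (n : ℝ) f)) :=
    htb.closure.isCompact_of_isClosed isClosed_closure
  obtain ⟨g, -, φ, hφ, h⟩ := hc.tendsto_subseq (x := fun n : ℕ => P (n : ℝ) f)
    (fun n => subset_closure ⟨n, rfl⟩)
  exact ⟨g, φ, hφ, h⟩

lemma AbsSem.anti_norm (H : AbsSem P fs) (f : E) (b : ℝ) :
    AntitoneOn (fun t => ‖P t f - b • fs‖) (Set.Ici 0) := by
  intro s hs t ht hst
  have e : P t f - b • fs = P (t - s) (P s f - b • fs) := by
    rw [map_sub, map_smul, H.finv _ (sub_nonneg.2 hst), ← H.sem _ _ (sub_nonneg.2 hst) hs,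
      sub_add_cancel]
  simp only [e]
  exact H.contr (sub_nonneg.2 hst) _

lemma AbsSem.cluster_norm (H : AbsSem P fs) {f g : E} {φ : ℕ → ℕ} (hφ : StrictMono φ)
    (hg : Tendsto (fun n => P (φ n : ℝ) f) atTop (𝓝 g)) (b : ℝ) {s : ℝ} (hs : 0 ≤ s) :
    ‖P s g - b • fs‖ = ‖g - b • fs‖ := by
  have l1 : Tendsto (fun n => ‖P (φ n : ℝ) f - b • fs‖) atTop (𝓝 ‖g - b • fs‖) :=
    (hg.sub_const _).norm
  have l2 : Tendsto (fun n => ‖P (s + φ n : ℝ) f - b • fs‖) atTop (𝓝 ‖P s g - b • fs‖) := by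
    have := ((((P s).continuous.tendsto g).comp hg).sub_const (b • fs)).norm
    refine this.congr fun n => ?_
    simp [H.sem s (φ n) hs (Nat.cast_nonneg _)]
  apply le_antisymm
  · have e : P s g - b • fs = P s (g - b • fs) := by rw [map_sub, map_smul, H.finv _ hs]
    rw [e]
    exact H.contr hs _
  · refine ge_of_tendsto' l2 fun n => ?_
    -- for fixed n, eventually φ m ≥ s + φ n
    refine le_of_tendsto l1 ?_
    have : ∀ᶠ m in atTop, ⌈s + φ n⌉₊ ≤ φ m := hφ.tendsto_atTop.eventually_ge_atTop _
    filter_upwards [this] with m hm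
    have hm' : s + φ n ≤ φ m := (Nat.le_ceil _).trans (by exact_mod_cast hm)
    exact H.anti_norm f b (show (s + φ n : ℝ) ∈ Set.Ici 0 from add_nonneg hs (Nat.cast_nonneg _))
      (Set.mem_Ici.2 (Nat.cast_nonneg (φ m))) hm'

lemma al_trunc {x c : E} (hc : 0 ≤ c) : x⁺ ⊓ c = x⁺ - (x - c)⁺ := by
  have h1 : (x - c)⁺ = (x⁺ - c)⁺ := by
    rw [posPart_def, posPart_def, posPart_def, sup_sub, zero_sub, sup_assoc,
      sup_eq_right.2 (neg_nonpos.2 hc)]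
  rw [h1, posPart_def (x⁺ - c), sub_sup, sub_sub_cancel, sub_zero, inf_comm]

lemma AbsSem.P_posPart (H : AbsSem P fs) {x : E} {s : ℝ} (hs : 0 ≤ s) (h : ‖P s x‖ = ‖x‖) :
    P s x⁺ = (P s x)⁺ := by
  have h1 : (P s x)⁺ ≤ P s x⁺ := by
    rw [posPart_def (P s x)]
    exact sup_le (H.mono hs (le_posPart x)) (H.pos _ hs _ (posPart_nonneg _))
  have e : P s x⁺ - (P s x)⁺ = P s x⁻ - (P s x)⁻ := by
    have e1 : P s x⁺ - P s x⁻ = P s x := by rw [← map_sub, posPart_sub_negPart]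
    have e2 := posPart_sub_negPart (P s x)
    rw [sub_eq_sub_iff_sub_eq_sub, e1, e2]
  have h2 : (P s x)⁻ ≤ P s x⁻ := by rw [← sub_nonneg, ← e, sub_nonneg]; exact h1
  have n1 := al_norm_sub H.add (posPart_nonneg _) h1
  have n2 := al_norm_sub H.add (negPart_nonneg _) h2
  rw [H.norm _ hs _ (posPart_nonneg _)] at n1
  rw [H.norm _ hs _ (negPart_nonneg _)] at n2
  rw [H.norm_posneg, H.norm_posneg x] at h
  have : ‖P s x⁺ - (P s x)⁺‖ = 0 := by
    have := norm_nonneg (P s x⁻ - (P s x)⁻)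
    exact le_antisymm (by linarith) (norm_nonneg _)
  exact sub_eq_zero.1 (norm_eq_zero.1 this)

/-- the component is disjoint from its complement -/
lemma al_comp {y f e : E} (hy : 0 ≤ y) (hf : 0 ≤ f)
    (he : Tendsto (fun n : ℕ => ((n : ℝ) • y) ⊓ f) atTop (𝓝 e)) : e ⊓ (f - e) = 0 := by
  have h1 : Tendsto (fun n : ℕ => ((2 : ℝ) • (((n : ℝ) • y) ⊓ f)) ⊓ f) atTop
      (𝓝 (((2 : ℝ) • e) ⊓ f)) := (he.const_smul (2 : ℝ)).inf_nhds tendsto_const_nhds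
  have h2 : Tendsto (fun n : ℕ => (((2 * n : ℕ) : ℝ) • y) ⊓ f) atTop (𝓝 e) :=
    he.comp (tendsto_id.const_mul_atTop' (by norm_num : 0 < 2))
  have h3 : ((2 : ℝ) • e) ⊓ f = e := by
    refine tendsto_nhds_unique h1 (h2.congr fun n => ?_)
    rw [al_smul_inf two_pos, inf_assoc, smul_smul]
    have : ((2 : ℝ) • f) ⊓ f = f := inf_eq_right.2 (by
      rw [two_smul]; exact le_add_of_nonneg_left hf)
    rw [this]
    push_cast
    rfl
  have h4 : ((2 : ℝ) • e) ⊓ f - e = 0 := by rw [h3, sub_self]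
  rw [inf_sub, two_smul, add_sub_cancel_right] at h4
  exact h4

lemma AbsSem.lemD [CompleteSpace E] (H : AbsSem P fs) {K : E →L[ℝ] E} {t₀ : ℝ} (ht₀ : 0 ≤ t₀)
    (hK : ∀ f, 0 ≤ f → 0 ≤ K f) (hKP : ∀ f, 0 ≤ f → K f ≤ P t₀ f) (hKf : K fs ≠ 0)
    (hKH : ∀ u : ℝ → E, ContinuousOn u (Set.Ici 0) →
      (∀ s, 0 ≤ s → K (u s) ⊓ K (fs - u s) = 0) → ∀ s, 0 ≤ s → K (u s) = K (u 0))
    {g : E} (hg0 : 0 ≤ g) (hg1 : g ≤ fs)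
    (hg : ∀ b s : ℝ, 0 ≤ s → ‖P s g - b • fs‖ = ‖g - b • fs‖) : g = ‖g‖ • fs := by
  have hkf0 := hK _ H.fpos
  have hP : ∀ b s : ℝ, 0 ≤ s → P s (g - b • fs)⁺ = (P s g - b • fs)⁺ := by
    intro b s hs
    have e : P s (g - b • fs) = P s g - b • fs := by rw [map_sub, map_smul, H.finv _ hs]
    rw [H.P_posPart hs (by rw [e, hg b s hs]), e]
  have key : ∀ a : ℝ, 0 ≤ a → a ≤ 1 → g ≤ a • fs ∨ a • fs ≤ g := by
    intro a ha ha1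
    have hmon : ∀ y : E, 0 ≤ y → Monotone (fun n : ℕ => ((n : ℝ) • y) ⊓ fs) := by
      intro y hy m n hmn
      exact inf_le_inf_right _ (smul_le_smul_of_nonneg_right (by exact_mod_cast hmn) hy)
    set y := (g - a • fs)⁺ with hy
    have hy0 : 0 ≤ y := posPart_nonneg _
    obtain ⟨e, he, he1, he2⟩ := al_mono H.add (hmon y hy0) (fun n => inf_le_right)
    have he0 : 0 ≤ e := by
      have := he2 0
      simp only [Nat.cast_zero, zero_smul] at this
      rwa [inf_eq_left.2 H.fpos] at this
    have hn : ∀ (n : ℕ) (s : ℝ), 0 ≤ s →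
        P s (((n : ℝ) • y) ⊓ fs) = ((n : ℝ) • (P s g - a • fs)⁺) ⊓ fs := by
      intro n s hs
      rcases Nat.eq_zero_or_pos n with rfl | hnp
      · simp [inf_eq_left.2 H.fpos]
      have hnp' : (0 : ℝ) < n := by exact_mod_cast hnp
      have aux : ∀ x : E, ((n : ℝ) • (x - a • fs)⁺) ⊓ fs =
          (n : ℝ) • ((x - a • fs)⁺ - (x - (a + (n : ℝ)⁻¹) • fs)⁺) := by
        intro x
        have : x - (a + (n : ℝ)⁻¹) • fs = (x - a • fs) - (n : ℝ)⁻¹ • fs := by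
          rw [add_smul, sub_sub]
        rw [this, ← al_trunc (smul_nonneg (by positivity) H.fpos), al_smul_inf hnp', smul_smul,
          mul_inv_cancel₀ hnp'.ne', one_smul]
      rw [hy, aux, aux, map_smul, map_sub, hP _ s hs, hP _ s hs]
    have hdis : ∀ s, 0 ≤ s → P s e ⊓ (fs - P s e) = 0 := by
      intro s hs
      refine al_comp (y := (P s g - a • fs)⁺) (posPart_nonneg _) H.fpos ?_
      refine (((P s).continuous.tendsto e).comp he).congr fun n => ?_
      exact hn n s hs
    have hPe0 : ∀ s, 0 ≤ s → 0 ≤ P s e := fun s hs => H.pos s hs _ he0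
    have hPe1 : ∀ s, 0 ≤ s → 0 ≤ fs - P s e := fun s hs => sub_nonneg.2 (H.le_fs hs he1)
    have hconst := hKH (fun s => P s e) (H.cont e) (by
      intro s hs
      apply le_antisymm _ (le_inf (hK _ (hPe0 s hs)) (hK _ (hPe1 s hs)))
      rw [← hdis (t₀ + s) (add_nonneg ht₀ hs)]
      apply inf_le_inf
      · rw [H.sem _ _ ht₀ hs]; exact hKP _ (hPe0 s hs)
      · have := hKP _ (hPe1 s hs)
        rwa [map_sub (P t₀), H.finv _ ht₀, ← H.sem _ _ ht₀ hs] at this)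
    simp only [H.zero] at hconst
    have hdK : K e ⊓ K (fs - e) = 0 := by
      apply le_antisymm _ (le_inf (hK _ he0) (hK _ (sub_nonneg.2 he1)))
      rw [← hdis t₀ ht₀]
      apply inf_le_inf
      · exact hKP _ he0
      · have := hKP _ (sub_nonneg.2 he1)
        rwa [map_sub (P t₀), H.finv _ ht₀] at this
    rcases H.lemA hK (hK _ he0) (sub_nonneg.2 he1) (sub_le_self _ he0) (fun s hs => by
      rw [map_sub (P s), H.finv _ hs, map_sub, hconst s hs, ← map_sub, hdK]) with h | h
    · right
      have hef : e = fs := (sub_eq_zero.1 h).symm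
      rw [hef] at he
      set x := g - a • fs with hx
      have h1 : Tendsto (fun n : ℕ => x⁻ ⊓ (((n : ℝ) • y) ⊓ fs)) atTop (𝓝 (x⁻ ⊓ fs)) :=
        tendsto_const_nhds.inf_nhds he
      have h2 : ∀ n : ℕ, x⁻ ⊓ (((n : ℝ) • y) ⊓ fs) = 0 := by
        intro n
        have q : x⁻ ⊓ ((n : ℝ) • y) = 0 := by
          induction n with
          | zero => simp [negPart_nonneg]
          | succ n ih =>
            push_cast
            rw [add_smul, one_smul]
            refine al_inf_add (negPart_nonneg _) (smul_nonneg (Nat.cast_nonneg _) hy0) hy0 ih ?_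
            rw [hy, inf_comm]
            exact posPart_inf_negPart_eq_zero x
        rw [← inf_assoc, q, inf_eq_left.2 H.fpos]
      have h3 : x⁻ ⊓ fs = 0 := by
        refine tendsto_nhds_unique h1 ?_
        exact tendsto_const_nhds.congr fun n => (h2 n).symm
      have h4 : x⁻ ≤ fs := by
        rw [negPart_def]
        refine sup_le ?_ H.fpos
        rw [hx, neg_sub]
        calc a • fs - g ≤ a • fs := sub_le_self _ hg0
          _ ≤ (1 : ℝ) • fs := smul_le_smul_of_nonneg_right ha1 H.fpos
          _ = fs := one_smul _ _
      rw [inf_eq_left.2 h4, negPart_eq_zero] at h3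
      exact sub_nonneg.1 h3
    · left
      have hKe : K e = 0 := by
        rwa [inf_eq_left.2 (al_pos_mono hK he1)] at h
      rcases H.lemA hK hkf0 he0 he1 (fun s hs => by
        rw [hconst s hs, hKe]; exact inf_eq_right.2 hkf0) with h' | h'
      · have h5 := he2 1
        simp only [Nat.cast_one, one_smul] at h5
        have h6 : y ≤ fs := by
          rw [hy, posPart_def]
          exact sup_le ((sub_le_self _ (smul_nonneg ha H.fpos)).trans hg1) H.fpos
        rw [inf_eq_left.2 h6, h'] at h5
        have h7 : y = 0 := le_antisymm h5 hy0
        rw [hy, posPart_eq_zero] at h7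
        exact sub_nonpos.1 h7
      · exact absurd (by simpa using h') hKf
  set c := ‖g‖ with hc
  have hc1 : c ≤ 1 := by rw [← H.fnorm]; exact al_norm_mono hg0 hg1
  have hc0 : 0 ≤ c := norm_nonneg _
  have hle : c • fs ≤ g := by
    have t : Tendsto (fun n : ℕ => ((1 - 1 / ((n : ℝ) + 1)) * c) • fs) atTop
        (𝓝 (((1 - 0) * c) • fs)) :=
      ((tendsto_const_nhds.sub tendsto_one_div_add_atTop_nhds_zero_nat).mul_const _).smul_const _
    rw [sub_zero, one_mul] at t
    refine le_of_tendsto' t fun n => ?_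
    have p1 : 0 < 1 / ((n : ℝ) + 1) := by positivity
    have p2 : 1 / ((n : ℝ) + 1) ≤ 1 := by
      rw [div_le_one (by positivity)]; have : (0 : ℝ) ≤ n := Nat.cast_nonneg n; linarith
    rcases hc0.eq_or_lt with h | h
    · rw [← h]; simpa using hg0
    have q0 : 0 ≤ (1 - 1 / ((n : ℝ) + 1)) * c := mul_nonneg (by linarith) hc0
    rcases key ((1 - 1 / ((n : ℝ) + 1)) * c) q0 (by nlinarith) with h1 | h1
    · have := al_norm_mono hg0 h1
      rw [norm_smul, H.fnorm, Real.norm_of_nonneg q0] at this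
      nlinarith
    · exact h1
  exact (al_eq H.add (smul_nonneg hc0 H.fpos) hle (by
    rw [norm_smul, H.fnorm, Real.norm_of_nonneg hc0, mul_one])).symm

lemma AbsSem.main0 [CompleteSpace E] (H : AbsSem P fs) {K : E →L[ℝ] E} {t₀ : ℝ} (ht₀ : 0 ≤ t₀)
    (hK : ∀ f, 0 ≤ f → 0 ≤ K f) (hKP : ∀ f, 0 ≤ f → K f ≤ P t₀ f) (hKf : K fs ≠ 0)
    (hKtb : TotallyBounded (K '' Set.Icc 0 fs))
    (hKH : ∀ u : ℝ → E, ContinuousOn u (Set.Ici 0) →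
      (∀ s, 0 ≤ s → K (u s) ⊓ K (fs - u s) = 0) → ∀ s, 0 ≤ s → K (u s) = K (u 0))
    {f : E} (hf0 : 0 ≤ f) (hf1 : f ≤ fs) (ε : ℝ) (hε : 0 < ε) :
    ∃ T, 0 ≤ T ∧ ∀ t, T ≤ t → ‖P t f - ‖f‖ • fs‖ < ε := by
  obtain ⟨g, φ, hφ, hg⟩ := H.cluster (fun ε hε => H.lemB ht₀ hK hKP hKtb hKf ε hε)
    (f := f) ⟨hf0, hf1⟩
  have h0 : ∀ n, 0 ≤ P (φ n : ℝ) f := fun n => H.pos _ (Nat.cast_nonneg _) _ hf0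
  have hg0 : 0 ≤ g := ge_of_tendsto' hg h0
  have hg1 : g ≤ fs := le_of_tendsto' hg fun n => H.le_fs (Nat.cast_nonneg _) hf1
  have hgn : ‖g‖ = ‖f‖ := by
    refine tendsto_nhds_unique hg.norm (tendsto_const_nhds.congr fun n => ?_)
    exact (H.norm _ (Nat.cast_nonneg _) _ hf0).symm
  have hgf := H.lemD ht₀ hK hKP hKf hKH hg0 hg1 (fun b s hs => H.cluster_norm hφ hg b hs)
  rw [hgn] at hgf
  rw [hgf, Metric.tendsto_atTop] at hg
  obtain ⟨N, hN⟩ := hg ε hε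
  refine ⟨φ N, Nat.cast_nonneg _, fun t ht => ?_⟩
  have := hN N le_rfl
  rw [dist_eq_norm] at this
  exact lt_of_le_of_lt (H.anti_norm f ‖f‖ (Set.mem_Ici.2 (Nat.cast_nonneg (φ N)))
    (show t ∈ Set.Ici 0 from (Nat.cast_nonneg (φ N)).trans ht) ht) this

lemma AbsSem.main [CompleteSpace E] (H : AbsSem P fs) {K : E →L[ℝ] E} {t₀ : ℝ} (ht₀ : 0 ≤ t₀)
    (hK : ∀ f, 0 ≤ f → 0 ≤ K f) (hKP : ∀ f, 0 ≤ f → K f ≤ P t₀ f) (hKf : K fs ≠ 0)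
    (hKtb : TotallyBounded (K '' Set.Icc 0 fs))
    (hKH : ∀ u : ℝ → E, ContinuousOn u (Set.Ici 0) →
      (∀ s, 0 ≤ s → K (u s) ⊓ K (fs - u s) = 0) → ∀ s, 0 ≤ s → K (u s) = K (u 0))
    (hunit : ∀ d : E, 0 ≤ d → d ⊓ fs = 0 → d = 0)
    {f : E} (hf0 : 0 ≤ f) (hf1 : ‖f‖ = 1) :
    Tendsto (fun t : ℝ => ‖P t f - fs‖) atTop (𝓝 0) := by
  have hmon : Monotone (fun n : ℕ => f ⊓ ((n : ℝ) • fs)) := fun m n hmn =>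
    inf_le_inf_left _ (smul_le_smul_of_nonneg_right (by exact_mod_cast hmn) H.fpos)
  obtain ⟨l, hl, hl1, hl2⟩ := al_mono H.add hmon (fun n => inf_le_left)
  have hlf : f - l = 0 := by
    apply hunit _ (sub_nonneg.2 hl1)
    apply le_antisymm _ (le_inf (sub_nonneg.2 hl1) H.fpos)
    have : l + (f - l) ⊓ fs ≤ l := by
      refine le_of_tendsto' (hl.add_const _) fun n => ?_
      refine le_trans (le_inf ?_ ?_) (hl2 (n + 1))
      · calc f ⊓ ((n : ℝ) • fs) + (f - l) ⊓ fs ≤ l + (f - l) := add_le_add (hl2 n) inf_le_left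
          _ = f := add_sub_cancel _ _
      · push_cast
        rw [add_smul, one_smul]
        exact add_le_add inf_le_right inf_le_right
    simpa using this
  have hlf' : l = f := (sub_eq_zero.1 hlf).symm
  rw [hlf'] at hl
  rw [Metric.tendsto_atTop]
  intro ε hε
  obtain ⟨N, hN⟩ := Metric.tendsto_atTop.1 hl (ε / 3) (by positivity)
  set n := N + 1 with hn
  set f' := f ⊓ ((n : ℝ) • fs) with hf'
  have hnp : (0 : ℝ) < n := by positivity
  have hf'0 : 0 ≤ f' := le_inf hf0 (smul_nonneg hnp.le H.fpos)
  have hd : ‖f' - f‖ < ε / 3 := by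
    have := hN n (by omega)
    rwa [dist_eq_norm] at this
  obtain ⟨T, hT0, hT⟩ := H.main0 ht₀ hK hKP hKf hKtb hKH (f := (n : ℝ)⁻¹ • f')
    (smul_nonneg (by positivity) hf'0) (by
      have := smul_le_smul_of_nonneg_left (inf_le_right : f' ≤ (n : ℝ) • fs)
        (inv_nonneg.2 hnp.le)
      rwa [smul_smul, inv_mul_cancel₀ hnp.ne', one_smul] at this) (ε / 3 / n) (by positivity)
  refine ⟨T, fun t ht => ?_⟩
  have ht0 : 0 ≤ t := hT0.trans ht
  have h1 := hT t ht
  have e : P t ((n : ℝ)⁻¹ • f') - ‖(n : ℝ)⁻¹ • f'‖ • fs = (n : ℝ)⁻¹ • (P t f' - ‖f'‖ • fs) := by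
    rw [map_smul, norm_smul, norm_inv, Real.norm_of_nonneg hnp.le, smul_sub, smul_smul]
  rw [e, norm_smul, norm_inv, Real.norm_of_nonneg hnp.le, lt_div_iff₀ hnp, mul_comm,
    mul_inv_cancel_left₀ hnp.ne'] at h1
  have e2 : P t f - fs = P t (f - f') + (P t f' - ‖f'‖ • fs) + (‖f'‖ - ‖f‖) • fs := by
    rw [map_sub, sub_smul, hf1, one_smul]; abel
  have h2 : ‖P t (f - f')‖ < ε / 3 := by
    refine lt_of_le_of_lt (H.contr ht0 _) ?_
    rwa [norm_sub_rev]
  have h3 : ‖(‖f'‖ - ‖f‖) • fs‖ < ε / 3 := by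
    rw [norm_smul, H.fnorm, mul_one]
    exact lt_of_le_of_lt (abs_norm_sub_norm_le f' f) hd
  rw [dist_zero_right, norm_norm, e2]
  have := norm_add₃_le (a := P t (f - f')) (b := P t f' - ‖f'‖ • fs) (c := (‖f'‖ - ‖f‖) • fs)
  linarith

end AbsLat

section Concrete

variable {X : Type*} [MeasurableSpace X] {μ : Measure X}

instance lp_ordered : IsOrderedModule ℝ (Lp ℝ 1 μ) where
  smul_le_smul_of_nonneg_left c hc f g hfg := by
    rw [← Lp.coeFn_le] at hfg ⊢
    filter_upwards [hfg, Lp.coeFn_smul c f, Lp.coeFn_smul c g] with x h h1 h2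
    simp only [h1, h2, Pi.smul_apply, smul_eq_mul]
    exact mul_le_mul_of_nonneg_left h hc
  smul_le_smul_of_nonneg_right f hf c d hcd := by
    rw [← Lp.coeFn_nonneg] at hf
    rw [← Lp.coeFn_le]
    filter_upwards [hf, Lp.coeFn_smul c f, Lp.coeFn_smul d f] with x h h1 h2
    simp only [h1, h2, Pi.smul_apply, smul_eq_mul]
    exact mul_le_mul_of_nonneg_right hcd h

lemma lp_add (a b : Lp ℝ 1 μ) (ha : 0 ≤ a) (hb : 0 ≤ b) : ‖a + b‖ = ‖a‖ + ‖b‖ := by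
  rw [← Lp.coeFn_nonneg] at ha hb
  rw [L1.norm_eq_integral_norm, L1.norm_eq_integral_norm, L1.norm_eq_integral_norm,
    ← integral_add (L1.integrable_coeFn a).norm (L1.integrable_coeFn b).norm]
  refine integral_congr_ae ?_
  filter_upwards [ha, hb, Lp.coeFn_add a b] with x h1 h2 h3
  simp only [Pi.zero_apply] at h1 h2
  rw [h3, Pi.add_apply, Real.norm_of_nonneg h1, Real.norm_of_nonneg h2,
    Real.norm_of_nonneg (add_nonneg h1 h2)]

/-- sectional integral -/
noncomputable def sd (μ : Measure X) (F : Set X) (G : Set (X × X)) (f : X → ℝ) (y : X) : ℝ :=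
  F.indicator (fun y => ∫ x in {x | (x, y) ∈ G}, f x ∂μ) y

lemma sec_meas {G : Set (X × X)} (hG : MeasurableSet G) (y : X) :
    MeasurableSet {x | (x, y) ∈ G} := hG.preimage (measurable_id.prodMk measurable_const)

lemma sd_bound (F : Set X) (G : Set (X × X)) (f : Lp ℝ 1 μ) (y : X) :
    ‖sd μ F G f y‖ ≤ F.indicator (fun _ => ‖f‖) y := by
  unfold sd
  by_cases hy : y ∈ F
  · rw [Set.indicator_of_mem hy, Set.indicator_of_mem hy, L1.norm_eq_integral_norm]
    refine (norm_integral_le_integral_norm _).trans ?_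
    exact setIntegral_le_integral (L1.integrable_coeFn f).norm (ae_of_all _ fun x => norm_nonneg _)
  · simp [hy]

lemma sd_bound' (F : Set X) (G : Set (X × X)) (f : Lp ℝ 1 μ) (y : X) :
    ‖sd μ F G f y‖ ≤ ‖f‖ :=
  (sd_bound F G f y).trans (Set.indicator_le_self' (fun _ _ => norm_nonneg _) y)

lemma sd_sm [SFinite μ] {F : Set X} (hF : MeasurableSet F) {G : Set (X × X)} (hG : MeasurableSet G)
    (f : Lp ℝ 1 μ) : StronglyMeasurable (sd μ F G f) := by
  refine StronglyMeasurable.indicator ?_ hF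
  have : StronglyMeasurable (Function.uncurry fun x y => G.indicator (fun p : X × X => f p.1) (x, y)) :=
    ((Lp.stronglyMeasurable f).comp_measurable measurable_fst).indicator hG
  convert this.integral_prod_left (μ := μ) using 2 with y
  rw [← integral_indicator (sec_meas hG y)]
  rfl

lemma sd_int [SFinite μ] {F : Set X} (hF : MeasurableSet F) (hμF : μ F ≠ ⊤) {G : Set (X × X)}
    (hG : MeasurableSet G) (f : Lp ℝ 1 μ) : Integrable (sd μ F G f) μ := by
  refine Integrable.mono' (g := F.indicator (fun _ => ‖f‖)) ?_ (sd_sm hF hG f).aestronglyMeasurable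
    (ae_of_all _ (sd_bound F G f))
  exact (integrable_indicator_iff hF).2 (integrableOn_const hμF)

lemma sd_add (F : Set X) (G : Set (X × X)) (f g : Lp ℝ 1 μ) (y : X) :
    sd μ F G (f + g : Lp ℝ 1 μ) y = sd μ F G f y + sd μ F G g y := by
  unfold sd
  by_cases hy : y ∈ F
  · simp only [Set.indicator_of_mem hy]
    rw [← integral_add (L1.integrable_coeFn f).integrableOn (L1.integrable_coeFn g).integrableOn]
    exact integral_congr_ae (ae_restrict_of_ae (Lp.coeFn_add f g))
  · simp [hy]

lemma sd_smul (F : Set X) (G : Set (X × X)) (c : ℝ) (f : Lp ℝ 1 μ) (y : X) :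
    sd μ F G (c • f : Lp ℝ 1 μ) y = c * sd μ F G f y := by
  unfold sd
  by_cases hy : y ∈ F
  · simp only [Set.indicator_of_mem hy]
    rw [← integral_const_mul]
    exact integral_congr_ae (ae_restrict_of_ae (Lp.coeFn_smul c f))
  · simp [hy]

lemma sd_sub (F : Set X) (G : Set (X × X)) (f g : Lp ℝ 1 μ) (y : X) :
    sd μ F G (f - g : Lp ℝ 1 μ) y = sd μ F G f y - sd μ F G g y := by
  have := sd_add F G (f - g) g y
  rw [sub_add_cancel] at this
  linarith

lemma sd_nonneg (F : Set X) (G : Set (X × X)) {f : Lp ℝ 1 μ} (hf : 0 ≤ f) (y : X) :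
    0 ≤ sd μ F G f y := by
  rw [← Lp.coeFn_nonneg] at hf
  refine Set.indicator_nonneg (fun y _ => ?_) y
  exact integral_nonneg_of_ae (ae_restrict_of_ae hf)

lemma sd_union (F : Set X) {A B : Set (X × X)} (hB : MeasurableSet B)
    (hd : Disjoint A B) (f : Lp ℝ 1 μ) (y : X) :
    sd μ F (A ∪ B) f y = sd μ F A f y + sd μ F B f y := by
  unfold sd
  by_cases hy : y ∈ F
  · simp only [Set.indicator_of_mem hy]
    refine setIntegral_union ?_ (sec_meas hB y) (L1.integrable_coeFn f).integrableOn
      (L1.integrable_coeFn f).integrableOn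
    exact hd.preimage (fun x => (x, y))
  · simp [hy]

/-- the kernel operator -/
noncomputable def Kop [SFinite μ] {F : Set X} (hF : MeasurableSet F) (hμF : μ F ≠ ⊤)
    {G : Set (X × X)} (hG : MeasurableSet G) : Lp ℝ 1 μ →L[ℝ] Lp ℝ 1 μ :=
  LinearMap.mkContinuous
    { toFun := fun f => (sd_int hF hμF hG f).toL1 _
      map_add' := fun f g => by
        rw [← Integrable.toL1_add]
        refine (Integrable.toL1_eq_toL1_iff _ _ _ _).2 (ae_of_all _ fun y => ?_)
        exact sd_add F G f g y
      map_smul' := fun c f => by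
        rw [RingHom.id_apply, ← Integrable.toL1_smul]
        refine (Integrable.toL1_eq_toL1_iff _ _ _ _).2 (ae_of_all _ fun y => ?_)
        exact sd_smul F G c f y }
    (μ.real F) (fun f => by
      simp only [LinearMap.coe_mk, AddHom.coe_mk]
      rw [L1.norm_eq_integral_norm]
      have h1 : ∫ y, ‖(Integrable.toL1 _ (sd_int hF hμF hG f)) y‖ ∂μ
          = ∫ y, ‖sd μ F G f y‖ ∂μ := by
        refine integral_congr_ae ?_
        filter_upwards [Integrable.coeFn_toL1 (sd_int hF hμF hG f)] with y hy
        rw [hy]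
      rw [h1]
      calc ∫ y, ‖sd μ F G f y‖ ∂μ ≤ ∫ y, F.indicator (fun _ => ‖f‖) y ∂μ :=
            integral_mono (sd_int hF hμF hG f).norm
              ((integrable_indicator_iff hF).2 (integrableOn_const hμF)) (sd_bound F G f)
        _ = μ.real F * ‖f‖ := by
            rw [integral_indicator hF, setIntegral_const, smul_eq_mul])

lemma Kop_coe [SFinite μ] {F : Set X} (hF : MeasurableSet F) (hμF : μ F ≠ ⊤)
    {G : Set (X × X)} (hG : MeasurableSet G) (f : Lp ℝ 1 μ) :
    Kop hF hμF hG f =ᵐ[μ] sd μ F G f :=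
  Integrable.coeFn_toL1 (sd_int hF hμF hG f)

lemma Kop_pos [SFinite μ] {F : Set X} (hF : MeasurableSet F) (hμF : μ F ≠ ⊤)
    {G : Set (X × X)} (hG : MeasurableSet G) (f : Lp ℝ 1 μ) (hf : 0 ≤ f) :
    0 ≤ Kop hF hμF hG f := by
  rw [← Lp.coeFn_nonneg]
  filter_upwards [Kop_coe hF hμF hG f] with y hy
  rw [hy]
  exact sd_nonneg F G hf y

lemma Kop_union [SFinite μ] {F : Set X} (hF : MeasurableSet F) (hμF : μ F ≠ ⊤)
    {A B C : Set (X × X)} (hA : MeasurableSet A) (hB : MeasurableSet B) (hC : MeasurableSet C)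
    (h : C = A ∪ B) (hd : Disjoint A B) (f : Lp ℝ 1 μ) :
    Kop hF hμF hC f = Kop hF hμF hA f + Kop hF hμF hB f := by
  subst h
  refine Lp.ext ?_
  filter_upwards [Kop_coe hF hμF hA f, Kop_coe hF hμF hB f, Kop_coe hF hμF hC f,
    Lp.coeFn_add (Kop hF hμF hA f) (Kop hF hμF hB f)] with y h1 h2 h3 h4
  rw [h4, Pi.add_apply, h1, h2, h3]
  exact sd_union F hB hd f y

lemma Kop_rect [SFinite μ] {F : Set X} (hF : MeasurableSet F) (hμF : μ F ≠ ⊤)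
    {A B : Set X} (hB : MeasurableSet B) (hG : MeasurableSet (A ×ˢ B))
    (fs : Lp ℝ 1 μ) : TotallyBounded (Kop hF hμF hG '' Set.Icc 0 fs) := by
  have hi : Integrable ((F ∩ B).indicator (fun _ => (1 : ℝ))) μ :=
    (integrable_indicator_iff (hF.inter hB)).2 (integrableOn_const
      (measure_ne_top_of_subset Set.inter_subset_left hμF))
  let v : Lp ℝ 1 μ := hi.toL1 _
  have hc : IsCompact ((fun r : ℝ => r • v) '' Set.Icc (-‖fs‖) ‖fs‖) :=
    isCompact_Icc.image (continuous_id.smul continuous_const)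
  refine hc.totallyBounded.subset ?_
  rintro _ ⟨f, hf, rfl⟩
  refine ⟨∫ x in A, f x ∂μ, ?_, ?_⟩
  · rw [Set.mem_Icc, ← abs_le, ← Real.norm_eq_abs]
    refine (norm_integral_le_integral_norm _).trans ?_
    refine (setIntegral_le_integral (L1.integrable_coeFn f).norm
      (ae_of_all _ fun x => norm_nonneg _)).trans ?_
    rw [← L1.norm_eq_integral_norm]
    exact al_norm_mono hf.1 hf.2
  · refine Lp.ext ?_
    filter_upwards [Kop_coe hF hμF hG f, Lp.coeFn_smul (∫ x in A, f x ∂μ) v,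
      Integrable.coeFn_toL1 hi] with y h1 h2 h3
    simp only [h1, h2, Pi.smul_apply, smul_eq_mul]
    rw [show v y = _ from h3]
    unfold sd
    by_cases hy : y ∈ F
    · by_cases hyB : y ∈ B
      · simp [hy, hyB]
      · simp [hy, hyB]
    · simp [hy]

lemma Kop_small [SFinite μ] {F : Set X} (hF : MeasurableSet F) (hμF : μ F ≠ ⊤)
    {V : ℕ → Set (X × X)} (hV : ∀ n, MeasurableSet (V n)) (hanti : Antitone V)
    (hemp : ⋂ n, V n = ∅) (fs : Lp ℝ 1 μ) :
    Tendsto (fun n => ‖Kop hF hμF (hV n) fs‖) atTop (𝓝 0) := by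
  have h1 : ∀ n, ‖Kop hF hμF (hV n) fs‖ = ∫ y, ‖sd μ F (V n) fs y‖ ∂μ := by
    intro n
    rw [L1.norm_eq_integral_norm]
    refine integral_congr_ae ?_
    filter_upwards [Kop_coe hF hμF (hV n) fs] with y hy
    rw [hy]
  simp only [h1]
  have : Tendsto (fun n => ∫ y, ‖sd μ F (V n) fs y‖ ∂μ) atTop (𝓝 (∫ _, (0 : ℝ) ∂μ)) := by
    refine tendsto_integral_of_dominated_convergence (F.indicator (fun _ => ‖fs‖))
      (fun n => (sd_sm hF (hV n) fs).norm.aestronglyMeasurable)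
      ((integrable_indicator_iff hF).2 (integrableOn_const hμF))
      (fun n => ae_of_all _ fun y => by rw [norm_norm]; exact sd_bound F (V n) fs y)
      (ae_of_all _ fun y => ?_)
    by_cases hy : y ∈ F
    · simp only [sd, Set.indicator_of_mem hy]
      have := tendsto_setIntegral_of_antitone (μ := μ) (f := fs) (s := fun n => {x | (x, y) ∈ V n})
        (fun n => sec_meas (hV n) y) (fun m n h x hx => hanti h hx)
        ⟨0, (L1.integrable_coeFn fs).integrableOn⟩
      have e : ⋂ n, {x | (x, y) ∈ V n} = ∅ := by
        ext x
        have : (x, y) ∉ ⋂ n, V n := by rw [hemp]; exact id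
        simpa using this
      rw [e, setIntegral_empty] at this
      simpa using this.norm
    · simp [sd, hy]
  simpa using this

lemma Kop_tb [SFinite μ] {F : Set X} (hF : MeasurableSet F) (hμF : μ F ≠ ⊤)
    {G : Set (X × X)} (hG : MeasurableSet G) (fs : Lp ℝ 1 μ) :
    TotallyBounded (Kop hF hμF hG '' Set.Icc 0 fs) := by
  induction G, hG using MeasurableSpace.induction_on_inter generateFrom_prod.symm isPiSystem_prod with
  | empty =>
    refine ((Set.finite_singleton (0 : Lp ℝ 1 μ)).totallyBounded).subset ?_
    rintro _ ⟨f, -, rfl⟩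
    refine Lp.ext ?_
    filter_upwards [Kop_coe hF hμF MeasurableSet.empty f, Lp.coeFn_zero ℝ 1 μ] with y h1 h2
    rw [h1, h2]
    simp [sd]
  | basic t ht =>
    obtain ⟨A, hA, B, hB, rfl⟩ := ht
    exact Kop_rect hF hμF hB _ fs
  | compl t ht ih =>
    have hu := Kop_rect hF hμF MeasurableSet.univ (A := Set.univ)
      (MeasurableSet.univ.prod MeasurableSet.univ) fs
    refine tb_add hu (tb_clm ih (-ContinuousLinearMap.id ℝ _)) ?_
    rintro _ ⟨f, hf, rfl⟩
    refine ⟨_, ⟨f, hf, rfl⟩, _, ⟨_, ⟨f, hf, rfl⟩, rfl⟩, ?_⟩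
    rw [Kop_union hF hμF ht ht.compl (MeasurableSet.univ.prod MeasurableSet.univ) (by simp)
      disjoint_compl_right f]
    simp
  | iUnion A hd hA ih =>
    have hUm : ∀ n : ℕ, MeasurableSet (⋃ i, ⋃ (_ : i < n), A i) := fun n =>
      MeasurableSet.iUnion fun i => MeasurableSet.iUnion fun _ => hA i
    have hUtb : ∀ n : ℕ, TotallyBounded (Kop hF hμF (hUm n) '' Set.Icc 0 fs) := by
      intro n
      induction n with
      | zero =>
        refine ((Set.finite_singleton (0 : Lp ℝ 1 μ)).totallyBounded).subset ?_
        rintro _ ⟨f, -, rfl⟩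
        refine Lp.ext ?_
        filter_upwards [Kop_coe hF hμF (hUm 0) f, Lp.coeFn_zero ℝ 1 μ] with y h1 h2
        rw [h1, h2]
        simp [sd]
      | succ n ihn =>
        refine tb_add ihn (ih n) ?_
        rintro _ ⟨f, hf, rfl⟩
        refine ⟨_, ⟨f, hf, rfl⟩, _, ⟨f, hf, rfl⟩, ?_⟩
        refine Kop_union hF hμF _ _ _ (Set.biUnion_lt_succ A n) ?_ f
        refine Set.disjoint_iUnion_left.2 fun i => Set.disjoint_iUnion_left.2 fun hi => ?_
        exact hd hi.ne
    let V : ℕ → Set (X × X) := fun n => (⋃ i, A i) \ (⋃ i, ⋃ (_ : i < n), A i)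
    have hVm : ∀ n, MeasurableSet (V n) := fun n => (MeasurableSet.iUnion hA).diff (hUm n)
    have hVa : Antitone V := by
      intro m n hmn
      refine Set.sdiff_subset_sdiff_right ?_
      exact Set.biUnion_subset_biUnion_left fun i (hi : i < m) => lt_of_lt_of_le hi hmn
    have hVe : ⋂ n, V n = ∅ := by
      rw [Set.eq_empty_iff_forall_notMem]
      intro p hp
      rw [Set.mem_iInter] at hp
      obtain ⟨i, hi⟩ := Set.mem_iUnion.1 (hp 0).1
      exact (hp (i + 1)).2 (Set.mem_iUnion₂.2 ⟨i, Nat.lt_succ_self i, hi⟩)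
    have hs := Kop_small hF hμF hVm hVa hVe fs
    refine tb_of_approx fun ε hε => ?_
    obtain ⟨n, hn⟩ := (hs.eventually (gt_mem_nhds hε)).exists
    refine ⟨_, hUtb n, ?_⟩
    rintro _ ⟨f, hf, rfl⟩
    refine ⟨_, ⟨f, hf, rfl⟩, ?_⟩
    rw [Kop_union hF hμF (hUm n) (hVm n) _ (Set.union_sdiff_cancel
      (Set.iUnion₂_subset fun i _ => Set.subset_iUnion A i)).symm disjoint_sdiff_self_right f,
      add_sub_cancel_left]
    refine lt_of_le_of_lt (al_norm_mono (Kop_pos _ _ _ _ hf.1) ?_) hn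
    exact al_pos_mono (Kop_pos _ _ _) hf.2

lemma Kop_H [SFinite μ] {F : Set X} (hF : MeasurableSet F) (hμF : μ F ≠ ⊤)
    {G : Set (X × X)} (hG : MeasurableSet G) (fs : Lp ℝ 1 μ) {u : ℝ → Lp ℝ 1 μ}
    (hu : ContinuousOn u (Set.Ici 0))
    (h : ∀ s, 0 ≤ s → Kop hF hμF hG (u s) ⊓ Kop hF hμF hG (fs - u s) = 0) (s : ℝ) (hs : 0 ≤ s) :
    Kop hF hμF hG (u s) = Kop hF hμF hG (u 0) := by
  have hc : Continuous (fun s : ℝ => u |s|) :=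
    hu.comp_continuous continuous_abs (fun s => abs_nonneg s)
  have hq : ∀ q : ℚ, ∀ᵐ y ∂μ, sd μ F G (u |(q : ℝ)|) y *
      (sd μ F G fs y - sd μ F G (u |(q : ℝ)|) y) = 0 := by
    intro q
    have := h _ (abs_nonneg (q : ℝ))
    have h2 := Lp.coeFn_inf (Kop hF hμF hG (u |(q : ℝ)|)) (Kop hF hμF hG (fs - u |(q : ℝ)|))
    rw [this] at h2
    filter_upwards [h2, Lp.coeFn_zero ℝ 1 μ, Kop_coe hF hμF hG (u |(q : ℝ)|),
      Kop_coe hF hμF hG (fs - u |(q : ℝ)|)] with y h3 h4 h5 h6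
    rw [h4, Pi.inf_apply, h5, h6, sd_sub, Pi.zero_apply] at h3
    rcases min_choice (sd μ F G (u |(q : ℝ)|) y)
      (sd μ F G fs y - sd μ F G (u |(q : ℝ)|) y) with h7 | h7
    · have h8 : sd μ F G (u |(q : ℝ)|) y = 0 := h7.symm.trans h3.symm
      rw [h8, zero_mul]
    · have h8 : sd μ F G fs y - sd μ F G (u |(q : ℝ)|) y = 0 := h7.symm.trans h3.symm
      rw [h8, mul_zero]
  rw [← ae_all_iff] at hq
  refine Lp.ext ?_
  filter_upwards [hq, Kop_coe hF hμF hG (u s), Kop_coe hF hμF hG (u 0)] with y hy h1 h2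
  rw [h1, h2]
  set V := sd μ F G fs y with hV
  let W : ℝ → ℝ := fun s => sd μ F G (u |s|) y
  have hsd : Continuous (fun f : Lp ℝ 1 μ => sd μ F G f y) := by
    refine (LipschitzWith.of_dist_le_mul (K := 1) fun f g => ?_).continuous
    rw [Real.dist_eq, ← Real.norm_eq_abs, ← sd_sub, dist_eq_norm, NNReal.coe_one, one_mul]
    exact sd_bound' F G (f - g) y
  have hW : Continuous W := hsd.comp hc
  have hall : ∀ s, W s * (V - W s) = 0 := by
    have e : (fun s => W s * (V - W s)) = fun _ => (0 : ℝ) := by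
      refine Rat.denseRange_cast.equalizer (hW.mul (continuous_const.sub hW)) continuous_const ?_
      ext q
      exact hy q
    exact fun s => congrFun e s
  have hval : ∀ s, W s = 0 ∨ W s = V := fun s => by
    rcases mul_eq_zero.1 (hall s) with h | h
    · exact Or.inl h
    · exact Or.inr (sub_eq_zero.1 h).symm
  have key : W s = W 0 := by
    by_contra hne
    have hVne : V ≠ 0 := by
      intro h0
      apply hne
      rcases hval s with h | h <;> rcases hval 0 with h' | h' <;> simp [h, h', h0]
    have hboth : (∃ a, W a = 0) ∧ (∃ b, W b = V) := by
      rcases hval s with h | h <;> rcases hval 0 with h' | h'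
      · exact absurd (h.trans h'.symm) hne
      · exact ⟨⟨_, h⟩, ⟨_, h'⟩⟩
      · exact ⟨⟨_, h'⟩, ⟨_, h⟩⟩
      · exact absurd (h.trans h'.symm) hne
    obtain ⟨⟨a, ha⟩, ⟨b, hb⟩⟩ := hboth
    have : V / 2 ∈ Set.range W := by
      rcases le_total 0 V with h | h
      · exact mem_range_of_exists_le_of_exists_ge hW ⟨a, by linarith⟩ ⟨b, by linarith⟩
      · exact mem_range_of_exists_le_of_exists_ge hW ⟨b, by linarith⟩ ⟨a, by linarith⟩
    obtain ⟨r, hr⟩ := this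
    rcases hval r with h | h
    · apply hVne; linarith
    · apply hVne; linarith
  simpa [W, abs_of_nonneg hs] using key

end Concrete

lemma exists_kernel_set {X : Type*} [MeasurableSpace X] (μ : Measure X) [SigmaFinite μ]
    (k : X → X → ENNReal) (hk : Measurable (Function.uncurry k))
    (hkpos : 0 < ∫⁻ x, ∫⁻ y, k x y ∂μ ∂μ) :
    ∃ (F : Set X) (G : Set (X × X)) (c : ℝ), MeasurableSet F ∧ μ F ≠ ⊤ ∧ MeasurableSet G ∧ 0 < c ∧
      (μ.prod μ) G ≠ 0 ∧ ∀ x y, (x, y) ∈ G → y ∈ F ∧ ENNReal.ofReal c ≤ k x y := by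
  have h1 : 0 < ∫⁻ p, Function.uncurry k p ∂(μ.prod μ) := by
    rw [lintegral_prod _ hk.aemeasurable]; exact hkpos
  rw [lintegral_pos_iff_support hk] at h1
  let G : ℕ × ℕ → Set (X × X) := fun i =>
    {p | ENNReal.ofReal (1 / ((i.1 : ℝ) + 1)) ≤ Function.uncurry k p} ∩
      Prod.snd ⁻¹' (spanningSets μ i.2)
  have hsub : Function.support (Function.uncurry k) ⊆ ⋃ i, G i := by
    rintro ⟨x, y⟩ hp
    obtain ⟨m, hm⟩ : ∃ m, y ∈ spanningSets μ m := by
      have : y ∈ ⋃ m, spanningSets μ m := by rw [iUnion_spanningSets]; trivial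
      exact Set.mem_iUnion.1 this
    obtain ⟨r, hr0, hr⟩ := ENNReal.lt_iff_exists_nnreal_btwn.1 (pos_iff_ne_zero.2 hp)
    obtain ⟨n, hn⟩ := exists_nat_one_div_lt (show (0 : ℝ) < r by exact_mod_cast hr0)
    refine Set.mem_iUnion.2 ⟨(n, m), ?_, hm⟩
    refine le_trans ?_ hr.le
    rw [← ENNReal.ofReal_coe_nnreal]
    exact ENNReal.ofReal_le_ofReal hn.le
  have hne : ∃ i, (μ.prod μ) (G i) ≠ 0 := by
    by_contra hcon
    push Not at hcon
    have := measure_mono_null hsub (measure_iUnion_null hcon)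
    exact h1.ne' this
  obtain ⟨i, hi⟩ := hne
  refine ⟨spanningSets μ i.2, G i, 1 / ((i.1 : ℝ) + 1), measurableSet_spanningSets μ _,
    (measure_spanningSets_lt_top μ _).ne, ?_, by positivity, hi, fun x y h => ⟨h.2, h.1⟩⟩
  exact (measurableSet_le measurable_const hk).inter
    (measurable_snd (measurableSet_spanningSets μ _))

theorem stmt_0 {X : Type*} [MeasurableSpace X] (μ : Measure X) [SigmaFinite μ]
    (P : ℝ → (Lp ℝ 1 μ →ₗ[ℝ] Lp ℝ 1 μ))
    -- `{P(t)}` is a `C₀`-semigroup: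
    (hP0 : ∀ f : Lp ℝ 1 μ, P 0 f = f)
    (hPsem : ∀ s t : ℝ, 0 ≤ s → 0 ≤ t → ∀ f : Lp ℝ 1 μ, P (s + t) f = P s (P t f))
    (hPcont : ∀ f : Lp ℝ 1 μ, ContinuousOn (fun t : ℝ => P t f) (Set.Ici 0))
    -- each `P(t)` is a stochastic operator, i.e. it maps densities to densities:
    (hPstoch : ∀ t : ℝ, 0 ≤ t → ∀ f : Lp ℝ 1 μ,
      (∀ᵐ x ∂μ, 0 ≤ f x) → ‖f‖ = 1 →
      (∀ᵐ x ∂μ, 0 ≤ (P t f) x) ∧ ‖P t f‖ = 1)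
    -- the semigroup is partially integral:
    (t₀ : ℝ) (ht₀ : 0 < t₀)
    (k : X → X → ENNReal) (hk : Measurable (Function.uncurry k))
    (hkpos : 0 < ∫⁻ x, ∫⁻ y, k x y ∂μ ∂μ)
    (hker : ∀ f : Lp ℝ 1 μ, (∀ᵐ x ∂μ, 0 ≤ f x) → ‖f‖ = 1 →
      ∀ᵐ y ∂μ, ∫⁻ x, k x y * ENNReal.ofReal (f x) ∂μ ≤ ENNReal.ofReal ((P t₀ f) y))
    -- `f*` is the unique invariant density and `f* > 0` a.e.:
    (fstar : Lp ℝ 1 μ)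
    (hfnn : ∀ᵐ x ∂μ, 0 ≤ fstar x) (hfnorm : ‖fstar‖ = 1)
    (hfinv : ∀ t : ℝ, 0 ≤ t → P t fstar = fstar)
    (hfuniq : ∀ g : Lp ℝ 1 μ, (∀ᵐ x ∂μ, 0 ≤ g x) → ‖g‖ = 1 →
      (∀ t : ℝ, 0 ≤ t → P t g = g) → g = fstar)
    (hfpos : ∀ᵐ x ∂μ, 0 < fstar x) :
    -- asymptotic stability:
    ∀ f : Lp ℝ 1 μ, (∀ᵐ x ∂μ, 0 ≤ f x) → ‖f‖ = 1 →
      Tendsto (fun t : ℝ => ‖P t f - fstar‖) atTop (nhds 0) := by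
  have hnn : ∀ f : Lp ℝ 1 μ, (∀ᵐ x ∂μ, 0 ≤ f x) ↔ 0 ≤ f := fun f => Lp.coeFn_nonneg f
  simp only [hnn] at hPstoch hker hfnn hfuniq ⊢
  -- scaling
  have hscale : ∀ f : Lp ℝ 1 μ, 0 ≤ f → f ≠ 0 →
      0 ≤ ‖f‖⁻¹ • f ∧ ‖(‖f‖⁻¹ • f)‖ = 1 ∧ f = ‖f‖ • (‖f‖⁻¹ • f) := by
    intro f hf h0
    have hn : 0 < ‖f‖ := norm_pos_iff.2 h0
    refine ⟨smul_nonneg (by positivity) hf, ?_, ?_⟩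
    · rw [norm_smul, norm_inv, norm_norm, inv_mul_cancel₀ hn.ne']
    · rw [smul_smul, mul_inv_cancel₀ hn.ne', one_smul]
  have hpn : ∀ t : ℝ, 0 ≤ t → ∀ f : Lp ℝ 1 μ, 0 ≤ f → 0 ≤ P t f ∧ ‖P t f‖ = ‖f‖ := by
    intro t ht f hf
    by_cases h0 : f = 0
    · simp [h0]
    obtain ⟨a, b, c⟩ := hscale f hf h0
    obtain ⟨p, q⟩ := hPstoch t ht _ a b
    have e : P t f = ‖f‖ • P t (‖f‖⁻¹ • f) := by rw [← map_smul, ← c]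
    rw [e]
    exact ⟨smul_nonneg (norm_nonneg _) p, by rw [norm_smul, norm_norm, q, mul_one]⟩
  have hcontr : ∀ t : ℝ, 0 ≤ t → ∀ f : Lp ℝ 1 μ, ‖P t f‖ ≤ 1 * ‖f‖ := by
    intro t ht f
    rw [one_mul]
    conv_lhs => rw [← posPart_sub_negPart f, map_sub]
    refine (norm_sub_le _ _).trans ?_
    rw [(hpn t ht _ (posPart_nonneg f)).2, (hpn t ht _ (negPart_nonneg f)).2,
      ← lp_add _ _ (posPart_nonneg _) (negPart_nonneg _), posPart_add_negPart, norm_abs_eq_norm]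
  let Q : ℝ → Lp ℝ 1 μ →L[ℝ] Lp ℝ 1 μ := fun t =>
    if ht : 0 ≤ t then (P t).mkContinuous 1 (hcontr t ht) else 0
  have hQ : ∀ t, 0 ≤ t → ∀ f, Q t f = P t f := by
    intro t ht f
    simp only [Q, dif_pos ht, LinearMap.mkContinuous_apply]
  have H : AbsSem Q fstar :=
    { add := lp_add
      zero := fun f => by rw [hQ 0 le_rfl, hP0]
      sem := fun s t hs ht f => by
        rw [hQ _ (add_nonneg hs ht), hQ _ hs, hQ _ ht, hPsem s t hs ht]
      cont := fun f => (hPcont f).congr fun t ht => hQ t ht f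
      pos := fun t ht f hf => by rw [hQ t ht]; exact (hpn t ht f hf).1
      norm := fun t ht f hf => by rw [hQ t ht]; exact (hpn t ht f hf).2
      fpos := hfnn
      fnorm := hfnorm
      finv := fun t ht => by rw [hQ t ht, hfinv t ht]
      uniq := fun g hg hn h => hfuniq g hg hn fun t ht => by rw [← hQ t ht, h t ht] }
  obtain ⟨F, G, c, hF, hμF, hG, hc, hGpos, hGk⟩ := exists_kernel_set μ k hk hkpos
  let K : Lp ℝ 1 μ →L[ℝ] Lp ℝ 1 μ := c • Kop hF hμF hG
  have hKa : ∀ f, K f = c • Kop hF hμF hG f := fun f => rfl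
  have hKpos : ∀ f, 0 ≤ f → 0 ≤ K f := fun f hf => by
    rw [hKa]; exact smul_nonneg hc.le (Kop_pos _ _ _ _ hf)
  have hKP1 : ∀ f, 0 ≤ f → ‖f‖ = 1 → K f ≤ Q t₀ f := by
    intro f hf hf1
    rw [hQ t₀ ht₀.le, hKa, ← Lp.coeFn_le]
    have hPf := (hPstoch t₀ ht₀.le f hf hf1).1
    have hk' := hker f hf hf1
    rw [← Lp.coeFn_nonneg] at hPf
    filter_upwards [hPf, hk', Kop_coe hF hμF hG f, Lp.coeFn_smul c (Kop hF hμF hG f)]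
      with y h1 h2 h3 h4
    rw [h4, Pi.smul_apply, h3, smul_eq_mul]
    rw [Pi.zero_apply] at h1
    by_cases hy : y ∈ F
    · rw [sd, Set.indicator_of_mem hy]
      rw [← ENNReal.ofReal_le_ofReal_iff h1]
      refine le_trans ?_ h2
      rw [ENNReal.ofReal_mul hc.le, ofReal_integral_eq_lintegral_ofReal
        (L1.integrable_coeFn f).integrableOn (ae_restrict_of_ae ((Lp.coeFn_nonneg f).2 hf)),
        ← lintegral_const_mul' _ _ ENNReal.ofReal_ne_top]
      refine le_trans ?_ (setLIntegral_le_lintegral {x | (x, y) ∈ G} _)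
      refine setLIntegral_mono' (sec_meas hG y) fun x hx => ?_
      exact mul_le_mul_left (hGk x y hx).2 _
    · rw [sd, Set.indicator_of_notMem hy, mul_zero]
      exact h1
  have hKP : ∀ f, 0 ≤ f → K f ≤ Q t₀ f := by
    intro f hf
    by_cases h0 : f = 0
    · simp [h0]
    obtain ⟨a, b, e⟩ := hscale f hf h0
    have h1 := smul_le_smul_of_nonneg_left (hKP1 _ a b) (norm_nonneg f)
    rw [← map_smul, ← map_smul, ← e] at h1
    exact h1
  have hKf : K fstar ≠ 0 := by
    intro h0
    rw [hKa, smul_eq_zero, or_iff_right hc.ne'] at h0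
    have h1 := Kop_coe hF hμF hG fstar
    rw [h0] at h1
    apply hGpos
    rw [Measure.prod_apply_symm hG, lintegral_eq_zero_iff (measurable_measure_prodMk_right hG)]
    filter_upwards [h1, Lp.coeFn_zero ℝ 1 μ] with y h2 h3
    rw [h3, Pi.zero_apply] at h2
    by_cases hy : y ∈ F
    · rw [sd, Set.indicator_of_mem hy] at h2
      have h4 := (setIntegral_eq_zero_iff_of_nonneg_ae
        (ae_restrict_of_ae ((Lp.coeFn_nonneg fstar).2 hfnn))
        (L1.integrable_coeFn fstar).integrableOn).1 h2.symm
      have h5 : ∀ᵐ x ∂(μ.restrict {x | (x, y) ∈ G}), False := by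
        filter_upwards [h4, ae_restrict_of_ae hfpos] with x h6 h7
        exact h7.ne' h6
      have h6 : μ.restrict {x | (x, y) ∈ G} Set.univ = 0 := by simpa [ae_iff] using h5
      rwa [Measure.restrict_apply_univ] at h6
    · have : (fun x => (x, y)) ⁻¹' G = ∅ := by
        rw [Set.eq_empty_iff_forall_notMem]
        exact fun x hx => hy (hGk x y hx).1
      simp [this]
  have hKtb : TotallyBounded (K '' Set.Icc 0 fstar) := by
    refine (tb_clm (Kop_tb hF hμF hG fstar) (c • ContinuousLinearMap.id ℝ _)).subset ?_
    rintro _ ⟨f, hf, rfl⟩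
    exact ⟨_, ⟨f, hf, rfl⟩, rfl⟩
  have hunit : ∀ d : Lp ℝ 1 μ, 0 ≤ d → d ⊓ fstar = 0 → d = 0 := by
    intro d hd h
    have h1 := Lp.coeFn_inf d fstar
    rw [h] at h1
    refine Lp.ext ?_
    filter_upwards [h1, Lp.coeFn_zero ℝ 1 μ, hfpos] with x h2 h3 h4
    rw [h3] at h2 ⊢
    simp only [Pi.inf_apply, Pi.zero_apply] at h2 ⊢
    rcases min_choice (d x) (fstar x) with h5 | h5
    · exact h5.symm.trans h2.symm
    · exact absurd (h5.symm.trans h2.symm) h4.ne'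
  intro f hf hf1
  have := H.main ht₀.le hKpos hKP hKf hKtb (fun u hu h s hs => by
    rw [hKa, hKa]
    congr 1
    refine Kop_H hF hμF hG fstar hu (fun s hs => ?_) s hs
    have h1 := h s hs
    rw [hKa, hKa, ← al_smul_inf hc, smul_eq_zero, or_iff_right hc.ne'] at h1
    exact h1) hunit hf hf1
  refine this.congr' ?_
  filter_upwards [eventually_ge_atTop 0] with t ht
  rw [hQ t ht]
end

section
/- Let (X,Σ,μ) be a σ-finite measure space and P a stochastic operator on L¹(X,Σ,μ). If f₁ and f₂ are two distinct invariant densities of P (Pf₁ = f₁, Pf₂ = f₂, f₁ ≠ f₂ in L¹), then ‖(f₁−f₂)⁺‖ > 0, the function h = (f₁−f₂)⁺/‖(f₁−f₂)⁺‖ is an invariant density of P, and h vanishes on a set of positive measure μ. -/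
open MeasureTheory

lemma aux_norm {X : Type*} [MeasurableSpace X] {μ : Measure X} (f : Lp ℝ 1 μ)
    (h : ∀ᵐ x ∂μ, 0 ≤ f x) : ‖f‖ = ∫ x, f x ∂μ := by
  rw [L1.norm_eq_integral_norm]
  apply integral_congr_ae
  filter_upwards [h] with x hx
  exact Real.norm_of_nonneg hx

lemma aux_zero {X : Type*} [MeasurableSpace X] {μ : Measure X} (f : Lp ℝ 1 μ)
    (h : ∀ᵐ x ∂μ, 0 ≤ f x) (h0 : ∫ x, f x ∂μ = 0) : f = 0 := by
  rw [← norm_eq_zero, aux_norm f h, h0]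

lemma aux_sub {X : Type*} [MeasurableSpace X] {μ : Measure X} (f g : Lp ℝ 1 μ) :
    ∫ x, (f - g : Lp ℝ 1 μ) x ∂μ = ∫ x, f x ∂μ - ∫ x, g x ∂μ := by
  rw [integral_congr_ae (Lp.coeFn_sub f g)]
  exact integral_sub (L1.integrable_coeFn f) (L1.integrable_coeFn g)

lemma aux_P {X : Type*} [MeasurableSpace X] {μ : Measure X}
    (P : Lp ℝ 1 μ →ₗ[ℝ] Lp ℝ 1 μ)
    (hPstoch : ∀ f : Lp ℝ 1 μ, (∀ᵐ x ∂μ, 0 ≤ f x) → ‖f‖ = 1 →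
      (∀ᵐ x ∂μ, 0 ≤ (P f) x) ∧ ‖P f‖ = 1) (f : Lp ℝ 1 μ)
    (h : ∀ᵐ x ∂μ, 0 ≤ f x) : (∀ᵐ x ∂μ, 0 ≤ (P f) x) ∧ ‖P f‖ = ‖f‖ := by
  by_cases hf : f = 0
  · subst hf
    rw [map_zero]
    exact ⟨h, rfl⟩
  have hn : 0 < ‖f‖ := norm_pos_iff.mpr hf
  have h1 : ∀ᵐ x ∂μ, 0 ≤ (‖f‖⁻¹ • f) x := by
    filter_upwards [h, Lp.coeFn_smul ‖f‖⁻¹ f] with x hx hs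
    rw [hs]
    exact mul_nonneg (inv_nonneg.mpr hn.le) hx
  have h2 : ‖‖f‖⁻¹ • f‖ = 1 := by
    rw [norm_smul, norm_inv, norm_norm, inv_mul_cancel₀ hn.ne']
  obtain ⟨h3, h4⟩ := hPstoch _ h1 h2
  rw [map_smul] at h3 h4
  constructor
  · filter_upwards [h3, Lp.coeFn_smul ‖f‖⁻¹ (P f)] with x hx hs
    rw [hs] at hx
    exact nonneg_of_mul_nonneg_right hx (inv_pos.mpr hn)
  · rw [norm_smul, norm_inv, norm_norm] at h4
    field_simp at h4
    exact h4


/-- If a stochastic operator `P` on `L¹(X,Σ,μ)` has two distinct invariant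
densities `f₁, f₂`, then `‖(f₁-f₂)⁺‖ > 0`, `h = (f₁-f₂)⁺/‖(f₁-f₂)⁺‖` is an invariant
density of `P`, and `h` vanishes on a set of positive measure. -/
theorem stmt_1 {X : Type*} [MeasurableSpace X] (μ : Measure X) [SigmaFinite μ]
    (P : Lp ℝ 1 μ →ₗ[ℝ] Lp ℝ 1 μ)
    -- `P` is a stochastic operator:
    (hPstoch : ∀ f : Lp ℝ 1 μ, (∀ᵐ x ∂μ, 0 ≤ f x) → ‖f‖ = 1 →
      (∀ᵐ x ∂μ, 0 ≤ (P f) x) ∧ ‖P f‖ = 1)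
    (f₁ f₂ : Lp ℝ 1 μ)
    (h₁nn : ∀ᵐ x ∂μ, 0 ≤ f₁ x) (h₁norm : ‖f₁‖ = 1) (h₁inv : P f₁ = f₁)
    (h₂nn : ∀ᵐ x ∂μ, 0 ≤ f₂ x) (h₂norm : ‖f₂‖ = 1) (h₂inv : P f₂ = f₂)
    (hne : f₁ ≠ f₂) :
    0 < ‖Lp.posPart (f₁ - f₂)‖ ∧
    (∀ᵐ x ∂μ, 0 ≤ (‖Lp.posPart (f₁ - f₂)‖⁻¹ • Lp.posPart (f₁ - f₂)) x) ∧
    ‖‖Lp.posPart (f₁ - f₂)‖⁻¹ • Lp.posPart (f₁ - f₂)‖ = 1 ∧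
    P (‖Lp.posPart (f₁ - f₂)‖⁻¹ • Lp.posPart (f₁ - f₂)) =
      ‖Lp.posPart (f₁ - f₂)‖⁻¹ • Lp.posPart (f₁ - f₂) ∧
    ¬ (∀ᵐ x ∂μ, (‖Lp.posPart (f₁ - f₂)‖⁻¹ • Lp.posPart (f₁ - f₂)) x ≠ 0) := by
  have hP := aux_P P hPstoch
  have hgi : ∫ x, (f₁ - f₂ : Lp ℝ 1 μ) x ∂μ = 0 := by
    rw [aux_sub, ← aux_norm _ h₁nn, ← aux_norm _ h₂nn, h₁norm, h₂norm, sub_self]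
  have hPg : P (f₁ - f₂) = f₁ - f₂ := by rw [map_sub, h₁inv, h₂inv]
  have hg0 : f₁ - f₂ ≠ 0 := sub_ne_zero.mpr hne
  generalize f₁ - f₂ = g at *
  have hpc := Lp.coeFn_posPart g
  generalize Lp.posPart g = p at *
  have hp : ∀ᵐ x ∂μ, 0 ≤ p x := by
    filter_upwards [hpc] with x hx
    rw [hx]; exact le_max_right _ _
  have hq : ∀ᵐ x ∂μ, 0 ≤ (p - g) x := by
    filter_upwards [hpc, Lp.coeFn_sub p g] with x hx hs
    rw [hs, Pi.sub_apply, hx]; exact sub_nonneg.mpr (le_max_left _ _)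
  have hqi := aux_sub p g
  rw [hgi, sub_zero] at hqi
  have hp0 : p ≠ 0 := by
    intro h0
    have : p - g = 0 := by
      apply aux_zero _ hq
      rw [hqi, ← aux_norm _ hp, h0, norm_zero]
    apply hg0
    rw [h0, zero_sub, neg_eq_zero] at this
    exact this
  have hn : 0 < ‖p‖ := norm_pos_iff.mpr hp0
  have hinv : P p = p := by
    rw [← sub_eq_zero]
    apply aux_zero
    · have hPq := (hP _ hq).1
      rw [map_sub, hPg] at hPq
      filter_upwards [hPq, (hP _ hp).1, hpc, Lp.coeFn_sub (P p) p,
        Lp.coeFn_sub (P p) g] with x h1 h2 h3 h4 h5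
      rw [h5, Pi.sub_apply] at h1
      rw [h4, Pi.sub_apply, h3]
      exact sub_nonneg.mpr (max_le (sub_nonneg.mp h1) h2)
    · rw [aux_sub, ← aux_norm _ (hP _ hp).1, ← aux_norm _ hp, (hP _ hp).2, sub_self]
  refine ⟨hn, ?_, ?_, ?_, ?_⟩
  · filter_upwards [hp, Lp.coeFn_smul ‖p‖⁻¹ p] with x hx hs
    rw [hs]
    exact mul_nonneg (inv_nonneg.mpr hn.le) hx
  · rw [norm_smul, norm_inv, norm_norm, inv_mul_cancel₀ hn.ne']
  · rw [map_smul, hinv]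
  · intro hall
    have hpg : p = g := by
      apply Lp.ext
      filter_upwards [hall, Lp.coeFn_smul ‖p‖⁻¹ p, hpc] with x h1 h2 h3
      rw [h2, Pi.smul_apply, smul_eq_mul] at h1
      have h4 : p x ≠ 0 := right_ne_zero_of_mul h1
      rw [h3] at h4 ⊢
      rcases max_choice (g x) 0 with h | h
      · exact h
      · exact absurd h h4
    apply hp0
    apply aux_zero _ hp
    rw [hpg, hgi]
end

section
/- Let X be a separable metric space with Borel σ-algebra Σ and a σ-finite Borel measure μ, and let {P(t)}_{t≥0} be a stochastic semigroup on L¹(X,Σ,μ) possessing a transition probability function, i.e. a family of Markov kernels P(t,x,·) on X such that ∫_A P(t)f(y) μ(dy) = ∫_X P(t,x,A) f(x) μ(dx) for every density f, every t ≥ 0 and every A ∈ Σ. Assume {P(t)}_{t≥0} satisfies condition (K) at every point: for each x₀ ∈ X there exist ε > 0, t > 0 and a measurable function χ ≥ 0 with ∫_X χ dμ > 0 such that P(t,x,A) ≥ ∫_A χ dμ for all A ∈ Σ and all x in the ball B(x₀,ε). If the semigroup has no invariant density, then it is sweeping from compact sets: for every compact set C ⊆ X and every density f, ∫_C P(t)f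 dμ → 0 as t → ∞. -/
open MeasureTheory Filter

lemma renewal_aux (U v r : ℕ → ℝ) (M c : ℝ) (hU0 : ∀ n, 0 ≤ U n) (hUM : ∀ n, U n ≤ M)
    (hv : ∀ n, 0 ≤ v n) (hvs : ∀ n, ∑ j ∈ Finset.range n, v j ≤ 1)
    (hrec : ∀ n, U (n+1) = ∑ j ∈ Finset.range (n+1), v j * U (n - j))
    (hr0 : ∀ n, 0 ≤ r n) (hr : Antitone r)
    (hc : ∀ n, ∑ j ∈ Finset.range (n+1), r j * U (n - j) ≤ c)
    (hns : ¬ Summable r) : Tendsto U atTop (nhds 0) := by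
  have hM : 0 ≤ M := (hU0 0).trans (hUM 0)
  have hsv : Summable v := summable_of_sum_range_le hv hvs
  have hsv1 : ∑' j, v j ≤ 1 := Real.tsum_le_of_sum_range_le hv hvs
  by_cases hz : ∀ j, v j = 0
  · have : ∀ n, U (n+1) = 0 := by intro n; rw [hrec]; simp [hz]
    rw [← tendsto_add_atTop_iff_nat 1]
    simp [this]
  push Not at hz
  obtain ⟨j0, hj0⟩ := hz
  have hbdd : IsBoundedUnder (· ≤ ·) atTop U := isBoundedUnder_of ⟨M, hUM⟩
  have hbdd' : IsBoundedUnder (· ≥ ·) atTop U := isBoundedUnder_of ⟨0, hU0⟩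
  set L := limsup U atTop with hL
  -- get ultrafilter
  have hcl : MapClusterPt L atTop U := by
    rw [mapClusterPt_iff_frequently]
    intro s hs
    obtain ⟨ε, hε, hs⟩ := Metric.mem_nhds_iff.1 hs
    have h1 : ∃ᶠ n in atTop, L - ε < U n :=
      frequently_lt_of_lt_limsup hbdd'.isCoboundedUnder_le (by linarith)
    have h2 : ∀ᶠ n in atTop, U n < L + ε :=
      eventually_lt_of_limsup_lt (by linarith) hbdd
    refine (h1.and_eventually h2).mono fun n hn => hs ?_
    rw [Metric.mem_ball, Real.dist_eq, abs_lt]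
    constructor <;> linarith [hn.1, hn.2]
  obtain ⟨G, hG, hGL⟩ := mapClusterPt_iff_ultrafilter.1 hcl
  have hL0 : 0 ≤ L := ge_of_tendsto' hGL hU0
  let a : ℕ → ℕ → ℝ := fun n j => if j ≤ n then U (n - j) else 0
  have ha0 : ∀ n j, 0 ≤ a n j := by
    intro n j; dsimp only [a]; split_ifs; exacts [hU0 _, le_rfl]
  have haM : ∀ n j, a n j ≤ M := by
    intro n j; dsimp only [a]; split_ifs; exacts [hUM _, hM]
  have hlim : ∀ j, ∃ l, Tendsto (fun n => a n j) G (nhds l) := by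
    intro j
    have := (isCompact_Icc (a := (0:ℝ)) (b := M)).ultrafilter_le_nhds (G.map (fun n => a n j))
      (by simp only [le_principal_iff, Ultrafilter.mem_coe, Ultrafilter.mem_map]
          exact univ_mem' fun n => ⟨ha0 n j, haM n j⟩)
    obtain ⟨l, -, hl⟩ := this
    exact ⟨l, hl⟩
  choose l hl using hlim
  have hl0 : l 0 = L := tendsto_nhds_unique (hl 0) (by simpa [a] using hGL)
  have hlL : ∀ j, l j ≤ L := by
    intro j
    refine le_of_forall_pos_le_add fun ε hε => ?_
    have h2 : ∀ᶠ n in atTop, U n < L + ε :=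
      eventually_lt_of_limsup_lt (by linarith) hbdd
    refine le_of_tendsto (hl j) (hG ?_)
    have h3 := (tendsto_sub_atTop_nat j).eventually h2
    filter_upwards [h3] with n hn
    dsimp only [a]; split_ifs
    · exact hn.le
    · linarith
  have hl00 : ∀ j, 0 ≤ l j := fun j => ge_of_tendsto' (hl j) (fun n => ha0 n j)
  have hstep : ∀ m, l m = ∑' j, v j * l (m + 1 + j) := by
    intro m
    have h1 : Tendsto (fun n => ∑' j, v j * a n (m + 1 + j)) G (nhds (∑' j, v j * l (m + 1 + j))) := by
      refine tendsto_tsum_of_dominated_convergence (bound := fun j => v j * M)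
        (hsv.mul_right M) ?_ ?_
      · intro j
        exact (hl _).const_mul _
      · refine Eventually.of_forall fun n j => ?_
        rw [Real.norm_eq_abs, abs_of_nonneg (mul_nonneg (hv _) (ha0 _ _))]
        exact mul_le_mul_of_nonneg_left (haM _ _) (hv _)
    refine tendsto_nhds_unique (hl m) (h1.congr' (hG ?_))
    filter_upwards [eventually_ge_atTop (m+1)] with n hn
    obtain ⟨k, rfl⟩ := Nat.exists_eq_add_of_le hn
    have : a (m + 1 + k) m = U (k + 1) := by
      dsimp only [a]; rw [if_pos (by omega)]; congr 1; omega
    rw [this, hrec, tsum_eq_sum (s := Finset.range (k+1))]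
    · refine Finset.sum_congr rfl fun j hj => ?_
      rw [Finset.mem_range] at hj
      dsimp only [a]; rw [if_pos (by omega)]; congr 2; omega
    · intro j hj
      rw [Finset.mem_range] at hj
      dsimp only [a]; rw [if_neg (by omega), mul_zero]
  have hprop : ∀ m, l m = L → l (m + 1 + j0) = L := by
    intro m hm
    have hs1 : Summable fun j => v j * l (m + 1 + j) :=
      Summable.of_nonneg_of_le (fun j => mul_nonneg (hv _) (hl00 _))
        (fun j => mul_le_mul_of_nonneg_left (hlL _) (hv _)) (hsv.mul_right L)
    have hs2 : Summable fun j => v j * (L - l (m + 1 + j)) := by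
      simpa [mul_sub] using (hsv.mul_right L).sub hs1
    have h3 : ∑' j, v j * (L - l (m + 1 + j)) ≤ 0 := by
      have : ∑' j, v j * (L - l (m + 1 + j)) = (∑' j, v j) * L - ∑' j, v j * l (m + 1 + j) := by
        rw [← tsum_mul_right, ← (hsv.mul_right L).tsum_sub hs1]
        simp only [mul_sub]
      rw [this, ← hstep, hm]
      nlinarith
    have h4 := hs2.le_tsum j0 (fun j _ => mul_nonneg (hv j) (sub_nonneg.2 (hlL _)))
    have h5 : 0 < v j0 := lt_of_le_of_ne (hv _) (Ne.symm hj0)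
    have h6 : L - l (m+1+j0) ≤ 0 := by
      by_contra h
      push Not at h
      have := mul_pos h5 h
      linarith
    linarith [hlL (m+1+j0)]
  have hmul : ∀ i, l ((j0+1) * i) = L := by
    intro i
    induction i with
    | zero => simpa using hl0
    | succ i ih => 
      have := hprop _ ih
      rw [← this]; congr 1; ring
  have hsum : ∀ N, L * ∑ i ∈ Finset.range N, r ((j0+1)*i) ≤ c := by
    intro N
    have h1 : Tendsto (fun n => ∑ i ∈ Finset.range N, r ((j0+1)*i) * a n ((j0+1)*i)) G
        (nhds (∑ i ∈ Finset.range N, r ((j0+1)*i) * L)) := by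
      refine tendsto_finsetSum _ fun i _ => ?_
      have := hl ((j0+1)*i)
      rw [hmul] at this
      exact this.const_mul _
    rw [Finset.mul_sum]
    simp_rw [mul_comm L]
    refine le_of_tendsto' h1 fun n => ?_
    refine le_trans ?_ (hc n)
    have e1 : ∑ j ∈ Finset.range (n+1), r j * U (n - j) = ∑ j ∈ Finset.range (n+1) ∪ (Finset.range N).image (fun i => (j0+1)*i), r j * a n j := by
      rw [← Finset.sum_subset (Finset.subset_union_left (s₁ := Finset.range (n+1)))]
      · refine Finset.sum_congr rfl fun j hj => ?_
        rw [Finset.mem_range] at hj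
        dsimp only [a]; rw [if_pos (by omega)]
      · intro j _ hj
        rw [Finset.mem_range] at hj
        dsimp only [a]; rw [if_neg (by omega), mul_zero]
    rw [e1]
    have e2 : ∑ i ∈ Finset.range N, r ((j0+1)*i) * a n ((j0+1)*i) = ∑ j ∈ (Finset.range N).image (fun i => (j0+1)*i), r j * a n j := by
      rw [Finset.sum_image]
      intro x _ y _ h
      exact Nat.eq_of_mul_eq_mul_left (Nat.succ_pos j0) h
    rw [e2]
    exact Finset.sum_le_sum_of_subset_of_nonneg Finset.subset_union_right
      (fun j _ _ => mul_nonneg (hr0 _) (ha0 _ _))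
  have hLz : L = 0 := by
    by_contra hne
    have hLp : 0 < L := lt_of_le_of_ne hL0 (Ne.symm hne)
    apply hns
    have hs : Summable fun i => r ((j0+1)*i) := by
      refine summable_of_sum_range_le (c := c / L) (fun i => hr0 _) fun N => ?_
      rw [le_div_iff₀ hLp, mul_comm]; exact hsum N
    have hsi : Summable fun i => ((j0+1 : ℕ):ℝ) * r ((j0+1)*i) := hs.mul_left _
    refine summable_of_sum_range_le (c := ∑' i, ((j0+1 : ℕ):ℝ) * r ((j0+1)*i)) hr0 fun N => ?_
    have k1 : ∑ i ∈ Finset.range N, r i ≤ ∑ i ∈ Finset.range ((j0+1)*N), r i :=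
      Finset.sum_le_sum_of_subset_of_nonneg
        (Finset.range_mono (Nat.le_mul_of_pos_left _ (Nat.succ_pos _))) (fun j _ _ => hr0 j)
    have k2 : ∀ N, ∑ i ∈ Finset.range ((j0+1)*N), r i ≤ ∑ i ∈ Finset.range N, ((j0+1 : ℕ):ℝ) * r ((j0+1)*i) := by
      intro N
      induction N with
      | zero => simp
      | succ N ih =>
        rw [Finset.sum_range_succ, mul_add, mul_one, Finset.sum_range_add]
        refine add_le_add ih ?_
        calc _ ≤ ∑ i ∈ Finset.range (j0+1), r ((j0+1)*N) :=
              Finset.sum_le_sum fun i _ => hr (Nat.le_add_right _ _)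
          _ = _ := by simp
    exact k1.trans ((k2 N).trans (hsi.sum_le_tsum _ (fun i _ => mul_nonneg (Nat.cast_nonneg _) (hr0 _))))
  refine tendsto_of_le_liminf_of_limsup_le ?_ (hLz ▸ hL ▸ le_rfl) hbdd hbdd'
  exact le_liminf_of_le hbdd.isCoboundedUnder_ge (Eventually.of_forall hU0)

lemma op_sweep {E : Type*} [NormedAddCommGroup E] [NormedSpace ℝ E] [CompleteSpace E]
    [PartialOrder E] [IsOrderedAddMonoid E] [OrderClosedTopology E]
    (I b : E →L[ℝ] ℝ) (T : E →L[ℝ] E) (χ : E) (hχ : 0 ≤ χ) (hχ0 : 0 < I χ)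
    (hI : ∀ f, 0 ≤ f → ‖f‖ = I f) (hT : ∀ f, 0 ≤ f → 0 ≤ T f)
    (hIT : ∀ f, 0 ≤ f → I (T f) = I f) (hb : ∀ f, 0 ≤ f → 0 ≤ b f)
    (hbI : ∀ f, 0 ≤ f → b f ≤ I f)
    (hmin : ∀ f, 0 ≤ f → b f • χ ≤ T f) (hno : ∀ h, 0 ≤ h → T h = h → I h = 0) :
    ∀ f, 0 ≤ f → Tendsto (fun n => b (T^[n] f)) atTop (nhds 0) := by
  have hI0 : ∀ f, 0 ≤ f → 0 ≤ I f := fun f hf => hI f hf ▸ norm_nonneg f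
  let Q : E →L[ℝ] E := T - b.smulRight χ
  have hQ : ∀ f, Q f = T f - b f • χ := fun f => rfl
  have hQ0 : ∀ f, 0 ≤ f → 0 ≤ Q f := fun f hf => by rw [hQ]; exact sub_nonneg.2 (hmin f hf)
  have hIQ : ∀ f, 0 ≤ f → I (Q f) = I f - b f * I χ := fun f hf => by
    rw [hQ, map_sub, hIT f hf, map_smul, smul_eq_mul]
  have hQn : ∀ f, 0 ≤ f → ∀ n, 0 ≤ Q^[n] f := by
    intro f hf n
    induction n with
    | zero => simpa
    | succ n ih => rw [Function.iterate_succ_apply']; exact hQ0 _ ih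
  have hTn : ∀ f, 0 ≤ f → ∀ n, 0 ≤ T^[n] f := by
    intro f hf n
    induction n with
    | zero => simpa
    | succ n ih => rw [Function.iterate_succ_apply']; exact hT _ ih
  have hITn : ∀ f, 0 ≤ f → ∀ n, I (T^[n] f) = I f := by
    intro f hf n
    induction n with
    | zero => simp
    | succ n ih => rw [Function.iterate_succ_apply', hIT _ (hTn f hf n), ih]
  have hIQn : ∀ f, 0 ≤ f → ∀ n, I (Q^[n] f) = I f - I χ * ∑ j ∈ Finset.range n, b (Q^[j] f) := by
    intro f hf n
    induction n with
    | zero => simp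
    | succ n ih => 
      rw [Function.iterate_succ_apply', hIQ _ (hQn f hf n), ih, Finset.sum_range_succ]; ring
  have hbs : ∀ f, 0 ≤ f → ∀ n, ∑ j ∈ Finset.range n, b (Q^[j] f) ≤ I f / I χ := by
    intro f hf n
    rw [le_div_iff₀ hχ0]
    have := hIQn f hf n
    have := hI0 _ (hQn f hf n)
    linarith
  let U : ℕ → ℝ := fun n => Nat.casesOn n 1 (fun m => b (T^[m] χ))
  have hUs : ∀ n, U (n+1) = b (T^[n] χ) := fun n => rfl
  have hUz : U 0 = 1 := rfl
  have hlast : ∀ n, T^[n] χ = ∑ j ∈ Finset.range (n+1), U (n - j) • Q^[j] χ := by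
    intro n
    induction n with
    | zero => simp [hUz]
    | succ n ih =>
      rw [Function.iterate_succ_apply', Finset.sum_range_succ']
      have : T (T^[n] χ) = Q (T^[n] χ) + U (n+1) • χ := by rw [hQ, hUs]; abel
      rw [this]
      congr 1
      · rw [ih, map_sum]
        refine Finset.sum_congr rfl fun j hj => ?_
        rw [map_smul, Function.iterate_succ_apply', Nat.add_sub_add_right]
  have hU0 : ∀ n, 0 ≤ U n := by
    intro n
    cases n with
    | zero => simp [hUz]
    | succ n => rw [hUs]; exact hb _ (hTn _ hχ n)
  have hUM : ∀ n, U n ≤ max 1 (I χ) := by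
    intro n
    cases n with
    | zero => simp [hUz]
    | succ n => 
      rw [hUs]; exact ((hbI _ (hTn _ hχ n)).trans (hITn _ hχ n).le).trans (le_max_right _ _)
  have hUlim : Tendsto U atTop (nhds 0) := by
    refine renewal_aux U (fun j => b (Q^[j] χ)) (fun j => I (Q^[j] χ)) (max 1 (I χ)) (I χ) hU0 hUM
      (fun n => hb _ (hQn _ hχ n)) (fun n => ?_) (fun n => ?_) (fun n => hI0 _ (hQn _ hχ n)) ?_
      (fun n => ?_) ?_
    · simpa [div_self hχ0.ne'] using hbs χ hχ n
    · rw [hUs, hlast, map_sum]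
      refine Finset.sum_congr rfl fun j hj => ?_
      rw [map_smul, smul_eq_mul, mul_comm]
    · refine antitone_nat_of_succ_le fun n => ?_
      rw [Function.iterate_succ_apply', hIQ _ (hQn _ hχ n)]
      nlinarith [hb _ (hQn _ hχ n)]
    · rw [← hITn χ hχ n]
      conv_rhs => rw [hlast, map_sum]
      refine (Finset.sum_congr rfl fun j hj => ?_).le
      rw [map_smul, smul_eq_mul, mul_comm]
    · intro hs
      have hq : Summable fun j => Q^[j] χ := by
        refine Summable.of_norm ?_
        refine hs.congr fun j => (hI _ (hQn _ hχ j)).symm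
      set h := ∑' j, Q^[j] χ with hh
      have h0 : 0 ≤ h := tsum_nonneg fun j => hQn _ hχ j
      have hQh : h = χ + Q h := by
        conv_lhs => rw [hh, hq.tsum_eq_zero_add]
        congr 1
        rw [hh, Q.map_tsum hq]
        simp only [Function.iterate_succ_apply']
      have hIh := congrArg I hQh
      rw [map_add, hIQ h h0] at hIh
      have hbh : b h = 1 := by
        have : (b h - 1) * I χ = 0 := by linarith
        rcases mul_eq_zero.1 this with h | h
        · linarith
        · exact absurd h hχ0.ne'
      have hTh : T h = h := by
        rw [hQ, hbh, one_smul] at hQh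
        conv_rhs => rw [hQh]
        abel
      have h1 := hno h h0 hTh
      have h2 := hI0 _ (hQ0 h h0)
      rw [hIQ h h0] at h2
      rw [hbh] at h2; linarith
  intro f hf
  have hfirst : ∀ n (f : E), T^[n] f = Q^[n] f + ∑ k ∈ Finset.range n, b (Q^[k] f) • T^[n-1-k] χ := by
    intro n
    induction n with
    | zero => simp
    | succ n ih => 
      intro f
      have : T f = Q f + b f • χ := by rw [hQ]; abel
      have hadd : ∀ (n : ℕ) (x y : E) (c : ℝ), T^[n] (x + c • y) = T^[n] x + c • T^[n] y := by
        intro n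
        induction n with
        | zero => simp
        | succ n ih => intro x y c; simp [Function.iterate_succ_apply, ih]
      rw [Function.iterate_succ_apply, this, hadd, ih, Finset.sum_range_succ', ← Function.iterate_succ_apply,
        add_assoc]
      congr 2
      · refine Finset.sum_congr rfl fun j hj => ?_
        rw [← Function.iterate_succ_apply, show n + 1 - 1 - (j + 1) = n - 1 - j by omega]
  have hsum : Summable fun k => b (Q^[k] f) :=
    summable_of_sum_range_le (fun n => hb _ (hQn f hf n)) (hbs f hf)
  have hA : Tendsto (fun n => ∑' k, b (Q^[k] f) * (if k < n then U (n - k) else 0)) atTop (nhds (∑' k, b (Q^[k] f) * 0)) := by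
    refine tendsto_tsum_of_dominated_convergence (bound := fun k => b (Q^[k] f) * max 1 (I χ)) (hsum.mul_right _) ?_ ?_
    · intro k
      refine Tendsto.const_mul _ ?_
      refine (hUlim.comp (tendsto_sub_atTop_nat k)).congr' ?_
      filter_upwards [eventually_gt_atTop k] with n hn
      simp [hn]
    · refine Eventually.of_forall fun n k => ?_
      have : 0 ≤ (if k < n then U (n - k) else 0) := by split_ifs; exacts [hU0 _, le_rfl]
      rw [Real.norm_eq_abs, abs_of_nonneg (mul_nonneg (hb _ (hQn f hf _)) this)]
      refine mul_le_mul_of_nonneg_left ?_ (hb _ (hQn f hf _))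
      split_ifs
      · exact hUM _
      · positivity
  have hB := hsum.tendsto_atTop_zero.add hA
  simp only [mul_zero, tsum_zero, add_zero] at hB
  refine hB.congr fun n => ?_
  rw [hfirst, map_add, map_sum, tsum_eq_sum (s := Finset.range n)]
  · congr 1
    refine Finset.sum_congr rfl fun k hk => ?_
    rw [Finset.mem_range] at hk
    rw [if_pos hk, map_smul, smul_eq_mul, show n - k = (n - 1 - k) + 1 by omega, hUs]
  · intro k hk
    rw [Finset.mem_range] at hk
    rw [if_neg hk, mul_zero]

lemma exists_setI {X : Type*} [MeasurableSpace X] (μ : Measure X) :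
    ∃ J : Set X → (Lp ℝ 1 μ →L[ℝ] ℝ), ∀ A f, J A f = ∫ x in A, f x ∂μ := by
  have key : ∀ A : Set X, ∃ J : Lp ℝ 1 μ →L[ℝ] ℝ, ∀ f, J f = ∫ x in A, f x ∂μ := by
    intro A
    refine ⟨LinearMap.mkContinuous
      { toFun := fun f => ∫ x in A, f x ∂μ
        map_add' := fun f g => ?_
        map_smul' := fun c f => ?_ } 1 ?_, fun f => rfl⟩
    · rw [← integral_add (L1.integrable_coeFn f).integrableOn (L1.integrable_coeFn g).integrableOn]
      exact integral_congr_ae (ae_restrict_of_ae (Lp.coeFn_add f g))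
    · rw [RingHom.id_apply, smul_eq_mul, ← integral_const_mul]
      exact integral_congr_ae (ae_restrict_of_ae (Lp.coeFn_smul c f))
    · intro f
      rw [one_mul, L1.norm_eq_integral_norm]
      refine (norm_integral_le_integral_norm _).trans ?_
      exact setIntegral_le_integral (L1.integrable_coeFn f).norm
        (Eventually.of_forall fun x => norm_nonneg _)
  choose J hJ using key
  exact ⟨J, hJ⟩

lemma semigroup_invariant {X : Type*} [MeasurableSpace X] (μ : Measure X)
    (P : ℝ → (Lp ℝ 1 μ →L[ℝ] Lp ℝ 1 μ))
    (hPsem : ∀ s t : ℝ, 0 ≤ s → 0 ≤ t → ∀ f : Lp ℝ 1 μ, P (s + t) f = P s (P t f))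
    (hPcont : ∀ f : Lp ℝ 1 μ, ContinuousOn (fun t : ℝ => P t f) (Set.Ici 0))
    (hpos : ∀ t : ℝ, 0 ≤ t → ∀ f : Lp ℝ 1 μ, 0 ≤ f → 0 ≤ P t f ∧ ‖P t f‖ = ‖f‖)
    (t₀ : ℝ) (ht₀ : 0 < t₀) (h : Lp ℝ 1 μ) (h0 : 0 ≤ h) (hh : h ≠ 0) (hT : P t₀ h = h) :
    ∃ g : Lp ℝ 1 μ, (∀ᵐ x ∂μ, 0 ≤ g x) ∧ ‖g‖ = 1 ∧ ∀ t : ℝ, 0 ≤ t → P t g = g := by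
  obtain ⟨J, hJ⟩ := exists_setI μ
  have hII : ∀ a b : ℝ, 0 ≤ a → 0 ≤ b → IntervalIntegrable (fun s => P s h) volume a b := by
    intro a b ha hb
    refine ((hPcont h).mono ?_).intervalIntegrable
    intro x hx
    exact (le_min ha hb).trans hx.1
  set g : Lp ℝ 1 μ := ∫ s in (0:ℝ)..t₀, P s h with hg
  have hJpos : ∀ A f, 0 ≤ f → 0 ≤ J A f := by
    intro A f hf
    rw [hJ]
    exact integral_nonneg_of_ae (ae_restrict_of_ae ((Lp.coeFn_nonneg f).2 hf))
  have hnorm : ∀ f : Lp ℝ 1 μ, 0 ≤ f → J Set.univ f = ‖f‖ := by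
    intro f hf
    rw [hJ, L1.norm_eq_integral_norm, setIntegral_univ]
    refine integral_congr_ae ?_
    filter_upwards [(Lp.coeFn_nonneg f).2 hf] with x hx
    exact (abs_of_nonneg hx).symm
  have hJg : ∀ A, J A g = ∫ s in (0:ℝ)..t₀, J A (P s h) := fun A =>
    ((J A).intervalIntegral_comp_comm (hII 0 t₀ le_rfl ht₀.le)).symm
  have hg0 : ∀ᵐ x ∂μ, 0 ≤ g x := by
    refine ae_nonneg_of_forall_setIntegral_nonneg (L1.integrable_coeFn g) fun A _ _ => ?_
    rw [← hJ, hJg]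
    exact intervalIntegral.integral_nonneg ht₀.le fun s hs => hJpos _ _ (hpos s hs.1 h h0).1
  have hg0' : 0 ≤ g := (Lp.coeFn_nonneg g).1 hg0
  have hgn : ‖g‖ = t₀ * ‖h‖ := by
    rw [← hnorm g hg0', hJg]
    have : ∫ s in (0:ℝ)..t₀, J Set.univ (P s h) = ∫ s in (0:ℝ)..t₀, ‖h‖ := by
      refine intervalIntegral.integral_congr fun s hs => ?_
      rw [Set.uIcc_of_le ht₀.le] at hs
      have := hpos s hs.1 h h0
      simp only [hnorm _ this.1, this.2]
    rw [this]; simp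
  have hgp : 0 < ‖g‖ := by rw [hgn]; exact mul_pos ht₀ (norm_pos_iff.2 hh)
  have hinv : ∀ t : ℝ, 0 ≤ t → P t g = g := by
    intro t ht
    have e1 : P t g = ∫ s in (0:ℝ)..t₀, P (t + s) h := by
      rw [hg, ← (P t).intervalIntegral_comp_comm (hII 0 t₀ le_rfl ht₀.le)]
      refine intervalIntegral.integral_congr fun s hs => ?_
      rw [Set.uIcc_of_le ht₀.le] at hs
      exact (hPsem t s ht hs.1 h).symm
    have e2 : ∫ s in (0:ℝ)..t₀, P (t + s) h = ∫ s in t..(t + t₀), P s h := by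
      rw [intervalIntegral.integral_comp_add_left (fun s => P s h)]; simp
    have e3 : ∫ s in t₀..(t + t₀), P s h = ∫ s in (0:ℝ)..t, P s h := by
      have : ∫ s in (0:ℝ)..t, P (s + t₀) h = ∫ s in t₀..(t + t₀), P s h := by
        rw [intervalIntegral.integral_comp_add_right (fun s => P s h)]; simp
      rw [← this]
      refine intervalIntegral.integral_congr fun s hs => ?_
      rw [Set.uIcc_of_le ht] at hs
      show P (s + t₀) h = P s h
      rw [hPsem s t₀ hs.1 ht₀.le, hT]
    have e4 := intervalIntegral.integral_add_adjacent_intervals (hII 0 t le_rfl ht)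
      (hII t (t + t₀) ht (by linarith))
    have e5 := intervalIntegral.integral_add_adjacent_intervals (hII 0 t₀ le_rfl ht₀.le)
      (hII t₀ (t + t₀) ht₀.le (by linarith))
    rw [e1, e2, hg]
    rw [e3, ← e4, add_comm] at e5
    exact (add_left_cancel e5).symm
  refine ⟨‖g‖⁻¹ • g, ?_, ?_, fun t ht => by rw [map_smul, hinv t ht]⟩
  · filter_upwards [Lp.coeFn_smul ‖g‖⁻¹ g, hg0] with x hx hx0
    rw [hx, Pi.smul_apply, smul_eq_mul]
    positivity
  · rw [norm_smul, norm_inv, norm_norm, inv_mul_cancel₀ hgp.ne']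

/-- A stochastic semigroup on `L¹` of a separable metric space with a
σ-finite Borel measure, possessing a transition probability function and satisfying
condition (K) at every point, is sweeping from compact sets whenever it has no
invariant density. -/
theorem stmt_2 {X : Type*} [MetricSpace X] [TopologicalSpace.SeparableSpace X]
    [MeasurableSpace X] [BorelSpace X] (μ : Measure X) [SigmaFinite μ]
    (P : ℝ → (Lp ℝ 1 μ →ₗ[ℝ] Lp ℝ 1 μ))
    -- `{P(t)}` is a `C₀`-semigroup of stochastic operators:
    (hP0 : ∀ f : Lp ℝ 1 μ, P 0 f = f)
    (hPsem : ∀ s t : ℝ, 0 ≤ s → 0 ≤ t → ∀ f : Lp ℝ 1 μ, P (s + t) f = P s (P t f))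
    (hPcont : ∀ f : Lp ℝ 1 μ, ContinuousOn (fun t : ℝ => P t f) (Set.Ici 0))
    (hPstoch : ∀ t : ℝ, 0 ≤ t → ∀ f : Lp ℝ 1 μ,
      (∀ᵐ x ∂μ, 0 ≤ f x) → ‖f‖ = 1 →
      (∀ᵐ x ∂μ, 0 ≤ (P t f) x) ∧ ‖P t f‖ = 1)
    -- transition probability function:
    (κ : ℝ → X → Measure X)
    (hκmeas : ∀ t : ℝ, 0 ≤ t → Measurable (κ t))
    (hκprob : ∀ t : ℝ, 0 ≤ t → ∀ x : X, IsProbabilityMeasure (κ t x))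
    (hκtrans : ∀ t : ℝ, 0 ≤ t → ∀ f : Lp ℝ 1 μ,
      (∀ᵐ x ∂μ, 0 ≤ f x) → ‖f‖ = 1 → ∀ A : Set X, MeasurableSet A →
      ∫ y in A, (P t f) y ∂μ = ∫ x, (κ t x A).toReal * f x ∂μ)
    -- condition (K) at every point:
    (hK : ∀ x₀ : X, ∃ ε : ℝ, 0 < ε ∧ ∃ t : ℝ, 0 < t ∧ ∃ χ : X → ℝ,
      Measurable χ ∧ (∀ y, 0 ≤ χ y) ∧ 0 < ∫ y, χ y ∂μ ∧
      ∀ x ∈ Metric.ball x₀ ε, ∀ A : Set X, MeasurableSet A →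
        ∫ y in A, χ y ∂μ ≤ (κ t x A).toReal)
    -- no invariant density:
    (hnoinv : ¬ ∃ fstar : Lp ℝ 1 μ, (∀ᵐ x ∂μ, 0 ≤ fstar x) ∧ ‖fstar‖ = 1 ∧
      ∀ t : ℝ, 0 ≤ t → P t fstar = fstar) :
    -- sweeping from compact sets:
    ∀ C : Set X, IsCompact C → ∀ f : Lp ℝ 1 μ, (∀ᵐ x ∂μ, 0 ≤ f x) → ‖f‖ = 1 →
      Tendsto (fun t : ℝ => ∫ x in C, (P t f) x ∂μ) atTop (nhds 0) := by
  obtain ⟨J, hJ⟩ := exists_setI μ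
  have hJpos : ∀ A f, 0 ≤ f → 0 ≤ J A f := by
    intro A f hf
    rw [hJ]
    exact integral_nonneg_of_ae (ae_restrict_of_ae ((Lp.coeFn_nonneg f).2 hf))
  have hJmono : ∀ A B f, A ⊆ B → 0 ≤ f → J A f ≤ J B f := by
    intro A B f hAB hf
    rw [hJ, hJ]
    exact setIntegral_mono_set (L1.integrable_coeFn f).integrableOn
      (ae_restrict_of_ae ((Lp.coeFn_nonneg f).2 hf)) (HasSubset.Subset.eventuallyLE hAB)
  have hnorm : ∀ f : Lp ℝ 1 μ, 0 ≤ f → J Set.univ f = ‖f‖ := by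
    intro f hf
    rw [hJ, L1.norm_eq_integral_norm, setIntegral_univ]
    refine integral_congr_ae ?_
    filter_upwards [(Lp.coeFn_nonneg f).2 hf] with x hx
    exact (abs_of_nonneg hx).symm
  have hscale : ∀ f : Lp ℝ 1 μ, 0 ≤ f → f ≠ 0 → (∀ᵐ x ∂μ, 0 ≤ (‖f‖⁻¹ • f : Lp ℝ 1 μ) x) ∧
      ‖(‖f‖⁻¹ • f : Lp ℝ 1 μ)‖ = 1 ∧ f = ‖f‖ • (‖f‖⁻¹ • f) := by
    intro f hf hf0
    have hfp := norm_pos_iff.2 hf0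
    refine ⟨?_, ?_, ?_⟩
    · filter_upwards [Lp.coeFn_smul ‖f‖⁻¹ f, (Lp.coeFn_nonneg f).2 hf] with x hx hx0
      rw [hx, Pi.smul_apply, smul_eq_mul]
      exact mul_nonneg (inv_nonneg.2 hfp.le) hx0
    · rw [norm_smul, norm_inv, norm_norm, inv_mul_cancel₀ hfp.ne']
    · rw [smul_smul, mul_inv_cancel₀ hfp.ne', one_smul]
  have hpos : ∀ t : ℝ, 0 ≤ t → ∀ f : Lp ℝ 1 μ, 0 ≤ f → 0 ≤ P t f ∧ ‖P t f‖ = ‖f‖ := by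
    intro t ht f hf
    by_cases hf0 : f = 0
    · simp [hf0]
    obtain ⟨h1, h2, h3⟩ := hscale f hf hf0
    obtain ⟨h4, h5⟩ := hPstoch t ht _ h1 h2
    have h6 : P t f = ‖f‖ • P t (‖f‖⁻¹ • f) := by
      conv_lhs => rw [h3]
      rw [map_smul]
    rw [h6]
    refine ⟨?_, ?_⟩
    · rw [← Lp.coeFn_nonneg]
      filter_upwards [Lp.coeFn_smul ‖f‖ (P t (‖f‖⁻¹ • f)), h4] with x hx hx0
      rw [hx, Pi.smul_apply, smul_eq_mul]
      exact mul_nonneg (norm_nonneg _) hx0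
    · rw [norm_smul, h5, norm_norm, mul_one]
  have htrans : ∀ t : ℝ, 0 ≤ t → ∀ f : Lp ℝ 1 μ, 0 ≤ f → ∀ A : Set X, MeasurableSet A →
      J A (P t f) = ∫ x, (κ t x A).toReal * f x ∂μ := by
    intro t ht f hf A hA
    by_cases hf0 : f = 0
    · subst hf0
      rw [map_zero, map_zero]
      symm
      refine integral_eq_zero_of_ae ?_
      filter_upwards [Lp.coeFn_zero ℝ 1 μ] with x hx
      rw [hx]; simp
    obtain ⟨h1, h2, h3⟩ := hscale f hf hf0
    have h5 := hκtrans t ht _ h1 h2 A hA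
    have h6 : P t f = ‖f‖ • P t (‖f‖⁻¹ • f) := by
      conv_lhs => rw [h3]
      rw [map_smul]
    rw [h6, map_smul, hJ, h5, smul_eq_mul, ← integral_const_mul]
    refine integral_congr_ae ?_
    filter_upwards [Lp.coeFn_smul ‖f‖⁻¹ f] with x hx
    rw [hx, Pi.smul_apply, smul_eq_mul]
    have hfp := (norm_pos_iff.2 hf0).ne'
    field_simp
  have hcontr : ∀ t : ℝ, 0 ≤ t → ∀ f : Lp ℝ 1 μ, ‖P t f‖ ≤ ‖f‖ := by
    intro t ht f
    have e1 : P t f = P t f⁺ - P t f⁻ := by rw [← map_sub, posPart_sub_negPart]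
    rw [e1]
    refine (norm_sub_le _ _).trans ?_
    rw [(hpos t ht _ (posPart_nonneg f)).2, (hpos t ht _ (negPart_nonneg f)).2,
      ← hnorm _ (posPart_nonneg f), ← hnorm _ (negPart_nonneg f), ← map_add, posPart_add_negPart,
      hnorm _ (abs_nonneg f), norm_abs_eq_norm]
  have hex : ∀ t : ℝ, ∃ T : Lp ℝ 1 μ →L[ℝ] Lp ℝ 1 μ, 0 ≤ t → ∀ f, T f = P t f := by
    intro t
    by_cases ht : 0 ≤ t
    · exact ⟨(P t).mkContinuous 1 (fun f => by rw [one_mul]; exact hcontr t ht f), fun _ f => rfl⟩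
    · exact ⟨0, fun h => absurd h ht⟩
  choose S hS using hex
  -- one ball
  have hball : ∀ x₀ : X, ∃ ε : ℝ, 0 < ε ∧ ∀ f : Lp ℝ 1 μ, 0 ≤ f →
      Tendsto (fun t : ℝ => J (Metric.ball x₀ ε) (P t f)) atTop (nhds 0) := by
    intro x₀
    obtain ⟨ε, hε, t₀, ht₀, χ, hχm, hχ0, hχp, hχ⟩ := hK x₀
    refine ⟨ε, hε, ?_⟩
    set B := Metric.ball x₀ ε with hB
    have hBm : MeasurableSet B := Metric.isOpen_ball.measurableSet
    have hχi : Integrable χ μ := by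
      by_contra hni
      rw [integral_undef hni] at hχp
      exact lt_irrefl _ hχp
    set c : Lp ℝ 1 μ := hχi.toL1 χ with hc
    have hcae : c =ᵐ[μ] χ := hχi.coeFn_toL1
    have hc0 : 0 ≤ c := by
      rw [← Lp.coeFn_nonneg]
      filter_upwards [hcae] with x hx
      rw [hx]; exact hχ0 x
    have hJc : ∀ A, J A c = ∫ x in A, χ x ∂μ := fun A => by
      rw [hJ]; exact integral_congr_ae (ae_restrict_of_ae hcae)
    have hmin : ∀ f, 0 ≤ f → J B f • c ≤ S t₀ f := by
      intro f hf
      rw [hS t₀ ht₀.le, ← Lp.coeFn_le]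
      refine ae_le_of_forall_setIntegral_le (L1.integrable_coeFn _) (L1.integrable_coeFn _)
        fun A hA _ => ?_
      rw [← hJ, ← hJ, map_smul, smul_eq_mul, htrans t₀ ht₀.le f hf A hA, hJc, hJ, mul_comm,
        ← integral_const_mul]
      have hfi := L1.integrable_coeFn f
      have hint : Integrable (fun x => (κ t₀ x A).toReal * f x) μ := by
        refine hfi.bdd_mul (c := 1) ?_ ?_
        · exact ((Measure.measurable_coe hA).comp (hκmeas t₀ ht₀.le)).ennreal_toReal.aestronglyMeasurable
        · refine Eventually.of_forall fun x => ?_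
          have := hκprob t₀ ht₀.le x
          rw [Real.norm_eq_abs, abs_of_nonneg ENNReal.toReal_nonneg]
          exact measureReal_le_one
      have hf' := (Lp.coeFn_nonneg f).2 hf
      calc ∫ x in B, (∫ y in A, χ y ∂μ) * f x ∂μ ≤ ∫ x in B, (κ t₀ x A).toReal * f x ∂μ := by
            refine setIntegral_mono_on_ae (hfi.const_mul _).integrableOn hint.integrableOn hBm ?_
            filter_upwards [hf'] with x hx hxB
            exact mul_le_mul_of_nonneg_right (hχ x hxB A hA) hx
        _ ≤ _ := by
            refine setIntegral_le_integral hint ?_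
            filter_upwards [hf'] with x hx
            exact mul_nonneg ENNReal.toReal_nonneg hx
    have hdisc := op_sweep (J Set.univ) (J B) (S t₀) c hc0
      (by rw [hJc, setIntegral_univ]; exact hχp) (fun f hf => (hnorm f hf).symm)
      (fun f hf => by rw [hS t₀ ht₀.le]; exact (hpos t₀ ht₀.le f hf).1)
      (fun f hf => by
        rw [hS t₀ ht₀.le, hnorm _ (hpos t₀ ht₀.le f hf).1, (hpos t₀ ht₀.le f hf).2, hnorm f hf])
      (fun f hf => hJpos B f hf) (fun f hf => hJmono _ _ f (Set.subset_univ _) hf) hmin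
      (fun h h0 hT => by
        by_contra hne
        have hh : h ≠ 0 := by rintro rfl; exact hne (map_zero _)
        apply hnoinv
        obtain ⟨g, hg1, hg2, hg3⟩ := semigroup_invariant μ S
          (fun s t hs ht f => by
            rw [hS _ (add_nonneg hs ht), hS _ hs, hS _ ht, hPsem s t hs ht])
          (fun f => (hPcont f).congr fun t ht => hS t ht f)
          (fun t ht f hf => by rw [hS t ht]; exact hpos t ht f hf) t₀ ht₀ h h0 hh hT
        exact ⟨g, hg1, hg2, fun t ht => by rw [← hS t ht]; exact hg3 t ht⟩)
    have hiter : ∀ (n : ℕ) (f : Lp ℝ 1 μ), (S t₀)^[n] f = P (n * t₀) f := by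
      intro n
      induction n with
      | zero => intro f; simp [hP0]
      | succ n ih =>
        intro f
        rw [Function.iterate_succ_apply', ih, hS t₀ ht₀.le,
          ← hPsem t₀ _ ht₀.le (mul_nonneg (Nat.cast_nonneg _) ht₀.le)]
        congr 2
        push_cast; ring
    intro f hf
    -- uniform continuity in time
    rw [Metric.tendsto_atTop]
    intro η hη
    have hcont0 : ∃ δ > 0, ∀ s, 0 ≤ s → s < δ → ‖P s f - f‖ < η / 2 := by
      have := (hPcont f) 0 (Set.mem_Ici.2 le_rfl)
      rw [Metric.continuousWithinAt_iff] at this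
      obtain ⟨δ, hδ, h⟩ := this (η / 2) (half_pos hη)
      refine ⟨δ, hδ, fun s hs hsd => ?_⟩
      have := h (Set.mem_Ici.2 hs) (by rw [Real.dist_eq, sub_zero, abs_of_nonneg hs]; exact hsd)
      rwa [hP0, dist_eq_norm] at this
    obtain ⟨δ, hδ, hδf⟩ := hcont0
    obtain ⟨N, hN⟩ := exists_nat_gt (t₀ / δ)
    have hNp : (0:ℝ) < N := lt_of_le_of_lt (div_nonneg ht₀.le hδ.le) hN
    have hN0 : 0 < N := by exact_mod_cast hNp
    set d := t₀ / N with hd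
    have hdp : 0 < d := div_pos ht₀ hNp
    have hdδ : d < δ := by
      rw [hd, div_lt_iff₀ hNp]; rw [div_lt_iff₀ hδ] at hN; linarith
    have hev : ∀ᶠ n : ℕ in atTop, ∀ i ∈ Finset.range N,
        J B (P (n * t₀) (P (i * d) f)) < η / 2 := by
      rw [Filter.eventually_all_finset]
      intro i _
      have h1 := hdisc (P (i * d) f) (hpos _ (mul_nonneg (Nat.cast_nonneg _) hdp.le) f hf).1
      simp only [hiter] at h1
      exact h1.eventually_lt_const (half_pos hη)
    obtain ⟨n₀, hn₀⟩ := eventually_atTop.1 hev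
    refine ⟨n₀ * t₀, fun t ht => ?_⟩
    have ht0 : 0 ≤ t := le_trans (mul_nonneg (Nat.cast_nonneg _) ht₀.le) ht
    rw [Real.dist_eq, sub_zero, abs_of_nonneg (hJpos _ _ (hpos t ht0 f hf).1)]
    set m := ⌊t / d⌋₊ with hm
    have hm1 : m * d ≤ t := by
      have := Nat.floor_le (div_nonneg ht0 hdp.le)
      rwa [le_div_iff₀ hdp] at this
    have hm2 : t < (m + 1) * d := by
      have := Nat.lt_floor_add_one (t / d)
      rwa [div_lt_iff₀ hdp] at this
    have hNd : N * d = t₀ := by rw [hd]; field_simp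
    have hmn : n₀ ≤ m / N := by
      rw [Nat.le_div_iff_mul_le hN0, hm]
      refine Nat.le_floor ?_
      rw [le_div_iff₀ hdp]; push_cast
      rw [mul_assoc, hNd]; exact ht
    have hmd : (m:ℝ) * d = ((m / N : ℕ) : ℝ) * t₀ + ((m % N : ℕ) : ℝ) * d := by
      have : (m : ℝ) = N * ((m / N : ℕ) : ℝ) + ((m % N : ℕ) : ℝ) := by
        exact_mod_cast (Nat.div_add_mod m N).symm
      conv_lhs => rw [this]
      rw [← hNd]; ring
    have hmd0 : 0 ≤ (m:ℝ) * d := mul_nonneg (Nat.cast_nonneg _) hdp.le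
    have hA : J B (P (m * d) f) < η / 2 := by
      rw [hmd, hPsem _ _ (mul_nonneg (Nat.cast_nonneg _) ht₀.le)
        (mul_nonneg (Nat.cast_nonneg _) hdp.le)]
      exact hn₀ _ hmn _ (Finset.mem_range.2 (Nat.mod_lt _ hN0))
    have hB2 : ‖P t f - P (m * d) f‖ < η / 2 := by
      have e : P t f = P (m * d) (P (t - m * d) f) := by
        rw [← hPsem _ _ hmd0 (by linarith)]; congr 2; ring
      rw [e, ← map_sub]
      exact (hcontr _ hmd0 _).trans_lt (hδf _ (by linarith) (by linarith))
    have hJle : ∀ g : Lp ℝ 1 μ, J B g ≤ ‖g‖ := by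
      intro g
      calc J B g ≤ J B |g| := by
            rw [← sub_nonneg, ← map_sub]; exact hJpos _ _ (sub_nonneg.2 (le_abs_self g))
        _ ≤ J Set.univ |g| := hJmono _ _ _ (Set.subset_univ _) (abs_nonneg g)
        _ = ‖g‖ := by rw [hnorm _ (abs_nonneg g), norm_abs_eq_norm]
    have h7 := hJle (P t f - P (m * d) f)
    rw [map_sub] at h7
    linarith
  choose ε hε hballs using hball
  intro C hC f hf hf1
  have hf0 : 0 ≤ f := (Lp.coeFn_nonneg f).1 hf
  obtain ⟨s, -, hs⟩ := hC.elim_nhds_subcover (fun x => Metric.ball x (ε x))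
    (fun x _ => Metric.ball_mem_nhds x (hε x))
  have hlim : Tendsto (fun t : ℝ => ∑ x ∈ s, J (Metric.ball x (ε x)) (P t f)) atTop (nhds 0) := by
    have := tendsto_finsetSum s fun x _ => hballs x f hf0
    simpa using this
  have hsub : ∀ (s : Finset X) (g : Lp ℝ 1 μ), 0 ≤ g →
      J (⋃ x ∈ s, Metric.ball x (ε x)) g ≤ ∑ x ∈ s, J (Metric.ball x (ε x)) g := by
    classical
    intro s g hg
    induction s using Finset.induction_on with
    | empty => simp [hJ]
    | insert a s ha ih =>
      rw [Finset.sum_insert ha, Finset.set_biUnion_insert]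
      refine le_trans ?_ (add_le_add_right ih _)
      have hBm : MeasurableSet (Metric.ball a (ε a)) := Metric.isOpen_ball.measurableSet
      have hi := L1.integrable_coeFn g
      have : J (Metric.ball a (ε a) ∪ ⋃ x ∈ s, Metric.ball x (ε x)) g
          = J (Metric.ball a (ε a)) g
            + J ((⋃ x ∈ s, Metric.ball x (ε x)) \ Metric.ball a (ε a)) g := by
        rw [hJ, hJ, hJ, ← Set.union_diff_self]
        refine setIntegral_union Set.disjoint_sdiff_right ?_ hi.integrableOn hi.integrableOn
        exact ((isOpen_biUnion fun x _ => Metric.isOpen_ball).measurableSet).diff hBm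
      rw [this]
      exact add_le_add_right (hJmono _ _ g Set.diff_subset hg) _
  refine squeeze_zero' ?_ ?_ hlim
  · filter_upwards [eventually_ge_atTop 0] with t ht
    rw [← hJ]; exact hJpos _ _ (hpos t ht f hf0).1
  · filter_upwards [eventually_ge_atTop 0] with t ht
    rw [← hJ]
    exact (hJmono _ _ _ hs (hpos t ht f hf0).1).trans (hsub s _ (hpos t ht f hf0).1)
end

section
/- Let F : [0,∞) → ℝ be a C¹ function with F(0) = 0 and F(x) < 0 for x > 0, and let π denote the flow of x' = F(x). Fix a > 0. Then the map x ↦ π_a x is injective on (0,∞), and for every nonnegative f ∈ L¹(0,∞) and every Borel set A contained in the image π_a((0,∞)): ∫_{{x>0 : π_a x ∈ A}} f(x) dx = ∫_A f(ψ(y)) · (F(ψ(y))/F(y)) dy, where ψ is the inverse of x ↦ π_a x on its image (that is, the Frobenius–Perron operator of π_a is P_{π_a} f(y) = f(ψ(y)) F(ψ(y))/F(y) for y in the image, and 0 otherwise). -/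
open MeasureTheory

/-- For the flow `π` of `x' = F(x)` with `F(0) = 0`, `F < 0` on `(0,∞)`,
and `a > 0`, the map `x ↦ π_a x` is injective on `(0,∞)` and its Frobenius–Perron
operator is given by `P_{π_a} f(y) = f(ψ(y)) F(ψ(y))/F(y)` on the image, where `ψ` is
the inverse of `x ↦ π_a x`. -/
theorem stmt_6 (F : ℝ → ℝ) (hF : ContDiffOn ℝ 1 F (Set.Ici 0)) (hF0 : F 0 = 0)
    (hFneg : ∀ x : ℝ, 0 < x → F x < 0)
    (π : ℝ → ℝ → ℝ)
    (hπ0 : ∀ x : ℝ, 0 ≤ x → π 0 x = x)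
    (hπode : ∀ x : ℝ, 0 ≤ x → ∀ t : ℝ, 0 ≤ t →
      HasDerivWithinAt (fun s => π s x) (F (π t x)) (Set.Ici 0) t)
    (hπpos : ∀ t : ℝ, 0 ≤ t → ∀ x : ℝ, 0 < x → 0 < π t x)
    (a : ℝ) (ha : 0 < a) :
    Set.InjOn (fun x => π a x) (Set.Ioi 0) ∧
    ∀ ψ : ℝ → ℝ, (∀ x ∈ Set.Ioi (0 : ℝ), ψ (π a x) = x) →
      ∀ f : ℝ → ℝ, (∀ x, 0 ≤ f x) → IntegrableOn f (Set.Ioi 0) →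
        ∀ A : Set ℝ, MeasurableSet A → A ⊆ (fun x => π a x) '' Set.Ioi 0 →
          ∫ x in {x : ℝ | 0 < x ∧ π a x ∈ A}, f x
            = ∫ y in A, f (ψ y) * (F (ψ y) / F y) := by
  have hcF : ContinuousOn F (Set.Ioi 0) := hF.continuousOn.mono Set.Ioi_subset_Ici_self
  have hcI : ContinuousOn (fun x => (F x)⁻¹) (Set.Ioi 0) :=
    hcF.inv₀ (fun x hx => (hFneg x hx).ne)
  obtain ⟨G, hG⟩ : ∃ G : ℝ → ℝ, ∀ x, 0 < x → HasStrictDerivAt G (F x)⁻¹ x := by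
    refine ⟨fun x => ∫ t in (1:ℝ)..x, (F t)⁻¹, fun x hx => ?_⟩
    refine intervalIntegral.integral_hasStrictDerivAt_right ?_ ?_ ?_
    · apply ContinuousOn.intervalIntegrable
      refine hcI.mono ?_
      intro y hy
      exact lt_of_lt_of_le (lt_min one_pos hx) hy.1
    · exact hcI.stronglyMeasurableAtFilter isOpen_Ioi x hx
    · exact hcI.continuousAt (Ioi_mem_nhds hx)
  have hanti : StrictAntiOn G (Set.Ioi 0) := by
    apply strictAntiOn_of_deriv_neg (convex_Ioi 0)
    · intro x hx
      exact (hG x hx).hasDerivAt.continuousAt.continuousWithinAt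
    · intro x hx
      rw [interior_Ioi] at hx
      rw [(hG x hx).hasDerivAt.deriv]
      exact inv_lt_zero.2 (hFneg x hx)
  have hGT : ∀ x, 0 < x → G (π a x) = G x + a := by
    intro x hx
    have hd : ∀ t, 0 ≤ t → HasDerivWithinAt (fun s => G (π s x) - s) 0 (Set.Ici 0) t := by
      intro t ht
      have hp := hπpos t ht x hx
      have h1 := (hG _ hp).hasDerivAt.comp_hasDerivWithinAt t (hπode x hx.le t ht)
      have h2 := h1.sub (hasDerivWithinAt_id t (Set.Ici 0))
      rw [inv_mul_cancel₀ (hFneg _ hp).ne, sub_self] at h2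
      exact h2
    have := constant_of_has_deriv_right_zero (f := fun s => G (π s x) - s) (a := 0) (b := a)
      (fun t ht => (hd t ht.1).continuousWithinAt.mono Set.Icc_subset_Ici_self)
      (fun t ht => (hd t ht.1).mono (Set.Ici_subset_Ici.2 ht.1)) a ⟨ha.le, le_rfl⟩
    simp only [hπ0 x hx.le] at this
    linarith
  have hinj : Set.InjOn (fun x => π a x) (Set.Ioi 0) := by
    intro x hx y hy hxy
    apply hanti.injOn hx hy
    have h1 := hGT x hx
    have h2 := hGT y hy
    simp only at hxy
    rw [hxy] at h1
    linarith
  have hT : ∀ x, 0 < x → HasDerivAt (fun x => π a x) (F (π a x) / F x) x := by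
    intro x hx
    have hp := hπpos a ha.le x hx
    have hne : (F (π a x))⁻¹ ≠ 0 := inv_ne_zero (hFneg _ hp).ne
    have hs := hG _ hp
    set g := hs.localInverse G _ _ hne with hg
    have hgd : HasStrictDerivAt g ((F (π a x))⁻¹)⁻¹ (G (π a x)) := hs.to_localInverse hne
    have hg0 : g (G (π a x)) = π a x :=
      (hs.hasStrictFDerivAt_equiv hne).localInverse_apply_image
    have hr : ∀ᶠ z in nhds (G (π a x)), G (g z) = z :=
      (hs.hasStrictFDerivAt_equiv hne).eventually_right_inverse
    have hpos : ∀ᶠ z in nhds (G (π a x)), 0 < g z := by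
      apply hgd.hasDerivAt.continuousAt.eventually
      rw [hg0]
      exact Ioi_mem_nhds hp
    have hh : HasDerivAt (fun z => G z + a) (F x)⁻¹ x := (hG x hx).hasDerivAt.add_const a
    have hc : HasDerivAt (fun z => g (G z + a)) (((F (π a x))⁻¹)⁻¹ * (F x)⁻¹) x := by
      refine HasDerivAt.comp x (h₂ := g) (h := fun z => G z + a) ?_ hh
      rw [← hGT x hx]
      exact hgd.hasDerivAt
    rw [inv_inv, ← div_eq_mul_inv] at hc
    refine hc.congr_of_eventuallyEq ?_
    have ht : Filter.Tendsto (fun z => G z + a) (nhds x) (nhds (G (π a x))) := by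
      rw [hGT x hx]
      exact hh.continuousAt
    filter_upwards [ht.eventually hr, ht.eventually hpos, Ioi_mem_nhds hx] with z h1 h2 h3
    apply hanti.injOn (hπpos a ha.le z h3) h2
    rw [h1, hGT z h3]
  refine ⟨hinj, ?_⟩
  intro ψ hψ f _ _ A hA hAs
  set s := {x : ℝ | 0 < x ∧ π a x ∈ A} with hs
  have hsm : MeasurableSet s := by
    have hc : ContinuousOn (fun x => π a x) (Set.Ioi 0) :=
      fun x hx => (hT x hx).continuousAt.continuousWithinAt
    have hm : Measurable ((Set.Ioi (0:ℝ)).domRestrict (fun x => π a x)) :=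
      (continuousOn_iff_continuous_domRestrict.1 hc).measurable
    have h2 := (MeasurableEmbedding.subtype_coe
      (measurableSet_Ioi (a := (0:ℝ)))).measurableSet_image.2 (hm hA)
    convert h2 using 1
    ext x
    simp [hs, Set.domRestrict, and_comm]
  have himg : (fun x => π a x) '' s = A := by
    ext y
    constructor
    · rintro ⟨x, hx, rfl⟩
      exact hx.2
    · intro hy
      obtain ⟨x, hx, rfl⟩ := hAs hy
      exact ⟨x, ⟨hx, hy⟩, rfl⟩
  have key := integral_image_eq_integral_abs_deriv_smul hsm
    (fun x hx => (hT x hx.1).hasDerivWithinAt) (hinj.mono (fun x hx => hx.1))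
    (fun y => f (ψ y) * (F (ψ y) / F y))
  rw [himg] at key
  rw [key]
  refine setIntegral_congr_fun hsm ?_
  intro x hx
  have h1 := hFneg x hx.1
  have h2 := hFneg _ (hπpos a ha.le x hx.1)
  simp only [smul_eq_mul]
  rw [hψ x hx.1, abs_of_pos (div_pos_of_neg_of_neg h2 h1)]
  have := h1.ne
  have := h2.ne
  field_simp
end

section
/- Let F be a C¹ real function, let π denote the flow of x' = F(x), fix t ≥ 0 and x, and assume F(π(s,x)) ≠ 0 for all s ∈ [0,t]. Then the map z ↦ π(t,z) is differentiable at z = x with derivative ∂π(t,x)/∂x = F(π(t,x))/F(x). -/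
open Set Filter Topology in
lemma uniq_aux (F : ℝ → ℝ) (hF : ContDiff ℝ 1 F) (f g : ℝ → ℝ) (T : ℝ) (hT : 0 ≤ T)
    (hf : ∀ s ∈ Icc 0 T, HasDerivWithinAt f (F (f s)) (Ici 0) s)
    (hg : ∀ s ∈ Icc 0 T, HasDerivWithinAt g (F (g s)) (Ici 0) s)
    (h0 : f 0 = g 0) : f T = g T := by
  have cf : ContinuousOn f (Icc 0 T) := fun s hs =>
    ((hf s hs).mono Icc_subset_Ici_self).continuousWithinAt
  have cg : ContinuousOn g (Icc 0 T) := fun s hs =>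
    ((hg s hs).mono Icc_subset_Ici_self).continuousWithinAt
  have hc : IsCompact (f '' Icc 0 T ∪ g '' Icc 0 T) :=
    (isCompact_Icc.image_of_continuousOn cf).union (isCompact_Icc.image_of_continuousOn cg)
  obtain ⟨K, hK⟩ := LocallyLipschitzOn.exists_lipschitzOnWith_of_compact hc
    (hF.locallyLipschitz.locallyLipschitzOn)
  exact ODE_solution_unique_of_mem_Icc_right (v := fun _ => F)
    (s := fun _ => f '' Icc 0 T ∪ g '' Icc 0 T) (fun _ _ => hK) cf
    (fun s hs => (hf s (Ico_subset_Icc_self hs)).mono (Ici_subset_Ici.2 hs.1))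
    (fun s hs => Or.inl ⟨s, Ico_subset_Icc_self hs, rfl⟩) cg
    (fun s hs => (hg s (Ico_subset_Icc_self hs)).mono (Ici_subset_Ici.2 hs.1))
    (fun s hs => Or.inr ⟨s, Ico_subset_Icc_self hs, rfl⟩) h0 ⟨hT, le_rfl⟩

open Set Filter Topology in
lemma semi_aux (F : ℝ → ℝ) (hF : ContDiff ℝ 1 F)
    (π : ℝ → ℝ → ℝ)
    (hπ0 : ∀ x : ℝ, π 0 x = x)
    (hπode : ∀ x : ℝ, ∀ s : ℝ, 0 ≤ s →
      HasDerivWithinAt (fun u => π u x) (F (π s x)) (Set.Ici 0) s)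
    (a b x : ℝ) (ha : 0 ≤ a) (hb : 0 ≤ b) : π a (π b x) = π (a + b) x := by
  refine uniq_aux F hF (fun s => π s (π b x)) (fun s => π (s + b) x) a ha
    (fun s hs => hπode _ s hs.1) (fun s hs => ?_) (by simp [hπ0])
  have h1 := hπode x (s + b) (add_nonneg hs.1 hb)
  have h2 : HasDerivWithinAt (fun s : ℝ => s + b) 1 (Ici 0) s :=
    ((hasDerivAt_id s).add_const b).hasDerivWithinAt
  have := HasDerivWithinAt.comp s h1 h2 (fun u hu => add_nonneg hu hb)
  simpa [Function.comp_def] using this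

/-- If `π` is the flow of `x' = F(x)` with `F` of class `C¹`, `t ≥ 0`,
and `F(π(s,x)) ≠ 0` for all `s ∈ [0,t]`, then `z ↦ π(t,z)` is differentiable at `x`
with derivative `F(π(t,x))/F(x)`. -/
theorem stmt_7 (F : ℝ → ℝ) (hF : ContDiff ℝ 1 F)
    (π : ℝ → ℝ → ℝ)
    (hπ0 : ∀ x : ℝ, π 0 x = x)
    (hπode : ∀ x : ℝ, ∀ s : ℝ, 0 ≤ s →
      HasDerivWithinAt (fun u => π u x) (F (π s x)) (Set.Ici 0) s)
    (t : ℝ) (ht : 0 ≤ t) (x : ℝ)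
    (hFne : ∀ s ∈ Set.Icc (0 : ℝ) t, F (π s x) ≠ 0) :
    HasDerivAt (fun z => π t z) (F (π t x) / F x) x := by
  have hx : F x ≠ 0 := by simpa [hπ0] using hFne 0 ⟨le_rfl, ht⟩
  rcases ht.eq_or_lt with rfl | htp
  · simp only [hπ0, div_self hx]
    exact hasDerivAt_id x
  obtain ⟨α, hα0, ε, hε, hα⟩ :=
    (hF.contDiffAt (x := x)).exists_forall_mem_closedBall_exists_eq_forall_mem_Ioo_hasDerivAt₀ 0
  simp only [zero_sub, zero_add] at hα
  have hev : ∀ᶠ y in nhds (0:ℝ), HasDerivAt α (F (α y)) y := by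
    filter_upwards [Ioo_mem_nhds (neg_lt_zero.2 hε) hε] with y hy using hα y hy
  have hs : HasStrictDerivAt α (F (α 0)) 0 :=
    hasStrictDerivAt_of_hasDerivAt_of_continuousAt (f' := fun y => F (α y)) hev
      (hF.continuous.continuousAt.comp (hα 0 ⟨neg_lt_zero.2 hε, hε⟩).continuousAt)
  rw [hα0] at hs
  set h := hs.localInverse α (F x) 0 hx with hh
  have hr := hs.eventually_right_inverse hx
  have hl := (hs.eventually_left_inverse hx).self_of_nhds
  have hd := (hs.to_localInverse hx).hasDerivAt
  rw [← hh] at hr hl hd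
  rw [hα0] at hr hl hd
  have hmem : ∀ᶠ z in nhds x, h z ∈ Set.Ioo (-(min ε t)) (min ε t) := by
    apply hd.continuousAt
    rw [hl]
    exact Ioo_mem_nhds (neg_lt_zero.2 (lt_min hε htp)) (lt_min hε htp)
  have key : ∀ᶠ z in nhds x, π t z = π (t + h z) x := by
    filter_upwards [hr, hmem] with z hz hm
    have h1 : h z < ε := hm.2.trans_le (min_le_left _ _)
    have h2 : -ε < h z := (neg_le_neg (min_le_left _ _)).trans_lt hm.1
    have h3 : -t < h z := (neg_le_neg (min_le_right _ _)).trans_lt hm.1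
    generalize h z = c at *
    rcases le_total 0 c with hc | hc
    · have e : π c x = α c := by
        refine uniq_aux F hF (fun s => π s x) α c hc (fun s hs => hπode _ s hs.1)
          (fun s hs => (hα s ⟨by linarith [hs.1], by linarith [hs.2]⟩).hasDerivWithinAt) 
          (by simp [hπ0, hα0])
      rw [← semi_aux F hF π hπ0 hπode t c x ht hc, e, hz]
    · have e : π (-c) z = α (-c + c) := by
        refine uniq_aux F hF (fun s => π s z) (fun s => α (s + c)) (-c) (by linarith)
          (fun s hs => hπode _ s hs.1)
          (fun s hs => ?_) (by simp [hπ0, hz])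
        exact ((hα (s + c) ⟨by linarith [hs.1], by linarith [hs.2]⟩).comp_add_const s c).hasDerivWithinAt
      rw [neg_add_cancel, hα0] at e
      have := semi_aux F hF π hπ0 hπode (t + c) (-c) z (by linarith) (by linarith)
      rw [e] at this
      rw [this]
      congr 1
      ring
  have hg : HasDerivAt (fun u => π u x) (F (π t x)) (t + h x) := by
    rw [hl, add_zero]
    exact (hπode x t ht).hasDerivAt (Ici_mem_nhds htp)
  have := HasDerivAt.comp x hg (hd.const_add t)
  rw [div_eq_mul_inv]
  exact this.congr_of_eventuallyEq key
end

section
/- Let F : [0,∞) → ℝ be C¹ with F(0) = 0 and F(x) < 0 for x > 0, let π denote the flow of x' = F(x), let G : [0,∞) → (0,∞) be C¹, and let q : [0,∞) × [0,∞) → [0,∞) be continuous. Suppose x₀ > 0 and a₀ > 0 satisfy q(x₀,a₀) > 0 and G'(π_{a₀} x₀) ≠ 0. Then there exist ε > 0, c > 0 and a nondegenerate compact interval B ⊂ (0,∞) such that for every x > 0 with |x − x₀| < ε and every Borel set A ⊆ ℝ: ∫₀^∞ q(x,a) · 𝟙_A(G(π_a x)) da ≥ c · λ(A ∩ B), where λ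 is Lebesgue measure. (This is condition (K) for the jump operator T at the point x₀.) -/
open MeasureTheory

lemma meas_part (φ qx : ℝ → ℝ) (hφ : ContinuousOn φ (Set.Ici 0))
    (hqnn : ∀ a, 0 ≤ a → 0 ≤ qx a) (hqint : IntegrableOn qx (Set.Ioi 0))
    (M : NNReal) (hM : 0 < M) (hlip : LipschitzOnWith M φ (Set.Ici 0))
    (a b : ℝ) (ha : 0 < a) (hb : 0 < b) (m : ℝ) (hm : 0 < m)
    (hqm : ∀ t ∈ Set.uIcc a b, m ≤ qx t) (B : Set ℝ) (hB : B ⊆ Set.uIcc (φ a) (φ b))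
    (A : Set ℝ) (hA : MeasurableSet A) :
    m / M * (volume (A ∩ B)).toReal ≤
      ∫ t in Set.Ioi (0 : ℝ), qx t * Set.indicator A (fun _ => (1 : ℝ)) (φ t) := by
  have hIpos : Set.uIcc a b ⊆ Set.Ioi 0 := fun t ht =>
    lt_of_lt_of_le (lt_min ha hb) ht.1
  have hψ : Continuous (fun t => φ (max t 0)) :=
    hφ.comp_continuous (by fun_prop) (fun t => Set.mem_Ici.2 (le_max_right t 0))
  set S : Set ℝ := (fun t => φ (max t 0)) ⁻¹' A with hS
  have hSm : MeasurableSet S := hψ.measurable hA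
  set J := Set.uIcc a b ∩ S with hJ
  have hJm : MeasurableSet J := measurableSet_uIcc.inter hSm
  have hJfin : volume J ≠ ⊤ :=
    ((measure_mono Set.inter_subset_left).trans_lt isCompact_uIcc.measure_lt_top).ne
  have hJpos : J ⊆ Set.Ioi 0 := Set.inter_subset_left.trans hIpos
  have heq : ∫ t in Set.Ioi (0 : ℝ), qx t * Set.indicator A (fun _ => (1 : ℝ)) (φ t)
      = ∫ t in Set.Ioi (0 : ℝ), S.indicator qx t := by
    refine setIntegral_congr_fun measurableSet_Ioi fun t ht => ?_
    have h0 : max t 0 = t := max_eq_left (le_of_lt ht)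
    by_cases h : φ t ∈ A
    · have : t ∈ S := by simp [hS, h0, h]
      simp [this, h]
    · have : t ∉ S := by simp [hS, h0, h]
      simp [this, h]
  have hint : IntegrableOn (S.indicator qx) (Set.Ioi 0) := hqint.indicator hSm
  have h1 : ∫ t in J, S.indicator qx t ≤ ∫ t in Set.Ioi (0 : ℝ), S.indicator qx t := by
    refine setIntegral_mono_set hint ?_ hJpos.eventuallyLE
    filter_upwards [ae_restrict_mem measurableSet_Ioi] with t ht
    exact Set.indicator_apply_nonneg (fun _ => hqnn t (le_of_lt ht))
  have h2 : m * (volume J).toReal ≤ ∫ t in J, S.indicator qx t := by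
    have : ∫ t in J, m ≤ ∫ t in J, S.indicator qx t := by
      refine setIntegral_mono_on (integrableOn_const hJfin) (hint.mono_set hJpos) hJm ?_
      intro t ht
      rw [Set.indicator_of_mem ht.2]
      exact hqm t ht.1
    simpa [Measure.real, mul_comm] using this
  have himg : A ∩ B ⊆ φ '' J := by
    rintro y ⟨hyA, hyB⟩
    obtain ⟨t, ht, rfl⟩ := intermediate_value_uIcc
      (hφ.mono (fun t ht => Set.Ioi_subset_Ici_self (hIpos ht))) (hB hyB)
    refine ⟨t, ⟨ht, ?_⟩, rfl⟩
    simp only [hS, Set.mem_preimage]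
    rwa [max_eq_left (le_of_lt (hIpos ht))]
  have h3 : volume (A ∩ B) ≤ (M : ENNReal) * volume J := by
    have := (hlip.mono (fun t ht => Set.Ioi_subset_Ici_self (hJpos ht) : J ⊆ Set.Ici 0)).hausdorffMeasure_image_le
      (d := 1) zero_le_one
    rw [hausdorffMeasure_real, ENNReal.rpow_one] at this
    exact (measure_mono himg).trans this
  have h4 : (volume (A ∩ B)).toReal ≤ M * (volume J).toReal := by
    have := ENNReal.toReal_mono (ENNReal.mul_ne_top ENNReal.coe_ne_top hJfin) h3
    simpa using this
  rw [heq]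
  refine le_trans ?_ (h2.trans h1)
  have hM' : (0:ℝ) < M := by exact_mod_cast hM
  calc m / M * (volume (A ∩ B)).toReal ≤ m / M * (M * (volume J).toReal) := by gcongr
    _ = _ := by field_simp

/-- Condition (K) for the jump operator `T` at a point `x₀`: if
`q(x₀,a₀) > 0` and `G'(π_{a₀} x₀) ≠ 0`, then there are `ε > 0`, `c > 0` and a
nondegenerate compact interval `B = [u,v] ⊂ (0,∞)` such that for all `x` with
`|x - x₀| < ε` and all Borel `A`,
`∫₀^∞ q(x,a) 𝟙_A(G(π_a x)) da ≥ c · λ(A ∩ B)`. -/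
theorem stmt_8 (F : ℝ → ℝ) (hF : ContDiffOn ℝ 1 F (Set.Ici 0)) (hF0 : F 0 = 0)
    (hFneg : ∀ x : ℝ, 0 < x → F x < 0)
    (π : ℝ → ℝ → ℝ)
    (hπ0 : ∀ x : ℝ, 0 ≤ x → π 0 x = x)
    (hπode : ∀ x : ℝ, 0 ≤ x → ∀ t : ℝ, 0 ≤ t →
      HasDerivWithinAt (fun s => π s x) (F (π t x)) (Set.Ici 0) t)
    (hπpos : ∀ t : ℝ, 0 ≤ t → ∀ x : ℝ, 0 < x → 0 < π t x)
    (G : ℝ → ℝ) (hG : ContDiffOn ℝ 1 G (Set.Ici 0))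
    (hGpos : ∀ x : ℝ, 0 ≤ x → 0 < G x)
    (q : ℝ → ℝ → ℝ)
    (hqc : ContinuousOn (Function.uncurry q) (Set.Ici 0 ×ˢ Set.Ici 0))
    (hqnn : ∀ x a : ℝ, 0 ≤ x → 0 ≤ a → 0 ≤ q x a)
    (hqint : ∀ x : ℝ, 0 ≤ x → IntegrableOn (q x) (Set.Ioi 0))
    (x₀ a₀ : ℝ) (hx₀ : 0 < x₀) (ha₀ : 0 < a₀)
    (hq₀ : 0 < q x₀ a₀) (hG' : deriv G (π a₀ x₀) ≠ 0) :
    ∃ ε : ℝ, 0 < ε ∧ ∃ c : ℝ, 0 < c ∧ ∃ u v : ℝ, 0 < u ∧ u < v ∧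
      ∀ x : ℝ, 0 < x → |x - x₀| < ε → ∀ A : Set ℝ, MeasurableSet A →
        c * (volume (A ∩ Set.Icc u v)).toReal ≤
          ∫ a in Set.Ioi (0 : ℝ), q x a * Set.indicator A (fun _ => (1 : ℝ)) (G (π a x)) := by
  have hcont : ∀ x : ℝ, 0 < x → ContinuousOn (fun s => π s x) (Set.Ici 0) := fun x hx t ht =>
    (hπode x hx.le t ht).continuousWithinAt
  have hle : ∀ x : ℝ, 0 < x → ∀ t, 0 ≤ t → π t x ≤ x := by
    intro x hx t ht
    have := antitoneOn_of_hasDerivWithinAt_nonpos (convex_Ici (0:ℝ)) (hcont x hx)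
      (f' := fun t => F (π t x))
      (fun t ht => (hπode x hx.le t (interior_subset ht)).mono interior_subset)
      (fun t ht => (hFneg _ (hπpos t (interior_subset ht) x hx)).le)
    have h := this (Set.self_mem_Ici) ht ht
    simpa [hπ0 x hx.le] using h
  have hsub : Set.Icc 0 (2 * x₀) ⊆ Set.Ici (0:ℝ) := fun y hy => hy.1
  obtain ⟨K, hK⟩ := (hF.mono hsub).exists_lipschitzOnWith one_ne_zero (convex_Icc _ _) isCompact_Icc
  obtain ⟨L, hL⟩ := (hG.mono hsub).exists_lipschitzOnWith one_ne_zero (convex_Icc _ _) isCompact_Icc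
  obtain ⟨C, hC⟩ := isCompact_Icc.exists_bound_of_continuousOn (hF.mono hsub).continuousOn
  have hmem : ∀ x, 0 < x → x < 2 * x₀ → ∀ t, 0 ≤ t → π t x ∈ Set.Icc 0 (2 * x₀) :=
    fun x hx hx2 t ht => ⟨(hπpos t ht x hx).le, (hle x hx t ht).trans hx2.le⟩
  have hC' : ∀ y ∈ Set.Icc 0 (2 * x₀), ‖F y‖₊ ≤ C.toNNReal := fun y hy => by
    have := (hC y hy).trans (Real.le_coe_toNNReal C)
    exact_mod_cast this
  have hφlip : ∀ x, 0 < x → x < 2 * x₀ →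
      LipschitzOnWith (L * C.toNNReal + 1) (fun t => G (π t x)) (Set.Ici 0) := by
    intro x hx hx2
    have h1 : LipschitzOnWith C.toNNReal (fun t => π t x) (Set.Ici 0) :=
      (convex_Ici (0:ℝ)).lipschitzOnWith_of_nnnorm_hasDerivWithin_le
        (fun t ht => hπode x hx.le t ht) (fun t ht => hC' _ (hmem x hx hx2 t ht))
    exact (hL.comp h1 (fun t ht => hmem x hx hx2 t ht)).weaken (by simp)
  have hgron : ∀ x, 0 < x → x < 2 * x₀ → ∀ t, 0 ≤ t →
      |G (π t x) - G (π t x₀)| ≤ L * (|x - x₀| * Real.exp (K * t)) := by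
    intro x hx hx2 t ht
    have hx02 : x₀ < 2 * x₀ := by linarith
    have h := dist_le_of_trajectories_ODE_of_mem (v := fun _ => F) (s := fun _ => Set.Icc 0 (2 * x₀))
      (f := fun t => π t x) (g := fun t => π t x₀) (a := 0) (b := t) (K := K) (δ := |x - x₀|)
      (fun _ _ => hK) ((hcont x hx).mono (fun s hs => hs.1))
      (fun s hs => (hπode x hx.le s hs.1).mono (Set.Ici_subset_Ici.2 hs.1))
      (fun s hs => hmem x hx hx2 s hs.1)
      ((hcont x₀ hx₀).mono (fun s hs => hs.1))
      (fun s hs => (hπode x₀ hx₀.le s hs.1).mono (Set.Ici_subset_Ici.2 hs.1))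
      (fun s hs => hmem x₀ hx₀ hx02 s hs.1)
      (by simp [hπ0 x hx.le, hπ0 x₀ hx₀.le, Real.dist_eq]) t ⟨ht, le_rfl⟩
    have h2 := hL.dist_le_mul _ (hmem x hx hx2 t ht) _ (hmem x₀ hx₀ hx02 t ht)
    rw [Real.dist_eq] at h2
    refine h2.trans ?_
    simp only [sub_zero] at h
    gcongr
  -- lower bound on q
  have hqat : ContinuousAt (Function.uncurry q) (x₀, a₀) :=
    hqc.continuousAt (prod_mem_nhds (Ici_mem_nhds hx₀) (Ici_mem_nhds ha₀))
  have hqev : ∀ᶠ p in nhds (x₀, a₀), q x₀ a₀ / 2 < Function.uncurry q p :=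
    hqat.eventually (lt_mem_nhds (show q x₀ a₀ / 2 < Function.uncurry q (x₀, a₀) by
      simp only [Function.uncurry_apply_pair]; linarith))
  obtain ⟨r, hr, hqr⟩ := Metric.eventually_nhds_iff.1 hqev
  -- choose b
  have hy0 := hπpos a₀ ha₀.le x₀ hx₀
  have hGd : HasDerivAt G (deriv G (π a₀ x₀)) (π a₀ x₀) :=
    (differentiableAt_of_deriv_ne_zero hG').hasDerivAt
  have hd : HasDerivAt (fun t => G (π t x₀)) (deriv G (π a₀ x₀) * F (π a₀ x₀)) a₀ :=
    hGd.comp a₀ ((hπode x₀ hx₀.le a₀ ha₀.le).hasDerivAt (Ici_mem_nhds ha₀))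
  have hne := hd.eventually_ne (c := G (π a₀ x₀)) (mul_ne_zero hG' (hFneg _ hy0).ne)
  have hball : ∀ᶠ z in nhdsWithin a₀ {a₀}ᶜ, z ∈ Metric.ball a₀ (min r a₀) :=
    nhdsWithin_le_nhds (Metric.ball_mem_nhds _ (lt_min hr ha₀))
  obtain ⟨b, hbne, hbball⟩ := (hne.and hball).exists
  rw [Metric.mem_ball, Real.dist_eq, lt_min_iff] at hbball
  have hb0 : 0 < b := by have := (abs_lt.1 hbball.2).1; linarith
  set p := G (π a₀ x₀) with hp
  set p' := G (π b x₀) with hp'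
  have hppos : 0 < p := hGpos _ hy0.le
  have hp'pos : 0 < p' := hGpos _ (hπpos b hb0.le x₀ hx₀).le
  set d := |p' - p| / 3 with hdd
  have hdpos : 0 < d := by
    have := abs_pos.2 (sub_ne_zero.2 hbne)
    positivity
  set E := (L : ℝ) * Real.exp (K * max a₀ b) + 1 with hE
  have hEpos : 0 < E := by positivity
  have hclose : ∀ x, 0 < x → x < 2 * x₀ → |x - x₀| < d / E → ∀ t, 0 ≤ t → t ≤ max a₀ b →
      |G (π t x) - G (π t x₀)| ≤ d := by
    intro x hx hx2 hxd t ht htm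
    refine (hgron x hx hx2 t ht).trans ?_
    rw [lt_div_iff₀ hEpos] at hxd
    refine le_trans ?_ hxd.le
    have : Real.exp (K * t) ≤ Real.exp (K * max a₀ b) := by gcongr
    calc L * (|x - x₀| * Real.exp (K * t)) ≤ L * (|x - x₀| * Real.exp (K * max a₀ b)) := by gcongr
      _ = |x - x₀| * (L * Real.exp (K * max a₀ b)) := by ring
      _ ≤ |x - x₀| * E := by gcongr; simp [hE]
  refine ⟨min (min x₀ r) (d / E), by positivity, q x₀ a₀ / 2 / ((L * C.toNNReal + 1 : NNReal) : ℝ),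
    by positivity, min p p' + d, max p p' - d, by positivity, ?_, ?_⟩
  · have := max_sub_min_eq_abs p p'
    linarith
  · intro x hx hxx A hA
    rw [lt_min_iff, lt_min_iff] at hxx
    obtain ⟨⟨hxx1, hxx2⟩, hxx3⟩ := hxx
    have hx2 : x < 2 * x₀ := by have := (abs_lt.1 hxx1).2; linarith
    refine meas_part (fun t => G (π t x)) (q x) (hφlip x hx hx2).continuousOn
      (fun a ha => hqnn x a hx.le ha) (hqint x hx.le) _ (by positivity) (hφlip x hx hx2)
      a₀ b ha₀ hb0 _ (by positivity) ?_ _ ?_ A hA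
    · intro t ht
      refine (hqr (y := (x, t)) ?_).le
      rw [Prod.dist_eq, max_lt_iff, Real.dist_eq, Real.dist_eq]
      refine ⟨hxx2, lt_of_le_of_lt ?_ hbball.1⟩
      exact Set.abs_sub_left_of_mem_uIcc ht
    · have e1 := abs_le.1 (hclose x hx hx2 hxx3 a₀ ha₀.le (le_max_left _ _))
      have e2 := abs_le.1 (hclose x hx hx2 hxx3 b hb0.le (le_max_right _ _))
      rw [← hp] at e1
      rw [← hp'] at e2
      intro y hy
      rw [Set.mem_uIcc]
      rcases le_total p p' with h | h
      · rw [min_eq_left h, max_eq_right h] at hy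
        left; constructor <;> linarith [hy.1, hy.2]
      · rw [min_eq_right h, max_eq_left h] at hy
        right; constructor <;> linarith [hy.1, hy.2]
end

section
/- Let F : [0,∞) → ℝ be C¹ with F(0) = 0 and F(x) < 0 for x > 0, let π denote the flow of x' = F(x), let G : [0,∞) → (0,∞) be C¹ such that the set {y > 0 : G'(y) = 0} has Lebesgue measure zero, and let q(x,·) be a continuous probability density on [0,∞) for each x. Then for every x > 0 the measure A ↦ ∫₀^∞ q(x,a) · 𝟙_A(G(π_a x)) da on the Borel sets of (0,∞) is absolutely continuous with respect to Lebesgue measure. -/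
open MeasureTheory

theorem null_of_strict (f : ℝ → ℝ) (S N : Set ℝ) (hN : volume N = 0)
    (h : ∀ x ∈ S, f x ∈ N ∧ ∃ c : ℝ, c ≠ 0 ∧ HasStrictDerivAt f c x) : volume S = 0 := by
  apply measure_null_of_locally_null
  intro x hx
  obtain ⟨hxN, c, hc, hd⟩ := h x hx
  have hd' := hd.hasStrictFDerivAt_equiv hc
  obtain ⟨K, V, hV, hL⟩ := hd'.to_localInverse.exists_lipschitzOnWith
  have h1 := hd'.eventually_left_inverse
  have h2 : ∀ᶠ y in nhds x, f y ∈ V := hd.hasDerivAt.continuousAt.eventually hV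
  refine ⟨S ∩ {y | f y ∈ V ∧ hd'.localInverse f _ x (f y) = y},
    Filter.inter_mem self_mem_nhdsWithin (mem_nhdsWithin_of_mem_nhds (h2.and h1)), ?_⟩
  have h3 : volume (hd'.localInverse f _ x '' (N ∩ V)) = 0 := by
    have h4 := (hL.mono (Set.inter_subset_right (s := N))).hausdorffMeasure_image_le
      (d := 1) zero_le_one
    rw [hausdorffMeasure_real] at h4
    rw [measure_mono_null Set.inter_subset_left hN, mul_zero] at h4
    exact le_antisymm h4 bot_le
  refine measure_mono_null ?_ h3
  rintro y ⟨hyS, hyV, hy⟩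
  exact ⟨f y, ⟨(h y hyS).1, hyV⟩, hy⟩

/-- Under assumptions (A1)–(A3), i.e. `F(0) = 0`, `F < 0` on `(0,∞)`,
`G` of class `C¹` with `{y > 0 : G'(y) = 0}` of Lebesgue measure zero, and `q(x,·)`
a continuous probability density, the measure `A ↦ ∫₀^∞ q(x,a) 𝟙_A(G(π_a x)) da`
on the Borel sets of `(0,∞)` is absolutely continuous with respect to Lebesgue
measure, for every `x > 0`. -/
theorem stmt_9 (F : ℝ → ℝ) (hF : ContDiffOn ℝ 1 F (Set.Ici 0)) (hF0 : F 0 = 0)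
    (hFneg : ∀ x : ℝ, 0 < x → F x < 0)
    (π : ℝ → ℝ → ℝ)
    (hπ0 : ∀ x : ℝ, 0 ≤ x → π 0 x = x)
    (hπode : ∀ x : ℝ, 0 ≤ x → ∀ t : ℝ, 0 ≤ t →
      HasDerivWithinAt (fun s => π s x) (F (π t x)) (Set.Ici 0) t)
    (hπpos : ∀ t : ℝ, 0 ≤ t → ∀ x : ℝ, 0 < x → 0 < π t x)
    (G : ℝ → ℝ) (hG : ContDiffOn ℝ 1 G (Set.Ici 0))
    (hGpos : ∀ x : ℝ, 0 ≤ x → 0 < G x)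
    (hG'null : volume {y : ℝ | 0 < y ∧ deriv G y = 0} = 0)
    (q : ℝ → ℝ → ℝ)
    (hqc : ∀ x : ℝ, 0 ≤ x → ContinuousOn (q x) (Set.Ici 0))
    (hqnn : ∀ x a : ℝ, 0 ≤ x → 0 ≤ a → 0 ≤ q x a)
    (hqint : ∀ x : ℝ, 0 ≤ x → IntegrableOn (q x) (Set.Ioi 0))
    (hqdens : ∀ x : ℝ, 0 ≤ x → ∫ a in Set.Ioi (0 : ℝ), q x a = 1) :
    ∀ x : ℝ, 0 < x → ∀ A : Set ℝ, MeasurableSet A → A ⊆ Set.Ioi 0 → volume A = 0 →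
      ∫ a in Set.Ioi (0 : ℝ), q x a * Set.indicator A (fun _ => (1 : ℝ)) (G (π a x)) = 0 := by
  intro x hx A hA hA0 hAn
  have hGs : ∀ y : ℝ, 0 < y → HasStrictDerivAt G (deriv G y) y := fun y hy =>
    (hG.contDiffAt (Ici_mem_nhds hy)).hasStrictDerivAt one_ne_zero
  have hB : volume {y : ℝ | 0 < y ∧ G y ∈ A} = 0 := by
    have h1 : volume {y : ℝ | 0 < y ∧ G y ∈ A ∧ deriv G y ≠ 0} = 0 :=
      null_of_strict G _ A hAn fun y hy => ⟨hy.2.1, _, hy.2.2, hGs y hy.1⟩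
    refine measure_mono_null ?_ (measure_union_null hG'null h1)
    rintro y ⟨hy, hyA⟩
    by_cases h : deriv G y = 0
    · exact Or.inl ⟨hy, h⟩
    · exact Or.inr ⟨hy, hyA, h⟩
  have hder : ∀ t : ℝ, 0 < t → HasDerivAt (fun s => π s x) (F (π t x)) t := fun t ht =>
    (hπode x hx.le t ht.le).hasDerivAt (Ici_mem_nhds ht)
  have hT : volume {t : ℝ | 0 < t ∧ G (π t x) ∈ A} = 0 := by
    refine null_of_strict (fun s => π s x) _ _ hB fun t ht => ?_
    have hp := hπpos t ht.1.le x hx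
    refine ⟨⟨hp, ht.2⟩, F (π t x), (hFneg _ hp).ne, ?_⟩
    refine hasStrictDerivAt_of_hasDerivAt_of_continuousAt (f' := fun s => F (π s x)) ?_ ?_
    · filter_upwards [Ioi_mem_nhds ht.1] with s hs using hder s hs
    · have hFc : ContinuousAt F (π t x) := hF.continuousOn.continuousAt (Ici_mem_nhds hp)
      exact ContinuousAt.comp (f := fun s => π s x) hFc (hder t ht.1).continuousAt
  refine integral_eq_zero_of_ae ?_
  have hae : ∀ᵐ t : ℝ, ¬ (0 < t ∧ G (π t x) ∈ A) := by
    rw [ae_iff]; simpa using hT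
  filter_upwards [ae_restrict_of_ae hae, ae_restrict_mem measurableSet_Ioi] with t ht ht0
  have : G (π t x) ∉ A := fun h => ht ⟨ht0, h⟩
  simp [this]
end

section
/- Let F : [0,∞) → ℝ be C¹ with F(0) = 0 and F(x) < 0 for x > 0, let π denote the flow of x' = F(x), let G : [0,∞) → (0,∞) satisfy G(x) ≤ x + L for some L > 0, and let q(x,·) be a probability density on [0,∞) with ∫₀^ε q(x,a) da ≤ 1 − ε for all x, for some fixed ε > 0. Assume moreover that π_ε x − x → −∞ as x → ∞. Then there exists R > 0 such that for all x > 0: ∫₀^∞ q(x,a) · G(π_a x) da ≤ x + L, and for all x ≥ R: ∫₀^∞ q(x,a) · G(π_a x) da ≤ x − 2L. -/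
open MeasureTheory Filter

/-- Under (A5) and with `G(x) ≤ x + L` (assumption (C2)) and
`π_ε x - x → -∞` as `x → ∞` (a consequence of (C1)), there exists `R > 0` such that
`∫₀^∞ q(x,a) G(π_a x) da ≤ x + L` for all `x > 0` and
`∫₀^∞ q(x,a) G(π_a x) da ≤ x - 2L` for all `x ≥ R`. -/
theorem stmt_11 (F : ℝ → ℝ) (hF : ContDiffOn ℝ 1 F (Set.Ici 0)) (hF0 : F 0 = 0)
    (hFneg : ∀ x : ℝ, 0 < x → F x < 0)
    (π : ℝ → ℝ → ℝ)
    (hπ0 : ∀ x : ℝ, 0 ≤ x → π 0 x = x)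
    (hπode : ∀ x : ℝ, 0 ≤ x → ∀ t : ℝ, 0 ≤ t →
      HasDerivWithinAt (fun s => π s x) (F (π t x)) (Set.Ici 0) t)
    (hπpos : ∀ t : ℝ, 0 ≤ t → ∀ x : ℝ, 0 < x → 0 < π t x)
    (G : ℝ → ℝ) (hGmeas : Measurable G)
    (hGpos : ∀ x : ℝ, 0 ≤ x → 0 < G x)
    (L : ℝ) (hL : 0 < L)
    (hGL : ∀ x : ℝ, 0 ≤ x → G x ≤ x + L)
    (q : ℝ → ℝ → ℝ)
    (hqmeas : ∀ x : ℝ, 0 ≤ x → Measurable (q x))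
    (hqnn : ∀ x a : ℝ, 0 ≤ x → 0 ≤ a → 0 ≤ q x a)
    (hqint : ∀ x : ℝ, 0 ≤ x → IntegrableOn (q x) (Set.Ioi 0))
    (hqdens : ∀ x : ℝ, 0 ≤ x → ∫ a in Set.Ioi (0 : ℝ), q x a = 1)
    (ε : ℝ) (hε : 0 < ε)
    (hA5 : ∀ x : ℝ, 0 ≤ x → ∫ a in Set.Ioc (0 : ℝ) ε, q x a ≤ 1 - ε)
    (htail : Tendsto (fun x : ℝ => π ε x - x) atTop atBot) :
    ∃ R : ℝ, 0 < R ∧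
      (∀ x : ℝ, 0 < x →
        ∫ a in Set.Ioi (0 : ℝ), q x a * G (π a x) ≤ x + L) ∧
      (∀ x : ℝ, R ≤ x →
        ∫ a in Set.Ioi (0 : ℝ), q x a * G (π a x) ≤ x - 2 * L) := by
  have hanti : ∀ x : ℝ, 0 < x → AntitoneOn (fun s => π s x) (Set.Ici 0) := by
    intro x hx
    refine antitoneOn_of_hasDerivWithinAt_nonpos (f' := fun t => F (π t x)) (convex_Ici 0) ?_ ?_ ?_
    · intro t ht
      exact (hπode x hx.le t ht).continuousWithinAt
    · intro t ht
      have ht' : (0 : ℝ) ≤ t := interior_subset ht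
      exact (hπode x hx.le t ht').mono interior_subset
    · intro t ht
      have ht' : (0 : ℝ) ≤ t := interior_subset ht
      exact (hFneg _ (hπpos t ht' x hx)).le
  have hle : ∀ x : ℝ, 0 < x → ∀ a : ℝ, 0 ≤ a → G (π a x) ≤ x + L := by
    intro x hx a ha
    have h1 := hanti x hx (Set.mem_Ici.2 le_rfl) (Set.mem_Ici.2 ha) ha
    simp only [hπ0 x hx.le] at h1
    linarith [hGL _ (hπpos a ha x hx).le]
  have hnn : ∀ x : ℝ, 0 < x →
      0 ≤ᵐ[volume.restrict (Set.Ioi (0 : ℝ))] fun a => q x a * G (π a x) := by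
    intro x hx
    filter_upwards [ae_restrict_mem measurableSet_Ioi] with a ha
    have ha' : (0 : ℝ) ≤ a := le_of_lt ha
    exact mul_nonneg (hqnn x a hx.le ha') (hGpos _ (hπpos a ha' x hx).le).le
  obtain ⟨R, hR⟩ := (tendsto_atBot.1 htail (-(3 * L / ε))).exists_forall_of_atTop
  refine ⟨max R 1, by positivity, ?_, ?_⟩
  · intro x hx
    have h : ∫ a in Set.Ioi (0 : ℝ), q x a * G (π a x)
        ≤ ∫ a in Set.Ioi (0 : ℝ), q x a * (x + L) := by
      refine integral_mono_of_nonneg (hnn x hx) ((hqint x hx.le).mul_const _) ?_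
      filter_upwards [ae_restrict_mem measurableSet_Ioi] with a ha
      have ha' : (0 : ℝ) ≤ a := le_of_lt ha
      exact mul_le_mul_of_nonneg_left (hle x hx a ha') (hqnn x a hx.le ha')
    rw [integral_mul_const, hqdens x hx.le, one_mul] at h
    exact h
  · intro x hxR
    have hx : 0 < x := lt_of_lt_of_le one_pos ((le_max_right _ _).trans hxR)
    have hD := hR x ((le_max_left _ _).trans hxR)
    set D := 3 * L / ε with hDdef
    have hDε : D * ε = 3 * L := by rw [hDdef]; field_simp
    have hDpos : 0 < D := by positivity
    have hsub : Set.Ioi ε ⊆ Set.Ioi (0 : ℝ) := Set.Ioi_subset_Ioi hε.le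
    have hqε : IntegrableOn (q x) (Set.Ioi ε) := (hqint x hx.le).mono_set hsub
    have hsplit : ∫ a in Set.Ioi (0 : ℝ), q x a
        = (∫ a in Set.Ioc (0 : ℝ) ε, q x a) + ∫ a in Set.Ioi ε, q x a := by
      rw [← Set.Ioc_union_Ioi_eq_Ioi hε.le]
      exact setIntegral_union (Set.Ioc_disjoint_Ioi le_rfl) measurableSet_Ioi
        ((hqint x hx.le).mono_set Set.Ioc_subset_Ioi_self) hqε
    have hmass : ε ≤ ∫ a in Set.Ioi ε, q x a := by
      have := hA5 x hx.le
      have := hqdens x hx.le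
      linarith
    have hi2 : IntegrableOn ((Set.Ioi ε).indicator (q x)) (Set.Ioi 0) :=
      (hqint x hx.le).indicator measurableSet_Ioi
    have h : ∫ a in Set.Ioi (0 : ℝ), q x a * G (π a x)
        ≤ ∫ a in Set.Ioi (0 : ℝ), (q x a * (x + L) - (Set.Ioi ε).indicator (q x) a * D) := by
      refine integral_mono_of_nonneg (hnn x hx)
        (((hqint x hx.le).mul_const _).sub (hi2.mul_const _)) ?_
      filter_upwards [ae_restrict_mem measurableSet_Ioi] with a ha
      have ha' : (0 : ℝ) ≤ a := le_of_lt ha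
      have hq := hqnn x a hx.le ha'
      by_cases hae : a ∈ Set.Ioi ε
      · rw [Set.indicator_of_mem hae, ← mul_sub]
        refine mul_le_mul_of_nonneg_left ?_ hq
        have h1 := hanti x hx (Set.mem_Ici.2 hε.le) (Set.mem_Ici.2 ha') (le_of_lt hae)
        simp only at h1
        linarith [hGL _ (hπpos a ha' x hx).le]
      · rw [Set.indicator_of_notMem hae, zero_mul, sub_zero]
        exact mul_le_mul_of_nonneg_left (hle x hx a ha') hq
    rw [integral_sub ((hqint x hx.le).mul_const _) (hi2.mul_const _), integral_mul_const,
      integral_mul_const, hqdens x hx.le, one_mul, setIntegral_indicator measurableSet_Ioi,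
      Set.inter_eq_self_of_subset_right hsub] at h
    have := mul_le_mul_of_nonneg_right hmass hDpos.le
    linarith [mul_comm D ε]
end

section
/- Let F : [0,∞) → ℝ be C¹ with F(0) = 0 and F(x) < 0 for x > 0, let π denote the flow of x' = F(x), and let G : [0,∞) → (0,∞) be C¹. Fix x_b > 0, a ≥ 0, t₁ > 0, t₂ > 0, and set x̄ = π_{a+t₁} x_b and y = π_{t₂} G(x̄). Then the function s ↦ G(π_{t₂}(G(π_{a+s} x_b))) is differentiable at s = t₁ with derivative G'(y) F(y) · G'(x̄) F(x̄) / F(G(x̄)), while the function s ↦ G(π_s(G(π_{a+t₁} x_b))) is differentiable at s = t₂ with derivative G'(y) F(y). Consequently, if G'(y) F(y) ≠ 0, the difference of these two derivatives is nonzero if and only if F(x̄) G'(x̄) ≠ F(G(x̄)). -/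
open Set Filter Topology

/-- Flow differentiability in the initial point. -/
theorem flow_deriv_aux (F : ℝ → ℝ) (hF : ContDiffOn ℝ 1 F (Set.Ici 0))
    (hFneg : ∀ x : ℝ, 0 < x → F x < 0)
    (π : ℝ → ℝ → ℝ)
    (hπ0 : ∀ x : ℝ, 0 ≤ x → π 0 x = x)
    (hπode : ∀ x : ℝ, 0 ≤ x → ∀ t : ℝ, 0 ≤ t →
      HasDerivWithinAt (fun s => π s x) (F (π t x)) (Set.Ici 0) t)
    (hπpos : ∀ t : ℝ, 0 ≤ t → ∀ x : ℝ, 0 < x → 0 < π t x)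
    (t x : ℝ) (ht : 0 ≤ t) (hx : 0 < x) :
    HasDerivAt (fun z => π t z) (F (π t x) / F x) x := by
  have hc : ContinuousOn (fun u => (F u)⁻¹) (Ioi 0) := by
    refine ContinuousOn.inv₀ (hF.continuousOn.mono Ioi_subset_Ici_self) ?_
    intro u hu
    exact (hFneg u hu).ne
  obtain ⟨H, hH⟩ : ∃ H : ℝ → ℝ, ∀ u : ℝ, 0 < u → HasStrictDerivAt H (F u)⁻¹ u := by
    refine ⟨fun u => ∫ v in (1:ℝ)..u, (F v)⁻¹, fun u hu => ?_⟩
    refine intervalIntegral.integral_hasStrictDerivAt_right ?_ ?_ ?_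
    · apply ContinuousOn.intervalIntegrable
      apply hc.mono
      intro v hv
      rcases hv with ⟨hv, -⟩
      exact lt_of_lt_of_le (lt_min one_pos hu) hv
    · exact hc.stronglyMeasurableAtFilter isOpen_Ioi u hu
    · exact hc.continuousAt (Ioi_mem_nhds hu)
  have hanti : StrictAntiOn H (Ioi 0) := by
    apply strictAntiOn_of_deriv_neg (convex_Ioi 0)
    · intro u hu
      exact (hH u hu).hasDerivAt.continuousAt.continuousWithinAt
    · intro u hu
      rw [interior_Ioi] at hu
      rw [(hH u hu).hasDerivAt.deriv]
      exact inv_lt_zero.2 (hFneg u hu)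
  have hflow : ∀ z : ℝ, 0 < z → H (π t z) = H z + t := by
    intro z hz
    have hd : ∀ s : ℝ, 0 ≤ s →
        HasDerivWithinAt (fun s => H (π s z) - s) 0 (Ici 0) s := by
      intro s hs
      have hp := hπpos s hs z hz
      have h1 := ((hH _ hp).hasDerivAt.comp_hasDerivWithinAt s (hπode z hz.le s hs)).sub
        (hasDerivWithinAt_id s (Ici 0))
      rw [inv_mul_cancel₀ (hFneg _ hp).ne, sub_self] at h1
      exact h1
    have := constant_of_has_deriv_right_zero (f := fun s => H (π s z) - s) (a := 0) (b := t)
      (fun s hs => ((hd s hs.1).continuousWithinAt).mono Icc_subset_Ici_self)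
      (fun s hs => (hd s hs.1).mono (Ici_subset_Ici.2 hs.1)) t ⟨ht, le_rfl⟩
    simp only [hπ0 z hz.le] at this
    linarith
  have hp := hπpos t ht x hx
  have hne : (F (π t x))⁻¹ ≠ 0 := inv_ne_zero (hFneg _ hp).ne
  have hS := hH _ hp
  have hL := (hS.to_localInverse hne).hasDerivAt
  rw [inv_inv] at hL
  have hFd := hS.hasStrictFDerivAt_equiv hne
  have hr : ∀ᶠ w in 𝓝 (H (π t x)), H (hS.localInverse H _ _ hne w) = w :=
    hFd.eventually_right_inverse
  have himg : hS.localInverse H _ _ hne (H (π t x)) = π t x := hFd.localInverse_apply_image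
  have hpos : ∀ᶠ w in 𝓝 (H (π t x)), 0 < hS.localInverse H _ _ hne w := by
    apply hL.continuousAt.eventually
    rw [himg]
    exact Ioi_mem_nhds hp
  have hK : HasDerivAt (fun z => H z + t) (F x)⁻¹ x := (hH x hx).hasDerivAt.add_const t
  rw [hflow x hx] at hL hr hpos
  have hcomp := HasDerivAt.comp x hL hK
  rw [← div_eq_mul_inv] at hcomp
  refine hcomp.congr_of_eventuallyEq ?_
  filter_upwards [hK.continuousAt.eventually hr, hK.continuousAt.eventually hpos,
    Ioi_mem_nhds hx] with z h1 h2 h3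
  refine hanti.injOn (hπpos t ht z h3) h2 ?_
  rw [hflow z h3]
  exact h1.symm


/-- Derivative computation used for condition (K) of the immune-status
semigroup. With `x̄ = π_{a+t₁} x_b` and `y = π_{t₂} G(x̄)`, the map
`s ↦ G(π_{t₂}(G(π_{a+s} x_b)))` has derivative `G'(y)F(y)·G'(x̄)F(x̄)/F(G(x̄))` at
`s = t₁`, the map `s ↦ G(π_s(G(π_{a+t₁} x_b)))` has derivative `G'(y)F(y)` at
`s = t₂`, and (provided `G'(y)F(y) ≠ 0`) the difference of these derivatives is
nonzero iff `F(x̄)G'(x̄) ≠ F(G(x̄))`. -/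
theorem stmt_19 (F : ℝ → ℝ) (hF : ContDiffOn ℝ 1 F (Set.Ici 0)) (hF0 : F 0 = 0)
    (hFneg : ∀ x : ℝ, 0 < x → F x < 0)
    (π : ℝ → ℝ → ℝ)
    (hπ0 : ∀ x : ℝ, 0 ≤ x → π 0 x = x)
    (hπode : ∀ x : ℝ, 0 ≤ x → ∀ t : ℝ, 0 ≤ t →
      HasDerivWithinAt (fun s => π s x) (F (π t x)) (Set.Ici 0) t)
    (hπpos : ∀ t : ℝ, 0 ≤ t → ∀ x : ℝ, 0 < x → 0 < π t x)
    (G : ℝ → ℝ) (hG : ContDiffOn ℝ 1 G (Set.Ici 0))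
    (hGpos : ∀ x : ℝ, 0 ≤ x → 0 < G x)
    (xb a t₁ t₂ : ℝ) (hxb : 0 < xb) (ha : 0 ≤ a) (ht₁ : 0 < t₁) (ht₂ : 0 < t₂)
    (xbar y : ℝ) (hxbar : xbar = π (a + t₁) xb) (hy : y = π t₂ (G xbar)) :
    HasDerivAt (fun s : ℝ => G (π t₂ (G (π (a + s) xb))))
      (deriv G y * F y * (deriv G xbar * F xbar) / F (G xbar)) t₁ ∧
    HasDerivAt (fun s : ℝ => G (π s (G (π (a + t₁) xb)))) (deriv G y * F y) t₂ ∧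
    (deriv G y * F y ≠ 0 →
      (deriv G y * F y * (deriv G xbar * F xbar) / F (G xbar) - deriv G y * F y ≠ 0
        ↔ F xbar * deriv G xbar ≠ F (G xbar))) := by

  have hGd : ∀ u : ℝ, 0 < u → HasDerivAt G (deriv G u) u := fun u hu =>
    ((hG.differentiableOn one_ne_zero).differentiableAt (Ici_mem_nhds hu)).hasDerivAt
  have hxp : 0 < xbar := hxbar ▸ hπpos _ (by linarith) _ hxb
  have hgp := hGpos xbar hxp.le
  have hyp : 0 < y := hy ▸ hπpos _ ht₂.le _ hgp
  have hne := (hFneg _ hgp).ne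
  refine ⟨?_, ?_, ?_⟩
  · have h1 : HasDerivAt (fun s => π s xb) (F xbar) (a + t₁) := by
      rw [hxbar]
      exact (hπode xb hxb.le (a + t₁) (by linarith)).hasDerivAt (Ici_mem_nhds (by linarith))
    have h2 : HasDerivAt (fun s => π (a + s) xb) (F xbar) t₁ := h1.comp_const_add a t₁
    have h3 : HasDerivAt (fun s => G (π (a + s) xb)) (deriv G xbar * F xbar) t₁ :=
      HasDerivAt.comp_of_eq t₁ (hGd xbar hxp) h2 hxbar
    have h4 := flow_deriv_aux F hF hFneg π hπ0 hπode hπpos t₂ (G xbar) ht₂.le hgp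
    rw [← hy] at h4
    have h5 := HasDerivAt.comp_of_eq t₁ h4 h3 (by rw [hxbar])
    have h6 := HasDerivAt.comp_of_eq t₁ (hGd y hyp) h5 (by simp [hy, hxbar])
    refine HasDerivAt.congr_deriv h6 ?_
    ring
  · rw [← hxbar]
    have h1 : HasDerivAt (fun s => π s (G xbar)) (F y) t₂ := by
      rw [hy]
      exact (hπode _ hgp.le t₂ ht₂.le).hasDerivAt (Ici_mem_nhds ht₂)
    exact HasDerivAt.comp_of_eq t₂ (hGd y hyp) h1 hy
  · intro h
    apply not_congr
    rw [sub_eq_zero, div_eq_iff hne, mul_right_inj' h, mul_comm]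
end
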